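/- Let R be a commutative noetherian ring with a dualizing module D and finite Krull dimension d, and let G be a Gorenstein injective R-module. Then G has a finite filtration by submodules 0 = G_{d+1} ⊆ G_d ⊆ ⋯ ⊆ G_1 ⊆ G_0 = G such that every G_k is Gorenstein injective and, for each 0 ≤ k ≤ d, the quotient G_k/G_{k+1} is isomorphic to the direct sum ⊕_p Tor_k^R(E(R/p), Hom_R(D,G)) taken over all prime ideals p of R of height k, and each such quotient is Gorenstein injective. -/

import Mathlib

open CategoryTheory

universe u

/-- The `a`-torsion submodule `Γ_a(M) = {x ∈ M | a^n x = 0 for some n}`. -/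
def torsionGamma {R : Type u} [CommRing R] (a : Ideal R) (M : Type u)
    [AddCommGroup M] [Module R M] : Submodule R M :=
  ⨆ n : ℕ, Submodule.torsionBySet R M ((a ^ n : Ideal R) : Set R)

/-- Data witnessing that `G` is Gorenstein injective: a ℤ-indexed exact complex of
injective modules, remaining exact after `Hom_R(E', -)` for every injective `E'`,
with `G ≅ ker(E_0 → E_{-1})`. -/
structure GorensteinInjData (R : Type u) [CommRing R] (G : Type u)
    [AddCommGroup G] [Module R G] where
  E : ℤ → Type u
  [acg : ∀ i, AddCommGroup (E i)]
  [mod : ∀ i, Module R (E i)]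
  d : ∀ i : ℤ, E (i + 1) →ₗ[R] E i
  inj : ∀ i, Module.Injective R (E i)
  exact : ∀ i : ℤ, LinearMap.range (d (i + 1)) = LinearMap.ker (d i)
  homExact : ∀ (E' : Type u) [AddCommGroup E'] [Module R E'], Module.Injective R E' →
      ∀ (i : ℤ) (g : E' →ₗ[R] E (i + 1)),
        (d i).comp g = 0 ↔ ∃ f : E' →ₗ[R] E (i + 1 + 1), (d (i + 1)).comp f = g
  equiv : G ≃ₗ[R] LinearMap.ker (d (-1))

/-- An `R`-module `G` is Gorenstein injective. -/
def IsGorensteinInjective (R : Type u) [CommRing R] (G : Type u)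
    [AddCommGroup G] [Module R G] : Prop :=
  Nonempty (GorensteinInjData R G)

/-- Data witnessing that `M` is Gorenstein flat. -/
structure GorensteinFlatData (R : Type u) [CommRing R] (M : Type u)
    [AddCommGroup M] [Module R M] where
  F : ℤ → Type u
  [acg : ∀ i, AddCommGroup (F i)]
  [mod : ∀ i, Module R (F i)]
  d : ∀ i : ℤ, F (i + 1) →ₗ[R] F i
  flat : ∀ i, Module.Flat R (F i)
  exact : ∀ i : ℤ, LinearMap.range (d (i + 1)) = LinearMap.ker (d i)
  tensorExact : ∀ (E' : Type u) [AddCommGroup E'] [Module R E'], Module.Injective R E' →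
      ∀ i : ℤ, LinearMap.range (LinearMap.lTensor E' (d (i + 1)))
        = LinearMap.ker (LinearMap.lTensor E' (d i))
  equiv : M ≃ₗ[R] LinearMap.ker (d (-1))

/-- An `R`-module `M` is Gorenstein flat. -/
def IsGorensteinFlat (R : Type u) [CommRing R] (M : Type u)
    [AddCommGroup M] [Module R M] : Prop :=
  Nonempty (GorensteinFlatData R M)

/-- `E` is an injective hull of `M`: `E` is injective and admits an injective
linear map from `M` with essential image. -/
def IsInjectiveHull (R : Type u) [CommRing R] (M : Type u) [AddCommGroup M] [Module R M]
    (E : Type u) [AddCommGroup E] [Module R E] : Prop :=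
  Module.Injective R E ∧ ∃ f : M →ₗ[R] E, Function.Injective f ∧
    ∀ N : Submodule R E, N ≠ ⊥ → N ⊓ LinearMap.range f ≠ ⊥

/-- `D` is a dualizing module for `R`: finitely generated, of finite injective dimension,
the homothety map `R → Hom_R(D,D)` is bijective, and `Ext^i_R(D,D) = 0` for `i ≥ 1`. -/
def IsDualizingModule (R : Type u) [CommRing R] (D : Type u)
    [AddCommGroup D] [Module R D] : Prop :=
  Module.Finite R D ∧
  (∃ n : ℕ, ∀ (M : Type u) (_ : AddCommGroup M) (_ : Module R M), ∀ i : ℕ, n < i →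
      Limits.IsZero (((Ext R (ModuleCat.{u} R) i).obj
        (Opposite.op (ModuleCat.of R M))).obj (ModuleCat.of R D))) ∧
  Function.Bijective (fun r : R => (r • (LinearMap.id : D →ₗ[R] D))) ∧
  (∀ i : ℕ, 0 < i →
    Limits.IsZero (((Ext R (ModuleCat.{u} R) i).obj
      (Opposite.op (ModuleCat.of R D))).obj (ModuleCat.of R D)))

/-- The height of a prime ideal, as the `Order.height` of the corresponding
point of the prime spectrum. -/
noncomputable def idealHeight {R : Type u} [CommRing R] (p : Ideal R) (hp : p.IsPrime) : ℕ∞ :=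
  Order.height (⟨p, hp⟩ : PrimeSpectrum R)

set_option linter.all false

namespace GI
section S1
variable {R : Type u} [CommRing R]

/-- torsion supported in `W`. -/
def Gam (W : Set (PrimeSpectrum R)) (N : Type u) [AddCommGroup N] [Module R N] :
    Submodule R N where
  carrier := {y | ∀ p : PrimeSpectrum R, (∀ r : R, r • y = 0 → r ∈ p.asIdeal) → p ∈ W}
  zero_mem' := by
    intro p hp
    exact absurd (hp 1 (by simp)) ((Ideal.ne_top_iff_one _).1 p.isPrime.ne_top)
  add_mem' := by
    intro a b ha hb p hp
    by_contra hW
    have h1 : ¬ (∀ r : R, r • a = 0 → r ∈ p.asIdeal) := fun h => hW (ha p h)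
    have h2 : ¬ (∀ r : R, r • b = 0 → r ∈ p.asIdeal) := fun h => hW (hb p h)
    push Not at h1 h2
    obtain ⟨r, hr, hrp⟩ := h1
    obtain ⟨s, hs, hsp⟩ := h2
    have := hp (r * s) (by
      rw [smul_add, mul_smul, mul_smul, hs, smul_comm, hr]; simp)
    rcases p.isPrime.mem_or_mem this with h | h
    · exact hrp h
    · exact hsp h
  smul_mem' := by
    intro c x hx p hp
    exact hx p (fun r hr => hp r (by rw [smul_comm, hr, smul_zero]))

variable {N N' : Type u} [AddCommGroup N] [Module R N] [AddCommGroup N'] [Module R N']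

lemma mem_Gam {W : Set (PrimeSpectrum R)} {y : N} : y ∈ Gam W N ↔
    ∀ p : PrimeSpectrum R, (∀ r : R, r • y = 0 → r ∈ p.asIdeal) → p ∈ W := Iff.rfl

lemma Gam_map {W : Set (PrimeSpectrum R)} (f : N →ₗ[R] N') {y : N} (hy : y ∈ Gam W N) :
    f y ∈ Gam W N' := fun p hp => hy p (fun r hr => hp r (by rw [← map_smul, hr, map_zero]))

lemma Gam_of_inj {W : Set (PrimeSpectrum R)} (f : N →ₗ[R] N') (hf : Function.Injective f)
    {y : N} (hy : f y ∈ Gam W N') : y ∈ Gam W N :=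
  fun p hp => hy p (fun r hr => hp r (hf (by rw [map_smul, hr, map_zero])))

lemma Gam_inter {W W' : Set (PrimeSpectrum R)} {y : N} :
    y ∈ Gam (W ∩ W') N ↔ y ∈ Gam W N ∧ y ∈ Gam W' N :=
  ⟨fun h => ⟨fun p hp => (h p hp).1, fun p hp => (h p hp).2⟩,
   fun h p hp => ⟨h.1 p hp, h.2 p hp⟩⟩

lemma Gam_mono {W W' : Set (PrimeSpectrum R)} (h : W ⊆ W') : Gam W N ≤ Gam W' N :=
  fun _ hy p hp => h (hy p hp)

/-- closed set of one element -/
def Vx (x : R) : Set (PrimeSpectrum R) := {p | x ∈ p.asIdeal}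

lemma mem_Gam_Vx {x : R} {y : N} : y ∈ Gam (Vx x) N ↔ ∃ n : ℕ, x ^ n • y = 0 := by
  constructor
  · intro h
    have : x ∈ Ideal.radical (LinearMap.ker (LinearMap.toSpanSingleton R N y) : Ideal R) := by
      rw [Ideal.radical_eq_sInf, Ideal.mem_sInf]
      rintro J ⟨hJ, hp⟩
      exact h ⟨J, hp⟩ (fun r hr => hJ (by simpa using hr))
    obtain ⟨n, hn⟩ := this
    exact ⟨n, by simpa using hn⟩
  · rintro ⟨n, hn⟩ p hp
    exact p.isPrime.mem_of_pow_mem n (hp _ hn)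

def PNull (p : Ideal R) (N : Type u) [AddCommGroup N] [Module R N] : Prop :=
  ∀ m : N, ∃ s, s ∉ p ∧ s • m = 0

section hull
variable {q : PrimeSpectrum R} {E : Type u} [AddCommGroup E] [Module R E]

lemma hull_ess (h : IsInjectiveHull R (R ⧸ q.asIdeal) E) : ∃ f : (R ⧸ q.asIdeal) →ₗ[R] E,
    Function.Injective f ∧ ∀ y : E, y ≠ 0 → ∃ r : R, ∃ a : R, a ∉ q.asIdeal ∧
      r • y = f (Ideal.Quotient.mk _ a) := by
  obtain ⟨_, f, hf, he⟩ := h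
  refine ⟨f, hf, fun y hy => ?_⟩
  have := he (R ∙ y) (by simpa using hy)
  obtain ⟨z, hz, hz0⟩ := Submodule.exists_mem_ne_zero_of_ne_bot this
  obtain ⟨r, hr⟩ := Submodule.mem_span_singleton.1 hz.1
  obtain ⟨b, hb⟩ := hz.2
  obtain ⟨a, rfl⟩ := Ideal.Quotient.mk_surjective b
  refine ⟨r, a, fun ha => hz0 ?_, hr.trans hb.symm⟩
  rw [← hb, Ideal.Quotient.eq_zero_iff_mem.2 ha, map_zero]

lemma smul_quot (f : (R ⧸ q.asIdeal) →ₗ[R] E) (hf : Function.Injective f) (s a : R) :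
    s • f (Ideal.Quotient.mk _ a) = 0 ↔ s ∈ q.asIdeal ∨ a ∈ q.asIdeal := by
  rw [← map_smul, map_eq_zero_iff f hf, ← q.isPrime.mul_mem_iff_mem_or_mem]
  exact Ideal.Quotient.eq_zero_iff_mem

lemma hull_inj (h : IsInjectiveHull R (R ⧸ q.asIdeal) E) {s : R} (hs : s ∉ q.asIdeal)
    {x : E} (hx : s • x = 0) : x = 0 := by
  obtain ⟨f, hf, he⟩ := hull_ess h
  by_contra hx0
  obtain ⟨r, a, ha, hr⟩ := he x hx0
  have := (smul_quot f hf s a).1 (by rw [← hr, smul_comm, hx, smul_zero])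
  tauto

lemma hull_surj (h : IsInjectiveHull R (R ⧸ q.asIdeal) E) {s : R} (hs : s ∉ q.asIdeal)
    (x : E) : ∃ y, s • y = x := by
  obtain ⟨f, hf, he⟩ := hull_ess h
  have hinj : Function.Injective (s • (LinearMap.id : E →ₗ[R] E)) := by
    rw [← LinearMap.ker_eq_bot, LinearMap.ker_eq_bot']
    intro m hm
    exact hull_inj h hs (by simpa using hm)
  obtain ⟨r, hr⟩ := h.1.out _ hinj LinearMap.id
  have hr' : ∀ y, r (s • y) = y := fun y => by simpa using hr y
  have hk : ∀ z, r z = 0 → z = 0 := by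
    intro z hz
    by_contra hz0
    obtain ⟨t, a, ha, hta⟩ := he z hz0
    have h1 : r (s • (t • z)) = t • z := hr' _
    rw [map_smul, map_smul, hz, smul_zero, smul_zero] at h1
    have h2 := (smul_quot f hf 1 a).1 (by rw [one_smul, ← hta, h1])
    rcases h2 with h2 | h2
    · exact (Ideal.ne_top_iff_one _).1 q.isPrime.ne_top h2
    · exact ha h2
  refine ⟨r x, sub_eq_zero.1 (hk _ ?_)⟩
  rw [map_sub, hr', sub_self]

lemma hull_nil [IsNoetherianRing R] (h : IsInjectiveHull R (R ⧸ q.asIdeal) E) {a : R}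
    (ha : a ∈ q.asIdeal) (x : E) : ∃ n : ℕ, a ^ n • x = 0 := by
  obtain ⟨f, hf, he⟩ := hull_ess h
  let K : ℕ →o Ideal R := ⟨fun n => LinearMap.ker (LinearMap.toSpanSingleton R E (a ^ n • x)), by
    apply monotone_nat_of_le_succ
    intro n r hr
    simp only [LinearMap.mem_ker, LinearMap.toSpanSingleton_apply] at hr ⊢
    rw [pow_succ, mul_comm, mul_smul, smul_comm, hr, smul_zero]⟩
  obtain ⟨n, hn⟩ := monotone_stabilizes_iff_noetherian.2 (inferInstance : IsNoetherian R R) K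
  refine ⟨n, ?_⟩
  by_contra hx0
  obtain ⟨r, b, hb, hr⟩ := he _ hx0
  have h1 : r ∈ K (n + 1) := by
    change r ∈ LinearMap.ker (LinearMap.toSpanSingleton R E (a ^ (n + 1) • x))
    rw [LinearMap.mem_ker, LinearMap.toSpanSingleton_apply, pow_succ, mul_comm, mul_smul,
      smul_comm, hr]
    exact (smul_quot f hf a b).2 (Or.inl ha)
  rw [← hn (n + 1) (by omega)] at h1
  have h2 : r • (a ^ n • x) = 0 := by
    simpa [K] using h1
  rw [h2] at hr
  have := (smul_quot f hf 1 b).1 (by rw [one_smul, ← hr])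
  rcases this with h2 | h2
  · exact (Ideal.ne_top_iff_one _).1 q.isPrime.ne_top h2
  · exact hb h2

end hull
end S1
end GI

namespace GI
section S1b
open scoped Classical
variable {R : Type u} [CommRing R] [IsNoetherianRing R]

lemma dfinsupp_injective {ι : Type u} (E : ι → Type u) [∀ i, AddCommGroup (E i)]
    [∀ i, Module R (E i)] (hE : ∀ i, Module.Injective R (E i)) :
    Module.Injective R (Π₀ i, E i) := by
  apply Module.Baer.injective
  intro I g
  have hfg : (⊤ : Submodule R I).FG := Module.Finite.fg_top
  obtain ⟨S, hS⟩ := hfg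
  have h1 : ∀ i, ∃ e : E i, ∀ x : I, (x : R) • e = g x i := by
    intro i
    obtain ⟨h, hh⟩ := Module.Baer.iff_injective.2 (hE i) I ((DFinsupp.lapply i).comp g)
    refine ⟨h 1, fun x => ?_⟩
    rw [← map_smul, smul_eq_mul, mul_one, hh _ x.2]
    rfl
  choose e he using h1
  let F : Finset ι := S.biUnion (fun x => (g x).support)
  have hF : ∀ i, i ∉ F → ∀ x, g x i = 0 := by
    intro i hi x
    have : (⊤ : Submodule R I) ≤ LinearMap.ker ((DFinsupp.lapply i).comp g) := by
      rw [← hS, Submodule.span_le]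
      intro y hy
      by_contra h
      apply hi
      rw [Finset.mem_biUnion]
      exact ⟨y, hy, by simpa using h⟩
    exact this (Submodule.mem_top : x ∈ _)
  refine ⟨LinearMap.toSpanSingleton R _ (DFinsupp.mk F (fun i => e i)), fun x hx => ?_⟩
  ext i
  simp only [LinearMap.toSpanSingleton_apply, DFinsupp.smul_apply, DFinsupp.mk_apply]
  split_ifs with h
  · exact he i ⟨x, hx⟩
  · rw [smul_zero, hF i h]

lemma ess_dfinsupp {ι : Type u} {A E : ι → Type u} [∀ i, AddCommGroup (E i)]
    [∀ i, Module R (E i)] [∀ i, AddCommGroup (A i)]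
    [∀ i, Module R (A i)] (f : ∀ i, A i →ₗ[R] E i)
    (hf : ∀ i, ∀ y : E i, y ≠ 0 → ∃ r : R, r • y ≠ 0 ∧ r • y ∈ LinearMap.range (f i)) :
    ∀ (n : ℕ) (y : Π₀ i, E i), y ≠ 0 →
      (y.support.filter (fun i => y i ∉ LinearMap.range (f i))).card ≤ n →
      ∃ r : R, r • y ≠ 0 ∧ r • y ∈ LinearMap.range (DFinsupp.mapRange.linearMap f) := by
  intro n
  induction n with
  | zero =>
    intro y hy hc
    refine ⟨1, by simpa using hy, ?_⟩
    rw [one_smul]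
    have hr : ∀ i, ∃ a, f i a = y i := by
      intro i
      by_contra h
      have hi : i ∈ y.support.filter (fun i => y i ∉ LinearMap.range (f i)) := by
        rw [Finset.mem_filter]
        refine ⟨?_, h⟩
        rw [DFinsupp.mem_support_iff]
        intro h0
        exact h ⟨0, by rw [map_zero, h0]⟩
      rw [Finset.card_eq_zero.1 (Nat.le_zero.1 hc)] at hi
      simp at hi
    choose a ha using hr
    refine ⟨DFinsupp.mk y.support (fun i => a i), ?_⟩
    ext i
    simp only [DFinsupp.mapRange.linearMap_apply, DFinsupp.mapRange_apply, DFinsupp.mk_apply]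
    split_ifs with h
    · exact ha i
    · rw [map_zero]; simpa using (DFinsupp.notMem_support_iff.1 h).symm
  | succ n ih =>
    intro y hy hc
    by_cases hall : ∀ i, y i ∈ LinearMap.range (f i)
    · apply ih y hy
      rw [Finset.filter_false_of_mem (fun i _ => by simpa using hall i)]
      simp
    · push Not at hall
      obtain ⟨i, hi⟩ := hall
      have hi0 : y i ≠ 0 := fun h => hi (by rw [h]; exact zero_mem _)
      obtain ⟨r, hr0, hr⟩ := hf i _ hi0
      have hry : r • y ≠ 0 := fun h => hr0 (by rw [← DFinsupp.smul_apply, h]; rfl)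
      obtain ⟨s, hs⟩ := ih (r • y) hry (by
        have hlt : ((r • y).support.filter (fun i => (r • y) i ∉ LinearMap.range (f i)))
            ⊂ (y.support.filter (fun i => y i ∉ LinearMap.range (f i))) := by
          rw [Finset.ssubset_iff_of_subset]
          · refine ⟨i, ?_, ?_⟩
            · rw [Finset.mem_filter]; exact ⟨by simpa using hi0, hi⟩
            · rw [Finset.mem_filter]
              rintro ⟨_, h⟩
              exact h (by simpa using hr)
          · intro j hj
            rw [Finset.mem_filter] at hj ⊢
            refine ⟨?_, fun h => hj.2 (Submodule.smul_mem _ r h)⟩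
            rw [DFinsupp.mem_support_iff]
            intro h0
            apply hj.2
            rw [DFinsupp.smul_apply, h0, smul_zero]
            exact zero_mem _
        have := Finset.card_lt_card hlt
        omega)
      exact ⟨s * r, by rw [mul_smul]; exact hs.1, by rw [mul_smul]; exact hs.2⟩

lemma ess_dfinsupp' {ι : Type u} {A E : ι → Type u} [∀ i, AddCommGroup (E i)]
    [∀ i, Module R (E i)] [∀ i, AddCommGroup (A i)]
    [∀ i, Module R (A i)] (f : ∀ i, A i →ₗ[R] E i)
    (hf : ∀ i, ∀ y : E i, y ≠ 0 → ∃ r : R, r • y ≠ 0 ∧ r • y ∈ LinearMap.range (f i))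
    (y : Π₀ i, E i) (hy : y ≠ 0) :
      ∃ r : R, r • y ≠ 0 ∧ r • y ∈ LinearMap.range (DFinsupp.mapRange.linearMap f) :=
  ess_dfinsupp f hf _ y hy le_rfl

lemma exists_prime_in {N : Type u} [AddCommGroup N] [Module R N] (K : Submodule R N)
    (hK : K ≠ ⊥) : ∃ q : PrimeSpectrum R, ∃ f : (R ⧸ q.asIdeal) →ₗ[R] N,
      Function.Injective f ∧ LinearMap.range f ≤ K := by
  have : Nontrivial K := Submodule.nontrivial_iff_ne_bot.2 hK
  obtain ⟨p, hp⟩ := associatedPrimes.nonempty R K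
  obtain ⟨h1, f, hf⟩ := (isAssociatedPrime_iff_exists_injective_linearMap _ _).1 hp
  refine ⟨⟨p, h1⟩, K.subtype.comp f, (Subtype.val_injective).comp hf, ?_⟩
  rintro _ ⟨x, rfl⟩
  exact (f x).2

lemma sSupIndep_insert {N : Type u} [AddCommGroup N] [Module R N] {S : Set (Submodule R N)}
    (hS : sSupIndep S) {C : Submodule R N} (hC : Disjoint C (sSup S)) :
    sSupIndep (insert C S) := by
  intro a ha
  by_cases haC : a = C
  · subst haC
    exact hC.mono_right (sSup_le_sSup (by rintro x ⟨h | h, h'⟩; exacts [absurd h h', h]))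
  · have haS : a ∈ S := by rcases ha with h | h; exacts [absurd h haC, h]
    have h1 : Disjoint a (sSup (S \ {a})) := hS haS
    have h2 : Disjoint (a ⊔ sSup (S \ {a})) C :=
      (hC.mono_right (sup_le (le_sSup haS) (sSup_le_sSup Set.sdiff_subset))).symm
    refine (h1.disjoint_sup_right_of_disjoint_sup_left h2).mono_right (sSup_le ?_)
    intro b hb
    obtain ⟨h | h, h'⟩ := hb
    · subst h; exact le_sup_right
    · exact le_trans (le_sSup (show b ∈ S \ {a} from ⟨h, h'⟩)) le_sup_left

variable (Efam : PrimeSpectrum R → Type u) [∀ p, AddCommGroup (Efam p)]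
    [∀ p, Module R (Efam p)]

theorem exists_hull (hE : ∀ p : PrimeSpectrum R, IsInjectiveHull R (R ⧸ p.asIdeal) (Efam p))
    (N : Type u) [AddCommGroup N] [Module R N] :
    ∃ (ι : Type u) (q : ι → PrimeSpectrum R) (f : N →ₗ[R] Π₀ i, Efam (q i)),
      Function.Injective f ∧
      ∀ y : Π₀ i, Efam (q i), y ≠ 0 → ∃ r : R, r • y ≠ 0 ∧ r • y ∈ LinearMap.range f := by
  let P : Set (Set (Submodule R N)) := {S | sSupIndep S ∧ ∀ C ∈ S, ∃ q : PrimeSpectrum R,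
    ∃ f : (R ⧸ q.asIdeal) →ₗ[R] N, Function.Injective f ∧ LinearMap.range f = C}
  obtain ⟨S, hS⟩ := zorn_subset P (by
    intro c hc hch
    refine ⟨⋃₀ c, ⟨?_, ?_⟩, fun s hs => Set.subset_sUnion_of_mem hs⟩
    · rw [Set.sUnion_eq_iUnion]
      exact sSupIndep_iUnion_of_directed hch.directedOn.directed_val
        (fun i => (hc i.2).1)
    · rintro C ⟨s, hs, hC⟩
      exact (hc hs).2 C hC)
  obtain ⟨⟨hSi, hSq⟩, hmax⟩ := hS
  have hq : ∀ C : S, ∃ q : PrimeSpectrum R,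
    ∃ f : (R ⧸ q.asIdeal) →ₗ[R] N, Function.Injective f ∧ LinearMap.range f = C.1 :=
    fun C => hSq C.1 C.2
  choose q g hg hgr using hq
  have hess := fun C : S => hull_ess (hE (q C))
  choose h hh hhe using hess
  let G : (Π₀ C : S, R ⧸ (q C).asIdeal) →ₗ[R] N := DFinsupp.lsum ℕ g
  have hG : Function.Injective G := by
    have h1 := ((sSupIndep_iff S).1 hSi).dfinsupp_lsum_injective
    let e : ∀ C : S, (R ⧸ (q C).asIdeal) →ₗ[R] C.1 := fun C =>
      (g C).codRestrict C.1 (fun x => by rw [← hgr C]; exact ⟨x, rfl⟩)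
    have h2 : G = (DFinsupp.lsum ℕ fun C : S => (C.1).subtype).comp
        (DFinsupp.mapRange.linearMap e) := by
      apply DFinsupp.lhom_ext
      intro C x
      simp [G, e]
    rw [h2, LinearMap.coe_comp]
    refine h1.comp ?_
    intro a b hab
    ext C
    have := DFunLike.congr_fun hab C
    simp only [DFinsupp.mapRange.linearMap_apply, DFinsupp.mapRange_apply] at this
    exact hg C (congrArg Subtype.val this)
  have hinj := dfinsupp_injective (R := R) (fun C : S => Efam (q C)) (fun C => (hE _).1)
  let H : (Π₀ C : S, R ⧸ (q C).asIdeal) →ₗ[R] (Π₀ C : S, Efam (q C)) :=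
    DFinsupp.mapRange.linearMap h
  have hH : Function.Injective H := by
    intro a b hab
    ext C
    have := DFunLike.congr_fun hab C
    simp only [H, DFinsupp.mapRange.linearMap_apply, DFinsupp.mapRange_apply] at this
    exact hh C this
  obtain ⟨f, hf⟩ := hinj.out G hG H
  have hGr : sSup S ≤ LinearMap.range G := by
    apply sSup_le
    intro C hC x hx
    replace hx : x ∈ (⟨C, hC⟩ : S).1 := hx
    rw [← hgr ⟨C, hC⟩] at hx
    obtain ⟨y, rfl⟩ := hx
    exact ⟨DFinsupp.single ⟨C, hC⟩ y, by simp [G]⟩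
  refine ⟨S, q, f, ?_, ?_⟩
  · rw [← LinearMap.ker_eq_bot]
    by_contra hk
    obtain ⟨q', f', hf', hr'⟩ := exists_prime_in _ hk
    have hd : Disjoint (LinearMap.range f') (sSup S) := by
      rw [Submodule.disjoint_def]
      intro x hx hx'
      obtain ⟨y, rfl⟩ := hGr hx'
      have := hr' hx
      rw [LinearMap.mem_ker, hf] at this
      rw [hH (this.trans (map_zero H).symm), map_zero]
    have hin : LinearMap.range f' ∈ S := by
      apply hmax (y := insert (LinearMap.range f') S) _ (Set.subset_insert _ _)
        (Set.mem_insert _ _)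
      refine ⟨sSupIndep_insert hSi hd, ?_⟩
      rintro C (rfl | hC)
      · exact ⟨q', f', hf', rfl⟩
      · exact hSq C hC
    have h0 : LinearMap.range f' = ⊥ := disjoint_self.1 (hd.mono_right (le_sSup hin))
    rw [LinearMap.range_eq_bot] at h0
    have : (Ideal.Quotient.mk q'.asIdeal 1) = 0 := hf' (by rw [h0]; rfl)
    rw [Ideal.Quotient.eq_zero_iff_mem] at this
    exact (Ideal.ne_top_iff_one _).1 q'.isPrime.ne_top this
  · intro y hy
    obtain ⟨r, hr0, x, hx⟩ := ess_dfinsupp' h (fun C y hy => by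
      obtain ⟨r, a, ha, hr⟩ := hhe C y hy
      refine ⟨r, ?_, _, hr.symm⟩
      rw [hr]
      intro h0
      apply ha
      rw [← Ideal.Quotient.eq_zero_iff_mem]
      exact hh C (h0.trans (map_zero _).symm)) y hy
    exact ⟨r, hr0, G x, by rw [hf]; exact hx⟩

theorem exists_decomp (hE : ∀ p : PrimeSpectrum R, IsInjectiveHull R (R ⧸ p.asIdeal) (Efam p))
    (N : Type u) [AddCommGroup N] [Module R N] (hN : Module.Injective R N) :
    ∃ (ι : Type u) (q : ι → PrimeSpectrum R), Nonempty (N ≃ₗ[R] Π₀ i, Efam (q i)) := by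
  obtain ⟨ι, q, f, hf, hess⟩ := exists_hull Efam hE N
  refine ⟨ι, q, ⟨LinearEquiv.ofBijective f ⟨hf, ?_⟩⟩⟩
  obtain ⟨r, hr⟩ := hN.out f hf LinearMap.id
  intro y
  refine ⟨r y, ?_⟩
  by_contra hne
  obtain ⟨c, hc0, x, hx⟩ := hess (f (r y) - y) (sub_ne_zero.2 hne)
  apply hc0
  have h1 : r (f x) = 0 := by
    rw [hx, map_smul, map_sub, hr]; simp
  rw [hr] at h1
  rw [← hx, show x = 0 from h1, map_zero]

end S1b
end GI

namespace GI
section S1c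
open scoped Classical
variable {R : Type u} [CommRing R] [IsNoetherianRing R]

def Stab (W : Set (PrimeSpectrum R)) : Prop := ∀ p q : PrimeSpectrum R, p ∈ W → p ≤ q → q ∈ W

lemma Stab_Vx (x : R) : Stab (Vx x) := fun _ _ hp h => h hp

lemma Stab.inter {W W' : Set (PrimeSpectrum R)} (h : Stab W) (h' : Stab W') : Stab (W ∩ W') :=
  fun p q hp hq => ⟨h p q hp.1 hq, h' p q hp.2 hq⟩

lemma Gam_dfinsupp {ι : Type u} (E : ι → Type u) [∀ i, AddCommGroup (E i)]
    [∀ i, Module R (E i)] {W : Set (PrimeSpectrum R)} {y : Π₀ i, E i} :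
    y ∈ Gam W (Π₀ i, E i) ↔ ∀ i, y i ∈ Gam W (E i) := by
  constructor
  · intro h i
    exact Gam_map (DFinsupp.lapply i : (Π₀ i, E i) →ₗ[R] E i) h
  · intro h
    rw [← DFinsupp.sum_single (f := y)]
    exact Submodule.sum_mem _ (fun i _ => Gam_map (DFinsupp.lsingle i : E i →ₗ[R] _) (h i))

variable {q : PrimeSpectrum R} {E : Type u} [AddCommGroup E] [Module R E]

lemma Gam_hull_mem (h : IsInjectiveHull R (R ⧸ q.asIdeal) E) {W : Set (PrimeSpectrum R)}
    (hW : Stab W) (hq : q ∈ W) (y : E) : y ∈ Gam W E := by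
  intro p hp
  refine hW q p hq (fun a ha => ?_)
  obtain ⟨n, hn⟩ := hull_nil h ha y
  exact p.isPrime.mem_of_pow_mem n (hp _ hn)

lemma Gam_hull_eq_zero (h : IsInjectiveHull R (R ⧸ q.asIdeal) E) {W : Set (PrimeSpectrum R)}
    (hq : q ∉ W) {y : E} (hy : y ∈ Gam W E) : y = 0 := by
  by_contra h0
  exact hq (hy q (fun r hr => by
    by_contra hrq
    exact h0 (hull_inj h hrq hr)))

lemma inj_retract {A N : Type u} [AddCommGroup A] [Module R A] [AddCommGroup N] [Module R N]
    (hN : Module.Injective R N) (i : A →ₗ[R] N) (r : N →ₗ[R] A) (h : ∀ a, r (i a) = a) :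
    Module.Injective R A := by
  constructor
  intro X Y _ _ _ _ f hf g
  obtain ⟨k, hk⟩ := hN.out f hf (i.comp g)
  exact ⟨r.comp k, fun x => by simp [hk, h]⟩

variable (Efam : PrimeSpectrum R → Type u) [∀ p, AddCommGroup (Efam p)]
    [∀ p, Module R (Efam p)]
variable (hE : ∀ p : PrimeSpectrum R, IsInjectiveHull R (R ⧸ p.asIdeal) (Efam p))
variable (N : Type u) [AddCommGroup N] [Module R N] (hN : Module.Injective R N)
include hE hN

theorem J1 (W : Set (PrimeSpectrum R)) (hW : Stab W) : ∃ π : N →ₗ[R] N,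
    (∀ y, π y ∈ Gam W N) ∧ ∀ y ∈ Gam W N, π y = y := by
  obtain ⟨ι, q, ⟨e⟩⟩ := exists_decomp Efam hE N hN
  let ρ : (Π₀ i, Efam (q i)) →ₗ[R] (Π₀ i, Efam (q i)) :=
    DFinsupp.mapRange.linearMap (fun i => if q i ∈ W then LinearMap.id else 0)
  have hρ : ∀ y i, ρ y i = if q i ∈ W then y i else 0 := by
    intro y i
    simp only [ρ, DFinsupp.mapRange.linearMap_apply, DFinsupp.mapRange_apply]
    split_ifs <;> rfl
  refine ⟨e.symm.toLinearMap.comp (ρ.comp e.toLinearMap), fun y => ?_, fun y hy => ?_⟩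
  · refine Gam_map e.symm.toLinearMap ((Gam_dfinsupp _).2 fun i => ?_)
    simp only [LinearMap.comp_apply, LinearEquiv.coe_coe, hρ]
    split_ifs with h
    · exact Gam_hull_mem (hE _) hW h _
    · exact zero_mem _
  · simp only [LinearMap.comp_apply, LinearEquiv.coe_coe]
    rw [LinearEquiv.symm_apply_eq]
    ext i
    rw [hρ]
    split_ifs with h
    · rfl
    · exact (Gam_hull_eq_zero (hE _) h ((Gam_dfinsupp _).1 (Gam_map e.toLinearMap hy) i)).symm

theorem J2 (x : R) : ∃ ψ : N →ₗ[R] N, ∀ y, y - x • ψ y ∈ Gam (Vx x) N := by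
  obtain ⟨ι, q, ⟨e⟩⟩ := exists_decomp Efam hE N hN
  have h1 : ∀ p : PrimeSpectrum R, ∃ ψ : Efam p →ₗ[R] Efam p,
      ∀ y, y - x • ψ y ∈ Gam (Vx x) (Efam p) := by
    intro p
    by_cases hx : x ∈ p.asIdeal
    · exact ⟨0, fun y => Gam_hull_mem (hE p) (Stab_Vx x) hx _⟩
    · let m : Efam p ≃ₗ[R] Efam p := LinearEquiv.ofBijective (x • LinearMap.id)
        ⟨(injective_iff_map_eq_zero _).2 fun a ha => hull_inj (hE p) hx (by simpa using ha),
         fun y => by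
          obtain ⟨z, hz⟩ := hull_surj (hE p) hx y
          exact ⟨z, by simpa using hz⟩⟩
      refine ⟨m.symm.toLinearMap, fun y => ?_⟩
      have : x • m.symm y = m (m.symm y) := rfl
      rw [LinearEquiv.coe_coe, this, LinearEquiv.apply_symm_apply, sub_self]
      exact zero_mem _
  choose ψ hψ using h1
  let ρ : (Π₀ i, Efam (q i)) →ₗ[R] (Π₀ i, Efam (q i)) :=
    DFinsupp.mapRange.linearMap (fun i => ψ (q i))
  refine ⟨e.symm.toLinearMap.comp (ρ.comp e.toLinearMap), fun y => ?_⟩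
  apply Gam_of_inj e.toLinearMap e.injective
  rw [Gam_dfinsupp]
  intro i
  have := hψ (q i) (e y i)
  simpa [ρ] using this

theorem J3 (W : Set (PrimeSpectrum R)) (p : PrimeSpectrum R) (hp : ∀ q ∈ W, q ≤ p → q = p)
    (s : R) (hs : s ∉ p.asIdeal) (y : N) (hy : y ∈ Gam W N) :
    ∃ y' ∈ Gam {q | p ≤ q} N, ∃ t, t ∉ p.asIdeal ∧ t • (y - s • y') = 0 := by
  obtain ⟨ι, q, ⟨e⟩⟩ := exists_decomp Efam hE N hN
  have hst : Stab {q | p ≤ q} := fun a b ha hb => le_trans ha hb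
  have h1 : ∀ q, ∀ y ∈ Gam W (Efam q),
      ∃ y' ∈ Gam {q | p ≤ q} (Efam q), ∃ t, t ∉ p.asIdeal ∧ t • (y - s • y') = 0 := by
    intro q y hy
    by_cases hqp : q = p
    · subst hqp
      obtain ⟨z, hz⟩ := hull_surj (hE q) hs y
      exact ⟨z, Gam_hull_mem (hE q) hst (le_refl q) z, 1,
        (Ideal.ne_top_iff_one _).1 q.isPrime.ne_top, by rw [hz]; simp⟩
    · refine ⟨0, zero_mem _, ?_⟩
      by_cases hqW : q ∈ W
      · have : ¬ q ≤ p := fun h => hqp (hp q hqW h)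
        obtain ⟨a, ha, hap⟩ := Set.not_subset.1 this
        obtain ⟨n, hn⟩ := hull_nil (hE q) ha y
        exact ⟨a ^ n, fun h => hap (p.isPrime.mem_of_pow_mem n h), by simpa using hn⟩
      · exact ⟨1, (Ideal.ne_top_iff_one _).1 p.isPrime.ne_top,
          by rw [Gam_hull_eq_zero (hE q) hqW hy]; simp⟩
  have h2 : ∀ y : Π₀ i, Efam (q i), (∀ i, y i ∈ Gam W (Efam (q i))) →
      ∃ y' ∈ Gam {q | p ≤ q} (Π₀ i, Efam (q i)), ∃ t, t ∉ p.asIdeal ∧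
        t • (y - s • y') = 0 := by
    intro y
    induction y using DFinsupp.induction with
    | h0 => exact fun _ => ⟨0, zero_mem _, 1,
        (Ideal.ne_top_iff_one _).1 p.isPrime.ne_top, by simp⟩
    | ha i b f hfi hb ih =>
      intro hall
      have hb' : b ∈ Gam W (Efam (q i)) := by simpa [hfi] using hall i
      have hf' : ∀ j, f j ∈ Gam W (Efam (q j)) := by
        intro j
        by_cases hj : i = j
        · subst hj; rw [hfi]; exact zero_mem _
        · simpa [DFinsupp.single_apply, hj] using hall j
      obtain ⟨u, hu, t, ht, htu⟩ := ih hf'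
      obtain ⟨v, hv, t', ht', htv⟩ := h1 (q i) b hb'
      refine ⟨DFinsupp.single i v + u, add_mem (Gam_map (N' := Π₀ i, Efam (q i))
        (DFinsupp.lsingle (R := R) (M := fun i => Efam (q i)) i) hv) hu, t' * t, fun h => ?_, ?_⟩
      · exact (p.isPrime.mem_or_mem h).elim ht' ht
      · have e1 : (DFinsupp.single i b + f) - s • (DFinsupp.single i v + u) =
          DFinsupp.single i (b - s • v) + (f - s • u) := by
          rw [DFinsupp.single_sub, DFinsupp.single_smul, smul_add]; abel
        have e2 : (t' * t) • (f - s • u) = 0 := by rw [mul_smul, htu, smul_zero]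
        rw [e1, smul_add, e2, add_zero, mul_comm, mul_smul,
          ← DFinsupp.single_smul, htv, DFinsupp.single_zero, smul_zero]
  obtain ⟨y', hy', t, ht, hty⟩ := h2 (e y) ((Gam_dfinsupp _).1 (Gam_map e.toLinearMap hy))
  refine ⟨e.symm y', Gam_map e.symm.toLinearMap hy', t, ht, e.injective ?_⟩
  simpa using hty

end S1c
end GI

namespace GI
section cmp
variable {R : Type u} [CommRing R]

lemma ext_cmp (X Y : ModuleCat.{u} R) (n : ℕ)
    (h : Limits.IsZero (((Ext R (ModuleCat.{u} R) (n + 1)).obj (Opposite.op X)).obj Y))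
    (e : Abelian.Ext.{u} X Y (n + 1)) : e = 0 := by
  let P : ProjectiveResolution X := Classical.choice (HasProjectiveResolution.out)
  have h1 := Limits.IsZero.of_iso h (P.isoExt (R := R) (n + 1) Y).symm
  rw [← HomologicalComplex.exactAt_iff_isZero_homology,
    HomologicalComplex.exactAt_iff' _ n (n + 1) (n + 2) (by simp) (by simp),
    ShortComplex.moduleCat_exact_iff] at h1
  obtain ⟨f, hf, rfl⟩ := P.extMk_surjective e (n + 2) rfl
  rw [P.extMk_eq_zero_iff f (n + 2) rfl hf n rfl]
  obtain ⟨g, hg⟩ := h1 f hf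
  exact ⟨g, hg⟩

lemma hasInj (D : Type u) [AddCommGroup D] [Module R D] (hD : IsDualizingModule R D) :
    ∃ n : ℕ, HasInjectiveDimensionLT (ModuleCat.of R D) n := by
  obtain ⟨n, hn⟩ := hD.2.1
  refine ⟨n + 1, HasInjectiveDimensionLT.mk (fun i hi Y e => ?_)⟩
  obtain ⟨j, rfl⟩ : ∃ j, i = j + 1 := ⟨i - 1, by omega⟩
  exact ext_cmp _ _ _ (hn Y inferInstance inferInstance (j + 1) (by omega)) e

lemma extDD (D : Type u) [AddCommGroup D] [Module R D] (hD : IsDualizingModule R D) (n : ℕ)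
    (e : Abelian.Ext.{u} (ModuleCat.of R D) (ModuleCat.of R D) (n + 1)) : e = 0 :=
  ext_cmp _ _ _ (hD.2.2.2 (n + 1) (by omega)) e

end cmp
end GI

namespace GI
section les
variable {R : Type u} [CommRing R]

abbrev EE (R : Type u) [CommRing R] (A Y : Type u) [AddCommGroup A] [Module R A]
    [AddCommGroup Y] [Module R Y] (n : ℕ) :=
  Abelian.Ext.{u} (ModuleCat.of R A) (ModuleCat.of R Y) n

variable {A B C Y Z : Type u} [AddCommGroup A] [Module R A] [AddCommGroup B] [Module R B]
  [AddCommGroup C] [Module R C] [AddCommGroup Y] [Module R Y] [AddCommGroup Z] [Module R Z]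

noncomputable def pre (f : A →ₗ[R] B) (Y : Type u) [AddCommGroup Y] [Module R Y] (n : ℕ) :
    EE R B Y n →ₗ[R] EE R A Y n where
  toFun x := (Abelian.Ext.mk₀ (ModuleCat.ofHom f)).comp x (zero_add n)
  map_add' x y := by simp
  map_smul' r x := by simp

noncomputable def post (A : Type u) [AddCommGroup A] [Module R A] (f : Y →ₗ[R] Z) (n : ℕ) :
    EE R A Y n →ₗ[R] EE R A Z n where
  toFun x := x.comp (Abelian.Ext.mk₀ (ModuleCat.ofHom f)) (add_zero n)
  map_add' x y := by simp
  map_smul' r x := by simp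

lemma pre_smul (r : R) (n : ℕ) (x : EE R A Y n) :
    pre (r • (LinearMap.id : A →ₗ[R] A)) Y n x = r • x := by
  change (Abelian.Ext.mk₀ (r • 𝟙 (ModuleCat.of R A))).comp x (zero_add n) = r • x
  rw [Abelian.Ext.mk₀_smul]
  simp

lemma post_smul (r : R) (n : ℕ) (x : EE R A Y n) :
    post A (r • (LinearMap.id : Y →ₗ[R] Y)) n x = r • x := by
  change x.comp (Abelian.Ext.mk₀ (r • 𝟙 (ModuleCat.of R Y))) (add_zero n) = r • x
  rw [Abelian.Ext.mk₀_smul]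
  simp

lemma shortExact_of (f : A →ₗ[R] B) (g : B →ₗ[R] C) (hf : Function.Injective f)
    (hg : Function.Surjective g) (h : Function.Exact f g) :
    (ShortComplex.mk (ModuleCat.ofHom f) (ModuleCat.ofHom g) (by
      ext x; exact h.apply_apply_eq_zero x)).ShortExact where
  exact := by
    rw [ShortComplex.moduleCat_exact_iff]
    intro x hx
    exact (h x).1 hx
  mono_f := (ModuleCat.mono_iff_injective _).2 hf
  epi_g := (ModuleCat.epi_iff_surjective _).2 hg

lemma les_contra (f : A →ₗ[R] B) (g : B →ₗ[R] C) (hf : Function.Injective f)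
    (hg : Function.Surjective g) (h : Function.Exact f g)
    (Y : Type u) [AddCommGroup Y] [Module R Y] (n : ℕ) :
    Function.Exact (pre g Y n) (pre f Y n) ∧
    ∃ δ : EE R A Y n →ₗ[R] EE R C Y (n + 1),
      Function.Exact (pre f Y n) δ ∧ Function.Exact δ (pre g Y (n + 1)) := by
  have hS := shortExact_of f g hf hg h
  refine ⟨?_, ⟨⟨⟨fun x => hS.extClass.comp x (add_comm 1 n), by simp⟩, by simp⟩, ?_, ?_⟩⟩
  · intro x
    constructor
    · intro hx
      exact Abelian.Ext.contravariant_sequence_exact₂ hS _ x hx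
    · rintro ⟨y, rfl⟩
      change (Abelian.Ext.mk₀ _).comp ((Abelian.Ext.mk₀ _).comp y (zero_add n)) (zero_add n) = 0
      rw [Abelian.Ext.mk₀_comp_mk₀_assoc]
      have : ModuleCat.ofHom f ≫ ModuleCat.ofHom g = 0 := by
        ext x; exact h.apply_apply_eq_zero x
      rw [this]; simp
  · intro x
    constructor
    · intro hx
      exact Abelian.Ext.contravariant_sequence_exact₁ hS _ x (add_comm 1 n) hx
    · rintro ⟨y, rfl⟩
      exact hS.extClass_comp_assoc y (h := add_comm 1 n)
  · intro x
    constructor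
    · intro hx
      exact Abelian.Ext.contravariant_sequence_exact₃ hS _ x hx (add_comm 1 n)
    · rintro ⟨y, rfl⟩
      exact hS.comp_extClass_assoc y (add_comm 1 n)

lemma les_cov (f : A →ₗ[R] B) (g : B →ₗ[R] C) (hf : Function.Injective f)
    (hg : Function.Surjective g) (h : Function.Exact f g)
    (X : Type u) [AddCommGroup X] [Module R X] (n : ℕ) :
    Function.Exact (post X f n) (post X g n) ∧
    ∃ δ : EE R X C n →ₗ[R] EE R X A (n + 1),
      Function.Exact (post X g n) δ ∧ Function.Exact δ (post X f (n + 1)) := by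
  have hS := shortExact_of f g hf hg h
  refine ⟨?_, ⟨⟨⟨fun x => x.comp hS.extClass rfl, by simp⟩, by simp⟩, ?_, ?_⟩⟩
  · intro x
    constructor
    · intro hx
      exact Abelian.Ext.covariant_sequence_exact₂ _ hS x hx
    · rintro ⟨y, rfl⟩
      change (y.comp (Abelian.Ext.mk₀ _) (add_zero n)).comp (Abelian.Ext.mk₀ _) (add_zero n) = 0
      rw [Abelian.Ext.comp_assoc_of_third_deg_zero, Abelian.Ext.mk₀_comp_mk₀]
      have : ModuleCat.ofHom f ≫ ModuleCat.ofHom g = 0 := by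
        ext x; exact h.apply_apply_eq_zero x
      rw [this]; simp
  · intro x
    constructor
    · intro hx
      exact Abelian.Ext.covariant_sequence_exact₃ _ hS x rfl hx
    · rintro ⟨y, rfl⟩
      change (y.comp (Abelian.Ext.mk₀ _) (add_zero n)).comp hS.extClass rfl = 0
      rw [Abelian.Ext.comp_assoc_of_second_deg_zero]
      have := hS.comp_extClass
      erw [this]; simp
  · intro x
    constructor
    · intro hx
      exact Abelian.Ext.covariant_sequence_exact₁ _ hS x hx rfl
    · rintro ⟨y, rfl⟩
      change (y.comp hS.extClass rfl).comp (Abelian.Ext.mk₀ _) (add_zero (n+1)) = 0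
      rw [Abelian.Ext.comp_assoc_of_third_deg_zero]
      have := hS.extClass_comp
      erw [this]; simp

lemma EE_inj_zero (hY : Module.Injective R Y) (n : ℕ) (x : EE R A Y (n + 1)) : x = 0 := by
  have : CategoryTheory.Injective (ModuleCat.of R Y) :=
    Module.injective_object_of_injective_module R Y
  exact Abelian.Ext.eq_zero_of_injective x

lemma EE_proj_zero (hA : Module.Projective R A) (n : ℕ) (x : EE R A Y (n + 1)) : x = 0 := by
  have : CategoryTheory.Projective (ModuleCat.of R A) :=
    (IsProjective.iff_projective A).1 hA
  exact Abelian.Ext.eq_zero_of_projective x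

noncomputable def EE0 (A Y : Type u) [AddCommGroup A] [Module R A]
    [AddCommGroup Y] [Module R Y] : EE R A Y 0 ≃ₗ[R] (A →ₗ[R] Y) :=
  (Abelian.Ext.linearEquiv₀ (R := R) (X := ModuleCat.of R A)
    (Y := ModuleCat.of R Y)).trans (ModuleCat.homLinearEquiv (S := R))

lemma EE0_pre (f : A →ₗ[R] B) (x : EE R B Y 0) : EE0 A Y (pre f Y 0 x) = (EE0 B Y x).comp f := by
  obtain ⟨y, rfl⟩ := (EE0 (R := R) B Y).symm.surjective x
  rw [LinearEquiv.apply_symm_apply, ← LinearEquiv.eq_symm_apply]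
  change (Abelian.Ext.mk₀ _).comp (Abelian.Ext.mk₀ _) (zero_add 0) = Abelian.Ext.mk₀ _
  rw [Abelian.Ext.mk₀_comp_mk₀]
  rfl

lemma EE0_post (f : Y →ₗ[R] Z) (x : EE R A Y 0) :
    EE0 A Z (post A f 0 x) = f.comp (EE0 A Y x) := by
  obtain ⟨y, rfl⟩ := (EE0 (R := R) A Y).symm.surjective x
  rw [LinearEquiv.apply_symm_apply, ← LinearEquiv.eq_symm_apply]
  change (Abelian.Ext.mk₀ _).comp (Abelian.Ext.mk₀ _) (zero_add 0) = Abelian.Ext.mk₀ _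
  rw [Abelian.Ext.mk₀_comp_mk₀]
  rfl

lemma EE_finite [IsNoetherianRing R] [Module.Finite R A] [Module.Finite R Y] (n : ℕ) :
    Module.Finite R (EE R A Y n) := by
  have := ModuleCat.finite_ext (R := R) (ModuleCat.of R A) (ModuleCat.of R Y) n
  exact this

end les
end GI

namespace GI
section pnull
variable {R : Type u} [CommRing R] {p : Ideal R}
variable {A B C : Type u} [AddCommGroup A] [Module R A] [AddCommGroup B] [Module R B]
  [AddCommGroup C] [Module R C]

lemma PNull.of_surj (h : PNull p A) (f : A →ₗ[R] B) (hf : Function.Surjective f) : PNull p B := by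
  intro m
  obtain ⟨a, rfl⟩ := hf m
  obtain ⟨s, hs, h1⟩ := h a
  exact ⟨s, hs, by rw [← map_smul, h1, map_zero]⟩

lemma PNull.of_inj (h : PNull p B) (f : A →ₗ[R] B) (hf : Function.Injective f) : PNull p A := by
  intro m
  obtain ⟨s, hs, h1⟩ := h (f m)
  exact ⟨s, hs, hf (by rw [map_smul, h1, map_zero])⟩

lemma PNull.mid [hp : p.IsPrime] (h : PNull p A) (h' : PNull p C) (f : A →ₗ[R] B) (g : B →ₗ[R] C)
    (hfg : Function.Exact f g) : PNull p B := by
  intro m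
  obtain ⟨s, hs, h1⟩ := h' (g m)
  rw [← map_smul] at h1
  obtain ⟨a, ha⟩ := (hfg _).1 h1
  obtain ⟨t, ht, h2⟩ := h a
  exact ⟨t * s, fun h => (hp.mem_or_mem h).elim ht hs, by
    rw [mul_smul, ← ha, ← map_smul, h2, map_zero]⟩

lemma fin_null_span [hp : p.IsPrime] (S : Finset A) (K : Submodule R A)
    (h : ∀ m ∈ S, ∃ s, s ∉ p ∧ s • m ∈ K) :
    ∃ s, s ∉ p ∧ ∀ m ∈ Submodule.span R (S : Set A), s • m ∈ K := by
  classical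
  have : ∃ s, s ∉ p ∧ ∀ m ∈ S, s • m ∈ K := by
    induction S using Finset.induction_on with
    | empty => exact ⟨1, (Ideal.ne_top_iff_one p).1 hp.ne_top, by simp⟩
    | insert a S ha ih =>
      obtain ⟨s, hs, h1⟩ := ih (fun m hm => h m (Finset.mem_insert_of_mem hm))
      obtain ⟨t, ht, h2⟩ := h a (Finset.mem_insert_self _ _)
      refine ⟨t * s, fun h => (hp.mem_or_mem h).elim ht hs, fun m hm => ?_⟩
      rcases Finset.mem_insert.1 hm with rfl | hm
      · rw [mul_comm, mul_smul]; exact K.smul_mem _ h2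
      · rw [mul_smul]; exact K.smul_mem _ (h1 m hm)
  obtain ⟨s, hs, h1⟩ := this
  refine ⟨s, hs, fun m hm => ?_⟩
  have : Submodule.span R (S : Set A) ≤ K.comap (s • LinearMap.id) :=
    Submodule.span_le.2 (fun m hm => h1 m hm)
  exact this hm

lemma fin_null [hp : p.IsPrime] [hA : Module.Finite R A] (K : Submodule R A)
    (h : ∀ m, ∃ s, s ∉ p ∧ s • m ∈ K) : ∃ s, s ∉ p ∧ ∀ m, s • m ∈ K := by
  obtain ⟨S, hS⟩ := hA.fg_top
  obtain ⟨s, hs, h1⟩ := fin_null_span S K (fun m _ => h m)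
  exact ⟨s, hs, fun m => h1 m (by rw [hS]; trivial)⟩

lemma PNull.fin [hp : p.IsPrime] [hA : Module.Finite R A] (h : PNull p A) :
    ∃ s, s ∉ p ∧ ∀ m : A, s • m = 0 := by
  simpa using fin_null (⊥ : Submodule R A) (fun m => by simpa using h m)

lemma PNull.EE_left [hp : p.IsPrime] [hA : Module.Finite R A] (h : PNull p A) (n : ℕ) :
    PNull p (EE R A B n) := by
  obtain ⟨s, hs, h1⟩ := h.fin
  intro m
  refine ⟨s, hs, ?_⟩
  rw [← pre_smul]
  have : s • (LinearMap.id : A →ₗ[R] A) = 0 := by ext m; exact h1 m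
  rw [this]
  change (Abelian.Ext.mk₀ (0 : ModuleCat.of R A ⟶ ModuleCat.of R A)).comp m (zero_add n) = 0
  simp

lemma PNull.EE_right [hp : p.IsPrime] [hA : Module.Finite R B] (h : PNull p B) (n : ℕ) :
    PNull p (EE R A B n) := by
  obtain ⟨s, hs, h1⟩ := h.fin
  intro m
  refine ⟨s, hs, ?_⟩
  rw [← post_smul]
  have : s • (LinearMap.id : B →ₗ[R] B) = 0 := by ext m; exact h1 m
  rw [this]
  change m.comp (Abelian.Ext.mk₀ (0 : ModuleCat.of R B ⟶ ModuleCat.of R B)) (add_zero n) = 0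
  simp

lemma Nak [hp : p.IsPrime] [hA : Module.Finite R A] {y : R} (hy : y ∈ p)
    (h : ∀ m : A, ∃ s, s ∉ p ∧ ∃ m', s • m = y • m') : PNull p A := by
  obtain ⟨s, hs, h1⟩ := fin_null (A := A) (p := p) (LinearMap.range (y • (LinearMap.id : A →ₗ[R] A)))
    (by intro m; obtain ⟨s, hs, m', h⟩ := h m; exact ⟨s, hs, m', h.symm⟩)
  obtain ⟨P, hP, -, hc, h0⟩ := LinearMap.exists_monic_and_natDegree_eq_and_coeff_mem_pow_and_aeval_eq_zero
    R (s • (LinearMap.id : A →ₗ[R] A)) (Ideal.span {y}) (by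
      rintro _ ⟨m, rfl⟩
      obtain ⟨m', h⟩ := h1 m
      change s • m ∈ _
      rw [← h]
      exact Submodule.smul_mem_smul (Ideal.mem_span_singleton_self y) trivial)
  intro m
  refine ⟨P.eval s, ?_, ?_⟩
  · intro hmem
    rw [Polynomial.eval_eq_sum_range, Finset.sum_range_succ] at hmem
    rw [hP.coeff_natDegree, one_mul] at hmem
    have h2 : ∑ x ∈ Finset.range P.natDegree, P.coeff x * s ^ x ∈ p := by
      refine Ideal.sum_mem _ (fun i hi => Ideal.mul_mem_right _ _ ?_)
      have h3 := hc i
      have h4 : (Ideal.span {y}) ^ (P.natDegree - i) ≤ p :=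
        (Ideal.pow_le_self (by have := Finset.mem_range.1 hi; omega)).trans
          ((Ideal.span_singleton_le_iff_mem _).2 hy)
      exact h4 h3
    exact hs (hp.mem_of_pow_mem _ ((Ideal.add_mem_iff_right _ h2).1 hmem))
  · have h2 : ∀ Q : Polynomial R,
        Polynomial.aeval (s • (LinearMap.id : A →ₗ[R] A)) Q m = Q.eval s • m := by
      intro Q
      have : (s • (LinearMap.id : A →ₗ[R] A)) = algebraMap R (Module.End R A) s := by
        ext; rfl
      rw [this, Polynomial.aeval_algebraMap_apply]
      simp [Module.algebraMap_end_apply]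
    rw [← h2, h0]; rfl

def PCyc (p : Ideal R) (A : Type u) [AddCommGroup A] [Module R A] : Prop :=
  ∃ ε : A, ∀ e : A, ∃ s, s ∉ p ∧ ∃ r : R, s • e = r • ε
end pnull
end GI

namespace GI
open scoped Classical
section minres
variable {R : Type u} [CommRing R] [IsNoetherianRing R]
variable (Efam : PrimeSpectrum R → Type u) [∀ p, AddCommGroup (Efam p)]
    [∀ p, Module R (Efam p)]

structure MinRes where
  Om : ℕ → ModuleCat.{u} R
  ι : ℕ → Type u
  q : ∀ i, ι i → PrimeSpectrum R
  η : ∀ i, Om i →ₗ[R] Π₀ a, Efam (q i a)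
  π : ∀ i, (Π₀ a, Efam (q i a)) →ₗ[R] Om (i+1)
  η_inj : ∀ i, Function.Injective (η i)
  ess : ∀ i, ∀ y : Π₀ a, Efam (q i a), y ≠ 0 → ∃ r : R, r • y ≠ 0 ∧ r • y ∈ LinearMap.range (η i)
  π_surj : ∀ i, Function.Surjective (π i)
  exact : ∀ i, Function.Exact (η i) (π i)

variable (hE : ∀ p : PrimeSpectrum R, IsInjectiveHull R (R ⧸ p.asIdeal) (Efam p))

noncomputable def hι (N : ModuleCat.{u} R) : Type u := (exists_hull Efam hE N).choose
noncomputable def hq (N : ModuleCat.{u} R) : hι Efam hE N → PrimeSpectrum R :=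
  (exists_hull Efam hE N).choose_spec.choose
noncomputable def hη (N : ModuleCat.{u} R) : N →ₗ[R] Π₀ a, Efam (hq Efam hE N a) :=
  (exists_hull Efam hE N).choose_spec.choose_spec.choose
noncomputable def nxt (N : ModuleCat.{u} R) : ModuleCat.{u} R :=
  ModuleCat.of R ((Π₀ a, Efam (hq Efam hE N a)) ⧸ LinearMap.range (hη Efam hE N))

noncomputable def OmD (D : ModuleCat.{u} R) : ℕ → ModuleCat.{u} R
  | 0 => D
  | n + 1 => nxt Efam hE (OmD D n)

noncomputable def minRes (D : ModuleCat.{u} R) : MinRes Efam where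
  Om := OmD Efam hE D
  ι i := hι Efam hE (OmD Efam hE D i)
  q i := hq Efam hE (OmD Efam hE D i)
  η i := hη Efam hE (OmD Efam hE D i)
  π i := (LinearMap.range (hη Efam hE (OmD Efam hE D i))).mkQ
  η_inj i := (exists_hull Efam hE (OmD Efam hE D i)).choose_spec.choose_spec.choose_spec.1
  ess i := (exists_hull Efam hE (OmD Efam hE D i)).choose_spec.choose_spec.choose_spec.2
  π_surj i := Submodule.mkQ_surjective _
  exact i := LinearMap.exact_map_mkQ_range _

variable {Efam} (M : MinRes Efam)

abbrev MinRes.I (M : MinRes Efam) (i : ℕ) := Π₀ a, Efam (M.q i a)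

include hE
lemma MinRes.I_inj (i : ℕ) : Module.Injective R (M.I i) := dfinsupp_injective _ (fun a => (hE _).1)
omit hE

omit [IsNoetherianRing R] in
lemma MinRes.succ_zero (i : ℕ) (h : ∀ x : M.Om i, x = 0) : ∀ x : M.Om (i+1), x = 0 := by
  intro x
  obtain ⟨y, rfl⟩ := M.π_surj i x
  by_cases hy : y = 0
  · rw [hy, map_zero]
  · obtain ⟨r, hr, z, hz⟩ := M.ess i y hy
    rw [h z, map_zero] at hz
    exact absurd hz.symm hr

omit [IsNoetherianRing R] in
lemma MinRes.succ_zero' (i : ℕ) (h : Module.Injective R (M.Om i)) : ∀ x : M.Om (i+1), x = 0 := by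
  intro x
  obtain ⟨y, rfl⟩ := M.π_surj i x
  obtain ⟨r, hr⟩ := h.out (M.η i) (M.η_inj i) LinearMap.id
  have hk : ∀ y, r y = 0 → y = 0 := by
    intro y hy
    by_contra hne
    obtain ⟨t, ht, z, hz⟩ := M.ess i y hne
    have : r (M.η i z) = 0 := by rw [hz, map_smul, hy, smul_zero]
    rw [hr] at this
    simp only [LinearMap.id_apply] at this
    rw [this, map_zero] at hz
    exact ht hz.symm
  have h2 := hk (y - M.η i (r y)) (by rw [map_sub, hr]; simp)
  rw [sub_eq_zero] at h2
  rw [h2]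
  exact (M.exact i).apply_apply_eq_zero _

include hE
lemma MinRes.term (n : ℕ) (h : HasInjectiveDimensionLT (M.Om 0) n) :
    ∀ j, n ≤ j → ∀ x : M.Om j, x = 0 := by
  have h1 : ∀ j, j ≤ n → HasInjectiveDimensionLT (M.Om j) (n - j) := by
    intro j
    induction j with
    | zero => intro _; exact h
    | succ j ih =>
      intro hj
      have := ih (by omega)
      have hS := shortExact_of (M.η j) (M.π j) (M.η_inj j) (M.π_surj j) (M.exact j)
      have hi : CategoryTheory.Injective (ModuleCat.of R (M.I j)) :=
        Module.injective_object_of_injective_module R _ (inj := M.I_inj hE j)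
      have e : n - j = n - (j+1) + 1 := by omega
      rw [e] at this
      rcases h0 : n - (j+1) with _ | k
      · rw [h0] at this
        have h4 : CategoryTheory.Injective (ModuleCat.of R (M.Om j)) := injective_iff_hasInjectiveDimensionLT_one.2 this
        have h5 : Module.Injective R (M.Om j) := Module.injective_module_of_injective_object R _
        rw [hasInjectiveDimensionLT_zero_iff_isZero]
        have := M.succ_zero' j h5
        have : Subsingleton (M.Om (j+1)) := ⟨fun a b => (this a).trans (this b).symm⟩
        exact ModuleCat.isZero_of_subsingleton _
      · rw [h0] at this
        exact (hS.hasInjectiveDimensionLT_X₃_iff k hi).2 this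
  have h2 : ∀ x : M.Om n, x = 0 := by
    have := h1 n le_rfl
    rw [Nat.sub_self, hasInjectiveDimensionLT_zero_iff_isZero] at this
    intro x
    have := ModuleCat.subsingleton_of_isZero this
    exact Subsingleton.elim _ _
  intro j hj
  induction j, hj using Nat.le_induction with
  | base => exact h2
  | succ j hj ih => exact M.succ_zero j ih
omit hE

variable {X : Type u} [AddCommGroup X] [Module R X]

include hE
lemma MinRes.shift (m j n : ℕ) (hn : n = m + 1 + j) :
    Nonempty (EE R X (M.Om j) (m + 1) ≃ₗ[R] EE R X (M.Om 0) n) := by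
  induction j generalizing m n with
  | zero => subst hn; exact ⟨LinearEquiv.refl _ _⟩
  | succ j ih =>
    obtain ⟨e⟩ := ih (m + 1) n (by omega)
    obtain ⟨-, δ, h1, h2⟩ := les_cov (M.η j) (M.π j) (M.η_inj j) (M.π_surj j) (M.exact j) X (m + 1)
    refine ⟨(LinearEquiv.ofBijective δ ⟨?_, ?_⟩).trans e⟩
    · rw [injective_iff_map_eq_zero]
      intro x hx
      obtain ⟨y, rfl⟩ := (h1 x).1 hx
      rw [EE_inj_zero (M.I_inj hE j) m y, map_zero]
    · intro y
      exact (h2 y).1 (EE_inj_zero (M.I_inj hE j) (m + 1) _)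

omit hE

omit [IsNoetherianRing R] in
lemma MinRes.key (j : ℕ) (v : M.I j) (q : Ideal R) (hq : q.IsPrime) (hv : ∀ a ∈ q, a • v = 0) :
    ∃ s, s ∉ q ∧ s • v ∈ LinearMap.range (M.η j) := by
  by_cases h : v = 0
  · exact ⟨1, (Ideal.ne_top_iff_one q).1 hq.ne_top, by rw [h, smul_zero]; exact Submodule.zero_mem _⟩
  · obtain ⟨r, hr, h2⟩ := M.ess j v h
    exact ⟨r, fun h => hr (hv r h), h2⟩

include hE
/-- `Hom(X, Ω^j) → Ext^j(X, D)` -/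
lemma MinRes.theta (X : Type u) [AddCommGroup X] [Module R X] (j : ℕ) :
    ∃ θ : (X →ₗ[R] M.Om j) →ₗ[R] EE R X (M.Om 0) j,
    Function.Surjective θ ∧ ∀ h, θ h = 0 → ∀ x, ∀ q : Ideal R, q.IsPrime → (∀ a ∈ q, a • x = 0) →
      ∃ s, s ∉ q ∧ s • h x = 0 := by
  rcases j with _ | j
  · refine ⟨(EE0 X (M.Om 0)).symm.toLinearMap, LinearEquiv.surjective _, fun h hh x q hq hx => ?_⟩
    have : h = 0 := by simpa using hh
    exact ⟨1, (Ideal.ne_top_iff_one q).1 hq.ne_top, by rw [this]; simp⟩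
  · obtain ⟨e⟩ := M.shift hE (X := X) 0 j (j + 1) (by omega)
    obtain ⟨-, δ, h1, h2⟩ := les_cov (M.η j) (M.π j) (M.η_inj j) (M.π_surj j) (M.exact j) X 0
    refine ⟨e.toLinearMap ∘ₗ δ ∘ₗ (EE0 X (M.Om (j+1))).symm.toLinearMap, ?_, ?_⟩
    · intro y
      obtain ⟨y, rfl⟩ := e.surjective y
      obtain ⟨y, rfl⟩ := (h2 y).1 (EE_inj_zero (M.I_inj hE j) 0 _)
      exact ⟨EE0 _ _ y, by simp⟩
    · intro h hh x q hq hx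
      have h3 : δ ((EE0 X (M.Om (j+1))).symm h) = 0 := e.injective (by rw [map_zero]; exact hh)
      obtain ⟨y, hy⟩ := (h1 _).1 h3
      have := EE0_post (M.π j) y
      rw [hy, LinearEquiv.apply_symm_apply] at this
      obtain ⟨s, hs, z, hz⟩ := M.key j (EE0 _ _ y x) q hq
        (fun a ha => by rw [← map_smul, hx a ha, map_zero])
      refine ⟨s, hs, ?_⟩
      rw [this]
      change s • M.π j (EE0 _ _ y x) = 0
      rw [← map_smul, ← hz]
      exact (M.exact j).apply_apply_eq_zero _
omit hE

end minres
end GI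

namespace GI
open scoped Classical
section bass
variable {R : Type u} [CommRing R] [IsNoetherianRing R]
variable {Efam : PrimeSpectrum R → Type u} [∀ p, AddCommGroup (Efam p)]
    [∀ p, Module R (Efam p)]
variable (hE : ∀ p : PrimeSpectrum R, IsInjectiveHull R (R ⧸ p.asIdeal) (Efam p))
variable (M : MinRes Efam)

omit [IsNoetherianRing R] in
lemma dfin_null {ι : Type u} {E : ι → Type u} [∀ i, AddCommGroup (E i)] [∀ i, Module R (E i)]
    (p : Ideal R) (hp : p.IsPrime) (v : Π₀ i, E i) (h : ∀ a, v a ≠ 0 → ∃ s, s ∉ p ∧ s • v a = 0) :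
    ∃ s, s ∉ p ∧ s • v = 0 := by
  have h' : ∀ a, ∃ s, s ∉ p ∧ s • v a = 0 := by
    intro a
    by_cases ha : v a = 0
    · exact ⟨1, (Ideal.ne_top_iff_one p).1 hp.ne_top, by rw [ha, smul_zero]⟩
    · exact h a ha
  choose s hs h1 using h'
  refine ⟨∏ a ∈ v.support, s a, ?_, ?_⟩
  · intro hm
    obtain ⟨a, -, ha⟩ := (hp.prod_mem_iff).1 hm
    exact hs a ha
  · ext a
    by_cases ha : a ∈ v.support
    · rw [← Finset.prod_erase_mul _ _ ha, DFinsupp.smul_apply, mul_smul, h1, smul_zero]; rfl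
    · rw [DFinsupp.notMem_support_iff] at ha
      rw [DFinsupp.smul_apply, ha, smul_zero]; rfl

include hE

lemma MinRes.null_of_not (i : ℕ) (p : PrimeSpectrum R) (h : ∀ a, ¬ M.q i a ≤ p) :
    PNull p.asIdeal (M.I i) := by
  intro v
  refine dfin_null p.asIdeal p.2 v (fun a ha => ?_)
  have := h a
  obtain ⟨s, hs, hs'⟩ := SetLike.not_le_iff_exists.1 (show ¬ (M.q i a).asIdeal ≤ p.asIdeal from this)
  obtain ⟨n, hn⟩ := hull_nil (hE (M.q i a)) hs (v a)
  exact ⟨s ^ n, fun h => hs' (p.2.mem_of_pow_mem _ h), hn⟩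

lemma MinRes.ext_null (i : ℕ) (p : PrimeSpectrum R) (h : PNull p.asIdeal (M.I i))
    (X : Type u) [AddCommGroup X] [Module R X] [hX : Module.Finite R X] :
    PNull p.asIdeal (EE R X (M.Om 0) i) := by
  obtain ⟨θ, h1, h2⟩ := M.theta hE X i
  refine PNull.of_surj ?_ θ h1
  intro g
  obtain ⟨S, hS⟩ := hX.fg_top
  obtain ⟨s, hs, h3⟩ := fin_null (A := X) (p := p.asIdeal) (LinearMap.ker g) (fun m => by
    obtain ⟨s, hs, h⟩ := h (M.η i (g m))
    refine ⟨s, hs, M.η_inj i ?_⟩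
    rw [map_smul, map_smul, h, map_zero])
  refine ⟨s, hs, ?_⟩
  ext m
  rw [LinearMap.smul_apply, ← map_smul]
  exact h3 m

lemma MinRes.mem_of_not_null (i : ℕ) (p : PrimeSpectrum R)
    (h : ¬ PNull p.asIdeal (EE R (R ⧸ p.asIdeal) (M.Om 0) i)) : ∃ a, M.q i a = p := by
  by_contra hno
  push Not at hno
  apply h
  obtain ⟨θ, h1, h2⟩ := M.theta hE (R ⧸ p.asIdeal) i
  refine PNull.of_surj ?_ θ h1
  intro g
  have hk : ∀ r ∈ p.asIdeal, r • M.η i (g 1) = 0 := by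
    intro r hr
    rw [← map_smul, ← map_smul]
    have : r • (1 : R ⧸ p.asIdeal) = 0 := by
      rw [← Algebra.algebraMap_eq_smul_one]; exact Ideal.Quotient.eq_zero_iff_mem.2 hr
    rw [this, map_zero, map_zero]
  obtain ⟨s, hs, h3⟩ := dfin_null p.asIdeal p.2 (M.η i (g 1)) (fun a ha => by
    have hle : p ≤ M.q i a := by
      intro r hr
      by_contra hr'
      refine ha (hull_inj (hE _) hr' ?_)
      rw [← DFinsupp.smul_apply, hk r hr]; rfl
    have : ¬ M.q i a ≤ p := fun h => hno a (le_antisymm h hle)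
    obtain ⟨s, hs, hs'⟩ := SetLike.not_le_iff_exists.1 (show ¬ (M.q i a).asIdeal ≤ p.asIdeal from this)
    obtain ⟨n, hn⟩ := hull_nil (hE (M.q i a)) hs (M.η i (g 1) a)
    exact ⟨s ^ n, fun h => hs' (p.2.mem_of_pow_mem _ h), hn⟩)
  refine ⟨s, hs, ?_⟩
  have h4 : s • g 1 = 0 := M.η_inj i (by rw [map_smul, h3, map_zero])
  refine LinearMap.ext fun x => ?_
  obtain ⟨r, rfl⟩ := Ideal.Quotient.mk_surjective x
  have : Ideal.Quotient.mk p.asIdeal r = r • 1 := by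
    rw [← Algebra.algebraMap_eq_smul_one]; rfl
  rw [this, LinearMap.smul_apply, map_smul, smul_comm, h4, smul_zero]; rfl

/-- the generator -/
lemma MinRes.gen (i : ℕ) (a : M.ι i) : ∃ g : (R ⧸ (M.q i a).asIdeal) →ₗ[R] M.Om i,
    (∀ b, b ≠ a → M.η i (g 1) b = 0) ∧ ∀ s, s • M.η i (g 1) a = 0 → s ∈ (M.q i a).asIdeal := by
  obtain ⟨f, hf, -⟩ := hull_ess (hE (M.q i a))
  have hk : ∀ r ∈ (M.q i a).asIdeal, r • (DFinsupp.single a (f 1) : M.I i) = 0 := by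
    intro r hr
    rw [← DFinsupp.single_smul, ← map_smul]
    have : r • (1 : R ⧸ (M.q i a).asIdeal) = 0 := by
      rw [← Algebra.algebraMap_eq_smul_one]; exact Ideal.Quotient.eq_zero_iff_mem.2 hr
    rw [this, map_zero, DFinsupp.single_zero]
  obtain ⟨s, hs, z, hz⟩ := M.key i (DFinsupp.single a (f 1)) (M.q i a).asIdeal (M.q i a).2 hk
  have hz0 : ∀ r ∈ (M.q i a).asIdeal, r • z = 0 := by
    intro r hr
    apply M.η_inj i
    rw [map_smul, hz, smul_comm, hk r hr, smul_zero, map_zero]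
  have hg : ∃ g : (R ⧸ (M.q i a).asIdeal) →ₗ[R] M.Om i, g 1 = z :=
    ⟨Submodule.liftQ _ (LinearMap.toSpanSingleton R _ z) (fun r hr => by
      rw [LinearMap.mem_ker, LinearMap.toSpanSingleton_apply]; exact hz0 r hr), by
      change LinearMap.toSpanSingleton R _ z 1 = z
      rw [LinearMap.toSpanSingleton_apply, one_smul]⟩
  obtain ⟨g, hg⟩ := hg
  refine ⟨g, fun b hb => ?_, fun t ht => ?_⟩
  · rw [hg, hz, DFinsupp.smul_apply, DFinsupp.single_eq_of_ne hb, smul_zero]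
  · rw [hg, hz, DFinsupp.smul_apply, DFinsupp.single_eq_same, smul_smul] at ht
    have := (smul_quot f hf (t * s) 1).1 ht
    have h1 : (1:R) ∉ (M.q i a).asIdeal := (Ideal.ne_top_iff_one _).1 (M.q i a).2.ne_top
    rcases this with h | h
    · exact ((M.q i a).2.mem_or_mem h).resolve_right hs
    · exact absurd h h1

lemma MinRes.not_null_of_mem (i : ℕ) (a : M.ι i) :
    ¬ PNull (M.q i a).asIdeal (EE R (R ⧸ (M.q i a).asIdeal) (M.Om 0) i) := by
  intro hn
  obtain ⟨g, -, hg⟩ := M.gen hE i a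
  obtain ⟨θ, h1, h2⟩ := M.theta hE (R ⧸ (M.q i a).asIdeal) i
  obtain ⟨s, hs, h3⟩ := hn (θ g)
  rw [← map_smul] at h3
  obtain ⟨t, ht, h4⟩ := h2 _ h3 1 (M.q i a).asIdeal (M.q i a).2 (fun r hr => by
    rw [← Algebra.algebraMap_eq_smul_one]; exact Ideal.Quotient.eq_zero_iff_mem.2 hr)
  rw [LinearMap.smul_apply, smul_smul] at h4
  have := hg (t * s) (by rw [← DFinsupp.smul_apply, ← map_smul, h4, map_zero]; rfl)
  exact ((M.q i a).2.mem_or_mem this).elim ht hs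

lemma MinRes.gen' (i : ℕ) (a : M.ι i) (p : PrimeSpectrum R) (h : M.q i a = p) :
    ∃ g : (R ⧸ p.asIdeal) →ₗ[R] M.Om i,
    (∀ b, b ≠ a → M.η i (g 1) b = 0) ∧ ∀ s, s • M.η i (g 1) a = 0 → s ∈ p.asIdeal := by
  subst h; exact M.gen hE i a

lemma MinRes.mult (i : ℕ) (p : PrimeSpectrum R) (a b : M.ι i) (ha : M.q i a = p) (hb : M.q i b = p)
    (hc : PCyc p.asIdeal (EE R (R ⧸ p.asIdeal) (M.Om 0) i)) : a = b := by
  by_contra hab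
  obtain ⟨g, g0, hg⟩ := M.gen' hE i a p ha
  obtain ⟨g', g0', hg'⟩ := M.gen' hE i b p hb
  obtain ⟨θ, h1, h2⟩ := M.theta hE (R ⧸ p.asIdeal) i
  have h1k : ∀ r ∈ p.asIdeal, r • (1 : R ⧸ p.asIdeal) = 0 := fun r hr => by
    rw [← Algebra.algebraMap_eq_smul_one]; exact Ideal.Quotient.eq_zero_iff_mem.2 hr
  obtain ⟨ε, hε⟩ := hc
  obtain ⟨s, hs, r, h3⟩ := hε (θ g)
  obtain ⟨s', hs', r', h3'⟩ := hε (θ g')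
  have h4 : θ ((r' * s) • g - (r * s') • g') = 0 := by
    rw [map_sub, map_smul, map_smul, mul_smul, mul_smul, h3, h3', smul_comm, sub_self]
  obtain ⟨t, ht, h5⟩ := h2 _ h4 1 p.asIdeal p.2 h1k
  have h6 := congrArg (fun z => M.η i z a) h5
  simp only [LinearMap.sub_apply, LinearMap.smul_apply, map_smul, map_sub, map_zero] at h6
  rw [DFinsupp.smul_apply, DFinsupp.sub_apply, DFinsupp.smul_apply, DFinsupp.smul_apply,
    g0' a hab, smul_zero, sub_zero, smul_smul] at h6
  have h7 := hg _ h6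
  have hr' : r' ∈ p.asIdeal := by
    by_contra hr'
    rcases p.2.mem_or_mem h7 with h | h
    · exact ht h
    · exact (p.2.mem_or_mem h).elim hr' hs
  obtain ⟨e, rfl⟩ := h1 ε
  have h8 : r' • e = 0 := by
    refine LinearMap.ext fun x => ?_
    obtain ⟨c, rfl⟩ := Ideal.Quotient.mk_surjective x
    have : Ideal.Quotient.mk p.asIdeal c = c • 1 := by
      rw [← Algebra.algebraMap_eq_smul_one]; rfl
    rw [this, LinearMap.smul_apply, map_smul, smul_comm, ← map_smul, h1k r' hr', map_zero, smul_zero]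
    rfl
  rw [← map_smul θ r', h8, map_zero, ← map_smul] at h3'
  obtain ⟨t', ht', h9⟩ := h2 _ h3' 1 p.asIdeal p.2 h1k
  rw [LinearMap.smul_apply, smul_smul] at h9
  have := hg' (t' * s') (by rw [← DFinsupp.smul_apply, ← map_smul, h9, map_zero]; rfl)
  exact (p.2.mem_or_mem this).elim ht' hs'

end bass
end GI

namespace GI
open scoped Classical
section bass2
variable {R : Type u} [CommRing R] [IsNoetherianRing R]
variable {Efam : PrimeSpectrum R → Type u} [∀ p, AddCommGroup (Efam p)]
    [∀ p, Module R (Efam p)]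

lemma mul_les (x : R) (X : Type u) [AddCommGroup X] [Module R X] :
    Function.Exact (x • (LinearMap.id : X →ₗ[R] X))
      (LinearMap.range (x • (LinearMap.id : X →ₗ[R] X))).mkQ := LinearMap.exact_map_mkQ_range _

lemma MinRes.exists_l (hE : ∀ p : PrimeSpectrum R, IsInjectiveHull R (R ⧸ p.asIdeal) (Efam p))
    (M : MinRes Efam) (hfin : Module.Finite R (M.Om 0))
    (hann : ∀ r : R, (∀ x : M.Om 0, r • x = 0) → r = 0)
    (hterm : ∃ n, ∀ j, n ≤ j → ∀ x : M.Om j, x = 0) :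
    ∃ l : PrimeSpectrum R → ℕ, (∀ p, ∃ a, M.q (l p) a = p) ∧
      (∀ p i, l p < i → PNull p.asIdeal (M.I i)) ∧ StrictMono l := by
  obtain ⟨n, hn⟩ := hterm
  have hbd : ∀ i, n ≤ i → ∀ a : M.ι i, False := by
    intro i hi a
    obtain ⟨g, -, hg⟩ := M.gen hE i a
    have := hg 1 (by rw [hn i hi (g 1), map_zero]; exact smul_zero _)
    exact (Ideal.ne_top_iff_one _).1 (M.q i a).2.ne_top this
  have hne : ∀ p : PrimeSpectrum R, ∃ i, ∃ a : M.ι i, M.q i a ≤ p := by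
    intro p
    by_contra hno
    push Not at hno
    have h1 : PNull p.asIdeal (M.Om 0) := (M.null_of_not hE 0 p (hno 0)).of_inj (M.η 0) (M.η_inj 0)
    obtain ⟨s, hs, h2⟩ := h1.fin
    exact hs (by rw [hann s h2]; exact zero_mem _)
  let S : PrimeSpectrum R → Set ℕ := fun p => {i | ∃ a : M.ι i, M.q i a ≤ p}
  have hSb : ∀ p, BddAbove (S p) := fun p => ⟨n, fun i ⟨a, _⟩ => by
    by_contra hh; exact hbd i (by omega) a⟩
  have hl1 : ∀ p, ∃ a : M.ι (sSup (S p)), M.q _ a ≤ p := fun p => Nat.sSup_mem (hne p) (hSb p)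
  have hl2 : ∀ p i, sSup (S p) < i → PNull p.asIdeal (M.I i) := by
    intro p i hi
    refine M.null_of_not hE i p (fun a ha => ?_)
    exact absurd (le_csSup (hSb p) ⟨a, ha⟩) (by omega)
  have hl3 : ∀ p l, sSup (S p) = l → ∀ a : M.ι l, M.q _ a ≤ p → M.q _ a = p := by
    intro p l hl a ha
    by_contra hne
    have hnle : ¬ p.asIdeal ≤ (M.q _ a).asIdeal := fun h => hne (le_antisymm ha h)
    obtain ⟨y, hy, hyq⟩ := SetLike.not_le_iff_exists.1 hnle
    set q := (M.q l a).asIdeal with hq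
    have hqp : q.IsPrime := (M.q l a).2
    have hinj : Function.Injective (y • (LinearMap.id : (R ⧸ q) →ₗ[R] (R ⧸ q))) := by
      rw [injective_iff_map_eq_zero]
      intro x hx
      obtain ⟨r, rfl⟩ := Ideal.Quotient.mk_surjective x
      have : Ideal.Quotient.mk q (y * r) = 0 := hx
      rw [Ideal.Quotient.eq_zero_iff_mem] at this ⊢
      exact (hqp.mem_or_mem this).resolve_left hyq
    obtain ⟨-, δ, h1, h2⟩ := les_contra _ _ hinj (Submodule.mkQ_surjective _) (mul_les y (R ⧸ q))
      (M.Om 0) l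
    have hnull := M.ext_null hE (l+1) p (hl2 p _ (hl ▸ Nat.lt_succ_self _)) ((R ⧸ q) ⧸
      (LinearMap.range (y • (LinearMap.id : (R ⧸ q) →ₗ[R] (R ⧸ q)))))
    have := EE_finite (R := R) (A := R ⧸ q) (Y := M.Om 0) l
    have hN : PNull p.asIdeal (EE R (R ⧸ q) (M.Om 0) l) := by
      refine Nak (y := y) hy (fun m => ?_)
      obtain ⟨s, hs, h3⟩ := hnull (δ m)
      rw [← map_smul] at h3
      obtain ⟨m', h4⟩ := (h1 _).1 h3
      rw [pre_smul] at h4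
      exact ⟨s, hs, m', h4.symm⟩
    refine M.not_null_of_mem hE l a (fun m => ?_)
    obtain ⟨s, hs, h⟩ := hN m
    exact ⟨s, fun h' => hs (ha h'), h⟩
  refine ⟨fun p => sSup (S p), fun p => ?_, hl2, ?_⟩
  · obtain ⟨a, ha⟩ := hl1 p
    exact ⟨a, hl3 p _ rfl a ha⟩
  · intro q p hqp
    have hle : sSup (S q) ≤ sSup (S p) := by
      obtain ⟨a, ha⟩ := hl1 q
      exact le_csSup (hSb p) ⟨a, ha.trans hqp.le⟩
    refine lt_of_le_of_ne hle (fun heq => ?_)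
    replace heq : sSup (S q) = sSup (S p) := heq
    have h1 := hl1 q
    rw [heq] at h1
    obtain ⟨a, ha⟩ := h1
    have h4 := hl3 p _ rfl a (ha.trans hqp.le)
    rw [h4] at ha
    exact absurd hqp (not_lt_of_ge ha)

lemma height_le_l (l : PrimeSpectrum R → ℕ) (hl : StrictMono l) (p : PrimeSpectrum R) :
    Order.height p ≤ l p := by
  have := Order.height_le_height_apply_of_strictMono l hl p
  rwa [Order.height_nat] at this

structure Good (p : PrimeSpectrum R) (D : Type u) [AddCommGroup D] [Module R D] (j : ℕ)
    (X : Type u) [AddCommGroup X] [Module R X] : Prop where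
  fin : Module.Finite R X
  null : ∀ i, j < i → PNull p.asIdeal (EE R X D i)
  cyc : PCyc p.asIdeal (EE R X D j)
  low : ∀ m, (∀ i, i < m → PNull p.asIdeal (EE R (R ⧸ p.asIdeal) X i)) →
    ∀ i, i < m + j → PNull p.asIdeal (EE R (R ⧸ p.asIdeal) D i)
  ht : ∀ q : PrimeSpectrum R, q ≤ p → (∀ r : R, (∀ x : X, r • x = 0) → r ∈ q.asIdeal) →
    (j : ℕ∞) ≤ Order.height q
  ne : ¬ PNull p.asIdeal X

variable {p : PrimeSpectrum R} {D : Type u} [AddCommGroup D] [Module R D] {j : ℕ}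
    {X : Type u} [AddCommGroup X] [Module R X]

lemma Good.height_le (h : Good p D j X) : (j : ℕ∞) ≤ Order.height p := by
  refine h.ht p le_rfl (fun r hr => ?_)
  by_contra hrp
  exact h.ne (fun x => ⟨r, hrp, hr x⟩)

/-- the `p`-null part. -/
def nullPart (p : PrimeSpectrum R) (X : Type u) [AddCommGroup X] [Module R X] : Submodule R X where
  carrier := {x | ∃ s, s ∉ p.asIdeal ∧ s • x = 0}
  zero_mem' := ⟨1, (Ideal.ne_top_iff_one _).1 p.2.ne_top, smul_zero _⟩
  add_mem' := by
    rintro x y ⟨s, hs, h⟩ ⟨t, ht, h'⟩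
    refine ⟨s * t, fun hh => (p.2.mem_or_mem hh).elim hs ht, ?_⟩
    rw [smul_add, mul_smul s t y, h', mul_comm, mul_smul, h, smul_zero, smul_zero, add_zero]
  smul_mem' := by
    rintro c x ⟨s, hs, h⟩
    exact ⟨s, hs, by rw [smul_comm, h, smul_zero]⟩

lemma Good.bar (h : Good p D j X) : Good p D j (X ⧸ nullPart p X) := by
  have hX := h.fin
  set N := nullPart p X with hN
  have hNn : PNull p.asIdeal N := by
    rintro ⟨x, s, hs, hx⟩
    exact ⟨s, hs, Subtype.ext hx⟩
  have hfinN : Module.Finite R N := inferInstance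
  have hle := les_contra N.subtype N.mkQ N.injective_subtype N.mkQ_surjective
    (LinearMap.exact_subtype_mkQ N) D
  have hlc := les_cov N.subtype N.mkQ N.injective_subtype N.mkQ_surjective
    (LinearMap.exact_subtype_mkQ N) (R ⧸ p.asIdeal)
  have hker : ∀ i, ∀ x : EE R (X ⧸ N) D i, pre N.mkQ D i x = 0 → ∃ s, s ∉ p.asIdeal ∧ s • x = 0 := by
    intro i x hx
    rcases i with _ | i
    · refine ⟨1, (Ideal.ne_top_iff_one _).1 p.2.ne_top, ?_⟩
      have h1 := EE0_pre N.mkQ x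
      rw [hx, map_zero] at h1
      have : EE0 (R := R) (X ⧸ N) D x = 0 := by
        refine LinearMap.ext fun y => ?_
        obtain ⟨y, rfl⟩ := N.mkQ_surjective y
        exact (LinearMap.congr_fun h1 y).symm
      rw [one_smul]
      exact (EE0 (R := R) (X ⧸ N) D).injective (by rw [this, map_zero])
    · obtain ⟨-, δ, h1, h2⟩ := hle i
      obtain ⟨y, rfl⟩ := (h2 x).1 hx
      obtain ⟨s, hs, h3⟩ := hNn.EE_left i y
      exact ⟨s, hs, by rw [← map_smul, h3, map_zero]⟩
  refine ⟨inferInstance, ?_, ?_, ?_, ?_, ?_⟩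
  · intro i hi x
    obtain ⟨s, hs, h1⟩ := h.null i hi (pre N.mkQ D i x)
    rw [← map_smul] at h1
    obtain ⟨t, ht, h2⟩ := hker i _ h1
    exact ⟨t * s, fun hh => (p.2.mem_or_mem hh).elim ht hs, by rw [mul_smul, h2]⟩
  · obtain ⟨ε, hε⟩ := h.cyc
    obtain ⟨h0, -⟩ := hle j
    obtain ⟨s, hs, h1⟩ := hNn.EE_left j (pre N.subtype D j ε)
    rw [← map_smul] at h1
    obtain ⟨ε', hε'⟩ := (h0 _).1 h1
    refine ⟨ε', fun e => ?_⟩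
    obtain ⟨t, ht, r, h2⟩ := hε (pre N.mkQ D j e)
    obtain ⟨t', ht', h3⟩ := hker j ((s * t) • e - r • ε') (by
      rw [map_sub, map_smul, map_smul, hε', mul_smul, h2, smul_comm, sub_self])
    refine ⟨t' * (s * t), fun hh => ?_, t' * r, ?_⟩
    · exact (p.2.mem_or_mem hh).elim ht' (fun hh => (p.2.mem_or_mem hh).elim hs ht)
    · rw [mul_smul, mul_smul t', ← sub_eq_zero, ← smul_sub, h3]
  · intro m hm
    refine h.low m (fun i hi => ?_)
    exact PNull.mid (hNn.EE_right i) (hm i hi) _ _ (hlc i).1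
  · intro q hq hh
    refine h.ht q hq (fun r hr => hh r (fun x => ?_))
    obtain ⟨x, rfl⟩ := N.mkQ_surjective x
    rw [← map_smul, hr, map_zero]
  · intro hn
    refine h.ne (hNn.mid hn N.subtype N.mkQ (LinearMap.exact_subtype_mkQ N))

lemma bar_no_null (x : X ⧸ nullPart p X) (s : R) (hs : s ∉ p.asIdeal) (h : s • x = 0) : x = 0 := by
  obtain ⟨x, rfl⟩ := Submodule.mkQ_surjective _ x
  rw [← map_smul, Submodule.mkQ_apply, Submodule.Quotient.mk_eq_zero] at h
  rw [Submodule.mkQ_apply, Submodule.Quotient.mk_eq_zero]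
  obtain ⟨t, ht, h1⟩ := h
  exact ⟨t * s, fun hh => (p.2.mem_or_mem hh).elim ht hs, by rw [mul_smul, h1]⟩

end bass2
end GI

namespace GI
open scoped Classical
section bass3
variable {R : Type u} [CommRing R] [IsNoetherianRing R]
variable {Efam : PrimeSpectrum R → Type u} [∀ p, AddCommGroup (Efam p)]
    [∀ p, Module R (Efam p)]
variable {p : PrimeSpectrum R} {D : Type u} [AddCommGroup D] [Module R D] {j : ℕ}
    {X : Type u} [AddCommGroup X] [Module R X]

lemma Good.step (h : Good p D j X) (h1 : ∀ x : X, (∀ a ∈ p.asIdeal, a • x = 0) → x = 0) :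
    ∃ x : R, Good p D (j + 1) (X ⧸ LinearMap.range (x • (LinearMap.id : X →ₗ[R] X))) := by
  have hX := h.fin
  have hav : ¬ ((p.asIdeal : Set R) ⊆ ⋃ i ∈ associatedPrimes R X, (i : Set R)) := by
    rw [Ideal.subset_union_prime_finite (associatedPrimes.finite R X) (f := fun i : Ideal R => i) ⊥ ⊥
      (fun i hi _ _ => IsAssociatedPrime.isPrime hi)]
    rintro ⟨q, hq, hle⟩
    rw [AssociatedPrimes.mem_iff, isAssociatedPrime_iff] at hq
    obtain ⟨hqp, y, rfl⟩ := hq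
    have hy : y = 0 := h1 y (fun a ha => by
      have := hle ha
      rwa [Submodule.mem_colon_singleton, Submodule.mem_bot] at this)
    refine hqp.ne_top ?_
    rw [Ideal.eq_top_iff_one, Submodule.mem_colon_singleton, hy, smul_zero]
    exact zero_mem _
  obtain ⟨x, hxp, hx⟩ := Set.not_subset.1 hav
  have hxz : ∀ y : X, x • y = 0 → y = 0 := by
    intro y hy
    by_contra hne
    apply hx
    rw [biUnion_associatedPrimes_eq_zero_divisors]
    exact ⟨y, hne, hy⟩
  have hinj : Function.Injective (x • (LinearMap.id : X →ₗ[R] X)) := by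
    rw [injective_iff_map_eq_zero]; exact hxz
  refine ⟨x, ?_⟩
  set K := LinearMap.range (x • (LinearMap.id : X →ₗ[R] X)) with hK
  have hle := les_contra _ _ hinj K.mkQ_surjective (mul_les x X) D
  have hlc := les_cov _ _ hinj K.mkQ_surjective (mul_les x X) (R ⧸ p.asIdeal)
  refine ⟨inferInstance, ?_, ?_, ?_, ?_, ?_⟩
  · intro i hi
    obtain ⟨i, rfl⟩ : ∃ k, i = k + 1 := ⟨i - 1, by omega⟩
    obtain ⟨-, δ, -, h3⟩ := hle i
    exact PNull.mid (h.null i (by omega)) (h.null (i+1) (by omega)) _ _ h3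
  · obtain ⟨-, δ, -, h3⟩ := hle j
    obtain ⟨ε, hε⟩ := h.cyc
    refine ⟨δ ε, fun e => ?_⟩
    obtain ⟨s, hs, h4⟩ := h.null (j + 1) (by omega) (pre K.mkQ D (j+1) e)
    rw [← map_smul] at h4
    obtain ⟨e', he'⟩ := (h3 _).1 h4
    obtain ⟨t, ht, r, h5⟩ := hε e'
    refine ⟨t * s, fun hh => (p.2.mem_or_mem hh).elim ht hs, r, ?_⟩
    rw [mul_smul, ← he', ← map_smul, h5, map_smul]
  · intro m hm i hi
    refine h.low (m + 1) (fun i hi => ?_) i (by omega)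
    rcases i with _ | i
    · intro e
      refine ⟨1, (Ideal.ne_top_iff_one _).1 p.2.ne_top, ?_⟩
      rw [one_smul]
      apply (EE0 (R := R) (R ⧸ p.asIdeal) X).injective
      rw [map_zero]
      refine LinearMap.ext fun y => ?_
      apply h1
      intro a ha
      rw [← map_smul]
      have : a • y = 0 := by
        obtain ⟨c, rfl⟩ := Ideal.Quotient.mk_surjective y
        exact Ideal.Quotient.eq_zero_iff_mem.2 (Ideal.mul_mem_right _ _ ha)
      rw [this, map_zero]
    · obtain ⟨-, δ, -, h3⟩ := hlc i
      refine (hm i (by omega)).of_surj δ (fun e => (h3 e).1 ?_)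
      rw [post_smul, ← pre_smul]
      have : x • (LinearMap.id : (R ⧸ p.asIdeal) →ₗ[R] (R ⧸ p.asIdeal)) = 0 := by
        refine LinearMap.ext fun y => ?_
        obtain ⟨c, rfl⟩ := Ideal.Quotient.mk_surjective y
        exact Ideal.Quotient.eq_zero_iff_mem.2 (Ideal.mul_mem_right _ _ hxp)
      rw [this]
      change (Abelian.Ext.mk₀ (0 : ModuleCat.of R (R ⧸ p.asIdeal) ⟶ _)).comp e (zero_add (i+1)) = 0
      simp
  · intro q hq hh
    have hxq : x ∈ q.asIdeal := by
      refine hh x (fun y => ?_)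
      obtain ⟨y, rfl⟩ := K.mkQ_surjective y
      rw [← map_smul, Submodule.mkQ_apply, Submodule.Quotient.mk_eq_zero]
      exact ⟨y, rfl⟩
    have hann : Module.annihilator R X ≤ q.asIdeal := by
      intro r hr
      rw [Module.mem_annihilator] at hr
      refine hh r (fun y => ?_)
      obtain ⟨y, rfl⟩ := K.mkQ_surjective y
      rw [← map_smul, hr, map_zero]
    obtain ⟨q', hq', hle'⟩ := Ideal.exists_minimalPrimes_le hann
    have hass := Module.associatedPrimes.minimalPrimes_annihilator_subset_associatedPrimes R X hq'
    have hxq' : x ∉ q' := fun hh => hx (Set.mem_biUnion hass hh)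
    let Q : PrimeSpectrum R := ⟨q', hq'.1.1⟩
    have hlt : Q < q := lt_of_le_of_ne hle' (fun he => hxq' (by rw [← he] at hxq; exact hxq))
    have h5 := h.ht Q (hlt.le.trans hq) (fun r hr => hq'.1.2 (Module.mem_annihilator.2 hr))
    push_cast
    exact le_trans (by gcongr) (Order.height_add_one_le hlt)
  · intro hn
    refine h.ne (Nak hxp (fun m => ?_))
    obtain ⟨s, hs, h3⟩ := hn (K.mkQ m)
    rw [← map_smul, Submodule.mkQ_apply, Submodule.Quotient.mk_eq_zero] at h3
    obtain ⟨m', h4⟩ := h3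
    exact ⟨s, hs, m', h4.symm⟩

lemma Good.final (h : Good p D j X) (hfin : Order.height p ≠ ⊤) (n : ℕ) (hn : Order.height p < (j + n : ℕ)) :
    ∃ (j : ℕ) (Y : ModuleCat.{u} R), Good p D j Y ∧ ∃ f : (R ⧸ p.asIdeal) →ₗ[R] Y, Function.Injective f := by
  induction n generalizing j X with
  | zero => exact absurd hn (not_lt_of_ge (by simpa using h.height_le))
  | succ n ih =>
    have hb := h.bar
    by_cases hx : ∀ x : X ⧸ nullPart p X, (∀ a ∈ p.asIdeal, a • x = 0) → x = 0
    · obtain ⟨x, hg⟩ := hb.step hx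
      exact ih hg (by rwa [show j + 1 + n = j + (n + 1) by omega])
    · push Not at hx
      obtain ⟨x, h1, h2⟩ := hx
      refine ⟨j, ModuleCat.of R (X ⧸ nullPart p X), hb,
        Submodule.liftQ _ (LinearMap.toSpanSingleton R _ x) (fun r hr => by
          rw [LinearMap.mem_ker, LinearMap.toSpanSingleton_apply]; exact h1 r hr), ?_⟩
      rw [injective_iff_map_eq_zero]
      intro y hy
      obtain ⟨c, rfl⟩ := Ideal.Quotient.mk_surjective y
      have hy' : c • x = 0 := hy
      rw [Ideal.Quotient.eq_zero_iff_mem]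
      by_contra hc
      exact h2 (bar_no_null x c hc hy')

lemma MinRes.bass (hE : ∀ p : PrimeSpectrum R, IsInjectiveHull R (R ⧸ p.asIdeal) (Efam p))
    (M : MinRes Efam) (hfin : Module.Finite R (M.Om 0))
    (hann : ∀ r : R, (∀ x : M.Om 0, r • x = 0) → r = 0)
    (hcyc : ∀ f : M.Om 0 →ₗ[R] M.Om 0, ∃ r : R, f = r • LinearMap.id)
    (hext : ∀ n (e : EE R (M.Om 0) (M.Om 0) (n + 1)), e = 0)
    (hterm : ∃ n, ∀ j, n ≤ j → ∀ x : M.Om j, x = 0) (p : PrimeSpectrum R) (i : ℕ) :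
    ((∃ a, M.q i a = p) ↔ Order.height p = i) ∧ ∀ a b, M.q i a = p → M.q i b = p → a = b := by
  obtain ⟨l, hl1, hl2, hl3⟩ := M.exists_l hE hfin hann hterm
  have hle := height_le_l l hl3 p
  have h1 : (1:R) ∉ p.asIdeal := (Ideal.ne_top_iff_one _).1 p.2.ne_top
  have g0 : Good p (M.Om 0) 0 (M.Om 0) := by
    refine ⟨hfin, ?_, ?_, ?_, ?_, ?_⟩
    · intro i hi e
      obtain ⟨i, rfl⟩ : ∃ k, i = k + 1 := ⟨i - 1, by omega⟩
      exact ⟨1, h1, by rw [hext i e, smul_zero]⟩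
    · refine ⟨(EE0 _ _).symm LinearMap.id, fun e => ⟨1, h1, ?_⟩⟩
      obtain ⟨r, hr⟩ := hcyc (EE0 _ _ e)
      refine ⟨r, ?_⟩
      rw [← map_smul, ← hr, one_smul, LinearEquiv.symm_apply_apply]
    · intro m hm; simpa using hm
    · intro q _ _; simp
    · intro hn
      obtain ⟨s, hs, h⟩ := hn.fin
      exact hs (by rw [hann s h]; exact zero_mem _)
  have hne : Order.height p ≠ ⊤ := ne_top_of_le_ne_top (ENat.coe_ne_top _) hle
  obtain ⟨j, Y, hg, f, hf⟩ := g0.final hne (l p + 1) (by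
    refine lt_of_le_of_lt hle ?_
    exact_mod_cast (by omega))
  have hYf := hg.fin
  have hlc := les_contra f (LinearMap.range f).mkQ hf (Submodule.mkQ_surjective _)
    (LinearMap.exact_map_mkQ_range f) (M.Om 0)
  have hlj : l p ≤ j := by
    by_contra hlt
    push Not at hlt
    obtain ⟨a, ha⟩ := hl1 p
    have := M.not_null_of_mem hE _ a
    rw [ha] at this
    obtain ⟨-, δ, h2, -⟩ := hlc (l p)
    exact this (PNull.mid (hg.null _ hlt) (M.ext_null hE _ p (hl2 p _ (Nat.lt_succ_self _)) _) _ _ h2)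
  have hjl : j ≤ l p := by exact_mod_cast hg.height_le.trans hle
  obtain rfl : j = l p := le_antisymm hjl hlj
  have hht : Order.height p = l p := le_antisymm hle hg.height_le
  have hmem : ∀ i, (∃ a, M.q i a = p) → i = l p := by
    rintro i ⟨a, ha⟩
    have := M.not_null_of_mem hE _ a
    rw [ha] at this
    rcases lt_trichotomy i (l p) with hi | hi | hi
    · exact absurd (hg.low 0 (by intro i hi; omega) i (by omega)) this
    · exact hi
    · exact absurd (M.ext_null hE _ p (hl2 p _ hi) _) this
  refine ⟨⟨fun h => by rw [hht, hmem i h], fun h => ?_⟩, ?_⟩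
  · rw [hht] at h
    obtain rfl : l p = i := by exact_mod_cast h
    exact hl1 p
  · intro a b ha hb
    have hi := hmem i ⟨a, ha⟩
    subst hi
    refine M.mult hE _ p a b ha hb ?_
    obtain ⟨-, δ, h2, -⟩ := hlc (l p)
    obtain ⟨ε, hε⟩ := hg.cyc
    refine ⟨pre f _ _ ε, fun e => ?_⟩
    obtain ⟨s, hs, h3⟩ := M.ext_null hE _ p (hl2 p _ (Nat.lt_succ_self _)) _ (δ e)
    rw [← map_smul] at h3
    obtain ⟨e', he'⟩ := (h2 _).1 h3
    obtain ⟨t, ht, r, h5⟩ := hε e'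
    refine ⟨t * s, fun hh => (p.2.mem_or_mem hh).elim ht hs, r, ?_⟩
    rw [mul_smul, ← he', ← map_smul, h5, map_smul]

abbrev II (Efam : PrimeSpectrum R → Type u) [∀ p, AddCommGroup (Efam p)]
    [∀ p, Module R (Efam p)] (k : ℕ) : Type u :=
  Π₀ q : {q : PrimeSpectrum R // Order.height q = (k : ℕ∞)}, Efam q.1

theorem resolution (hE : ∀ p : PrimeSpectrum R, IsInjectiveHull R (R ⧸ p.asIdeal) (Efam p))
    (D : Type u) [AddCommGroup D] [Module R D] (hD : IsDualizingModule R D) :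
    ∃ (η : D →ₗ[R] II Efam 0) (d : ∀ k, II Efam k →ₗ[R] II Efam (k + 1)),
      Function.Injective η ∧ Function.Exact η (d 0) ∧ ∀ k, Function.Exact (d k) (d (k + 1)) := by
  let M := minRes Efam hE (ModuleCat.of R D)
  have hb := M.bass hE hD.1 (fun r hr => hD.2.2.1.1 (by
      refine LinearMap.ext fun x => ?_
      have := hr x
      change r • x = (0:R) • x
      rw [zero_smul]; exact this))
    (fun f => by
      obtain ⟨r, hr⟩ := hD.2.2.1.2 f
      exact ⟨r, hr.symm⟩)
    (fun n e => extDD D hD n e)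
    (by
      obtain ⟨n, hn⟩ := hasInj D hD
      exact ⟨n, M.term hE n hn⟩)
  have hiso : ∀ i, Nonempty (M.I i ≃ₗ[R] II Efam i) := by
    intro i
    let e : M.ι i ≃ {q : PrimeSpectrum R // Order.height q = (i : ℕ∞)} :=
      Equiv.ofBijective (fun a => ⟨M.q i a, ((hb _ i).1).1 ⟨a, rfl⟩⟩) ⟨by
      intro a b hab
      exact (hb (M.q i b) i).2 a b (congrArg Subtype.val hab) rfl, by
      rintro ⟨q, hq⟩
      obtain ⟨a, ha⟩ := ((hb q i).1).2 hq
      exact ⟨a, Subtype.ext ha⟩⟩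
    exact ⟨(DirectSum.lequivCongrLeft (M := fun q : {q : PrimeSpectrum R // Order.height q = (i : ℕ∞)} => Efam q.1) R e.symm).symm⟩
  let iso : ∀ i, M.I i ≃ₗ[R] II Efam i := fun i => Classical.choice (hiso i)
  have hgen : ∀ k, Function.Exact (iso k ∘ M.η k)
      (iso (k+1) ∘ M.η (k+1) ∘ M.π k ∘ (iso k).symm) := by
    intro k y
    constructor
    · intro hy
      have h1 : M.π k ((iso k).symm y) = 0 := by
        apply M.η_inj (k+1)
        apply (iso (k+1)).injective
        rw [map_zero, map_zero]; exact hy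
      obtain ⟨z, hz⟩ := (M.exact k _).1 h1
      exact ⟨z, by simp [hz]⟩
    · rintro ⟨z, rfl⟩
      simp [(M.exact k).apply_apply_eq_zero]
  refine ⟨(iso 0).toLinearMap ∘ₗ M.η 0, fun k => (iso (k+1)).toLinearMap ∘ₗ M.η (k+1) ∘ₗ M.π k ∘ₗ
    (iso k).symm.toLinearMap, (iso 0).injective.comp (M.η_inj 0), hgen 0, fun k y => ?_⟩
  refine (hgen (k+1) y).trans ?_
  constructor
  · rintro ⟨z, rfl⟩
    obtain ⟨w, rfl⟩ := M.π_surj k z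
    exact ⟨iso k w, by simp⟩
  · rintro ⟨z, rfl⟩
    exact ⟨M.π k ((iso k).symm z), rfl⟩

end bass3
end GI

namespace GI
open scoped Classical
section S3
variable {R : Type u} [CommRing R] [IsNoetherianRing R]
variable {Efam : PrimeSpectrum R → Type u} [∀ p, AddCommGroup (Efam p)]
    [∀ p, Module R (Efam p)]

/-- `V(x_0, …, x_{j-1})` -/
def SS (x : ℕ → R) (j : ℕ) : Set (PrimeSpectrum R) := {q | ∀ i, i < j → x i ∈ q.asIdeal}

omit [IsNoetherianRing R] in
lemma SS_stab (x : ℕ → R) (j : ℕ) : Stab (SS x j) := fun _ _ hp h i hi => h (hp i hi)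

omit [IsNoetherianRing R] in
lemma SS_succ (x : ℕ → R) (j : ℕ) : SS x (j + 1) = SS x j ∩ Vx (x j) := by
  ext q
  constructor
  · intro h; exact ⟨fun i hi => h i (by omega), h j (by omega)⟩
  · rintro ⟨h1, h2⟩ i hi
    rcases Nat.lt_succ_iff_lt_or_eq.1 hi with h | rfl
    · exact h1 i h
    · exact h2

omit [IsNoetherianRing R] in
lemma Gam_univ {N : Type u} [AddCommGroup N] [Module R N] (x : ℕ → R) (y : N) : y ∈ Gam (SS x 0) N :=
  fun p _ i hi => absurd hi (by omega)

omit [IsNoetherianRing R] in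
lemma mem_Gam_SS_succ {N : Type u} [AddCommGroup N] [Module R N] (x : ℕ → R) (j : ℕ) (y : N) :
    y ∈ Gam (SS x (j + 1)) N ↔ y ∈ Gam (SS x j) N ∧ ∃ n : ℕ, x j ^ n • y = 0 := by
  rw [SS_succ, Gam_inter, mem_Gam_Vx]

lemma exists_sop (p : PrimeSpectrum R) (k : ℕ) (hp : Order.height p = k) :
    ∃ x : ℕ → R, (∀ i, i < k → x i ∈ p.asIdeal) ∧
      ∀ j, j ≤ k → ∀ q ∈ SS x j, (j : ℕ∞) ≤ Order.height q := by
  suffices h : ∀ m, m ≤ k → ∃ x : ℕ → R, (∀ i, i < m → x i ∈ p.asIdeal) ∧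
      ∀ j, j ≤ m → ∀ q ∈ SS x j, (j : ℕ∞) ≤ Order.height q from h k le_rfl
  intro m
  induction m with
  | zero =>
    intro _
    refine ⟨fun _ => 0, fun i hi => absurd hi (by omega), fun j hj q _ => ?_⟩
    obtain rfl : j = 0 := by omega
    simp
  | succ m ih =>
    intro hm
    obtain ⟨x, hx, hS⟩ := ih (by omega)
    let a : Ideal R := Ideal.span (x '' {i | i < m})
    have ha : ∀ q : PrimeSpectrum R, q ∈ SS x m ↔ a ≤ q.asIdeal := by
      intro q
      rw [Ideal.span_le]
      constructor
      · rintro h _ ⟨i, hi, rfl⟩; exact h i hi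
      · intro h i hi; exact h ⟨i, hi, rfl⟩
    let F : Set (Ideal R) := {q | q ∈ a.minimalPrimes ∧ ¬ p.asIdeal ≤ q}
    have hF : F.Finite := (Ideal.finite_minimalPrimes_of_isNoetherianRing R a).subset (fun q hq => hq.1)
    have hav : ¬ ((p.asIdeal : Set R) ⊆ ⋃ i ∈ F, (i : Set R)) := by
      rw [Ideal.subset_union_prime_finite hF (f := fun i : Ideal R => i) ⊥ ⊥
        (fun i hi _ _ => hi.1.1.1)]
      rintro ⟨q, hq, hle⟩
      exact hq.2 hle
    obtain ⟨y, hyp, hy⟩ := Set.not_subset.1 hav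
    have hup : ∀ j, j ≤ m → SS (Function.update x m y) j = SS x j := by
      intro j hj
      ext q
      constructor
      · intro h i hi
        have := h i hi
        rwa [Function.update_of_ne (by omega)] at this
      · intro h i hi
        rw [Function.update_of_ne (by omega)]
        exact h i hi
    refine ⟨Function.update x m y, ?_, ?_⟩
    · intro i hi
      by_cases him : i = m
      · subst him; rw [Function.update_self]; exact hyp
      · rw [Function.update_of_ne him]; exact hx i (by omega)
    · intro j hj q hq
      by_cases hjm : j ≤ m
      · rw [hup j hjm] at hq
        exact hS j hjm q hq
      · obtain rfl : j = m + 1 := by omega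
        rw [SS_succ, hup m le_rfl] at hq
        obtain ⟨hq1, hq2⟩ := hq
        have hq2 : y ∈ q.asIdeal := by
          have h : Function.update x m y m ∈ q.asIdeal := hq2
          rwa [Function.update_self] at h
        obtain ⟨q', hq', hle⟩ := Ideal.exists_minimalPrimes_le ((ha q).1 hq1)
        let Q : PrimeSpectrum R := ⟨q', hq'.1.1⟩
        have hQ := hS m le_rfl Q ((ha Q).2 hq'.1.2)
        by_cases hQq : Q = q
        · have hpq : p.asIdeal ≤ q' := by
            by_contra hno
            apply hy
            refine Set.mem_biUnion (show q' ∈ F from ⟨hq', hno⟩) ?_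
            rw [← hQq] at hq2; exact hq2
          have : p ≤ q := hpq.trans hle
          refine le_trans ?_ (Order.height_mono this)
          rw [hp]; exact_mod_cast hm
        · have hlt : Q < q := lt_of_le_of_ne hle hQq
          push_cast
          exact le_trans (by gcongr) (Order.height_add_one_le hlt)

variable (hE : ∀ p : PrimeSpectrum R, IsInjectiveHull R (R ⧸ p.asIdeal) (Efam p))
variable (d : ∀ k, II Efam k →ₗ[R] II Efam (k + 1)) (hd : ∀ k, Function.Exact (d k) (d (k + 1)))
variable (x : ℕ → R)

include hE in
lemma II_inj (k : ℕ) : Module.Injective R (II Efam k) := dfinsupp_injective _ (fun a => (hE _).1)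

/-- psi-trick -/
lemma psi_pow (hE : ∀ p : PrimeSpectrum R, IsInjectiveHull R (R ⧸ p.asIdeal) (Efam p))
    {N : Type u} [AddCommGroup N] [Module R N] (hN : Module.Injective R N) (y : R) (n : ℕ) :
    ∃ ψ : N →ₗ[R] N, ∀ v, ∃ m : ℕ, y ^ m • (v - y ^ n • ψ v) = 0 := by
  obtain ⟨ψ, hψ⟩ := J2 Efam hE N hN (y ^ n)
  refine ⟨ψ, fun v => ?_⟩
  obtain ⟨m, hm⟩ := mem_Gam_Vx.1 (hψ v)
  exact ⟨n * m, by rw [pow_mul]; exact hm⟩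

include hE hd in
lemma exact_SS (j : ℕ) : ∀ i, j ≤ i → ∀ w : II Efam (i + 1), w ∈ Gam (SS x j) _ → d (i + 1) w = 0 →
    ∃ v ∈ Gam (SS x j) (II Efam i), d i v = w := by
  induction j with
  | zero =>
    intro i _ w _ hw
    obtain ⟨v, hv⟩ := (hd i w).1 hw
    exact ⟨v, Gam_univ x v, hv⟩
  | succ j ih =>
    intro i hi w hw hdw
    rw [mem_Gam_SS_succ] at hw
    obtain ⟨hw, n, hn⟩ := hw
    obtain ⟨v, hv, hvw⟩ := ih i (by omega) w hw hdw
    obtain ⟨i, rfl⟩ : ∃ k, i = k + 1 := ⟨i - 1, by omega⟩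
    obtain ⟨u, hu, huv⟩ := ih i (by omega) (x j ^ n • v) (Submodule.smul_mem _ _ hv)
      (by rw [map_smul, hvw, hn])
    obtain ⟨ψ, hψ⟩ := psi_pow hE (II_inj hE i) (x j) n
    refine ⟨v - d i (ψ u), ?_, ?_⟩
    · rw [mem_Gam_SS_succ]
      refine ⟨Submodule.sub_mem _ hv (Gam_map _ (Gam_map _ hu)), ?_⟩
      obtain ⟨m, hm⟩ := hψ u
      refine ⟨m + n, ?_⟩
      rw [pow_add, mul_smul, smul_sub (x j ^ n), ← huv, ← map_smul, ← map_sub, ← map_smul, hm, map_zero]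
    · rw [map_sub, hvw, (hd i).apply_apply_eq_zero, sub_zero]

def HH (j : ℕ) : Submodule R (II Efam j) := Gam (SS x j) _ ⊓ LinearMap.ker (d j)

def HH' (j : ℕ) : Submodule R (II Efam j) :=
  Gam (SS x j) _ ⊓ (Gam (Vx (x j)) _).comap (d j)

omit [IsNoetherianRing R] in
lemma mem_HH {j : ℕ} {v : II Efam j} : v ∈ HH d x j ↔ v ∈ Gam (SS x j) _ ∧ d j v = 0 := Iff.rfl

omit [IsNoetherianRing R] in
lemma mem_HH' {j : ℕ} {v : II Efam j} : v ∈ HH' d x j ↔ v ∈ Gam (SS x j) _ ∧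
    ∃ n : ℕ, x j ^ n • d j v = 0 := by
  rw [← mem_Gam_Vx]; rfl

omit [IsNoetherianRing R] in
lemma HH_le (j : ℕ) : HH d x j ≤ HH' d x j := fun v hv =>
  (mem_HH' d x).2 ⟨hv.1, 0, by rw [hv.2, smul_zero]⟩

omit [IsNoetherianRing R] in
lemma HH'_pow {j : ℕ} {v : II Efam j} (hv : v ∈ HH' d x j) : ∃ n : ℕ, x j ^ n • v ∈ HH d x j := by
  obtain ⟨h1, n, hn⟩ := (mem_HH' d x).1 hv
  exact ⟨n, (mem_HH d x).2 ⟨Submodule.smul_mem _ _ h1, by rw [map_smul, hn]⟩⟩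

include hE in
lemma Gam_SS_zero (j : ℕ) (hx : ∀ q ∈ SS x (j + 1), ((j + 1 : ℕ) : ℕ∞) ≤ Order.height q)
    (v : II Efam j) (hv : v ∈ Gam (SS x (j + 1)) _) : v = 0 := by
  rw [Gam_dfinsupp] at hv
  ext q
  refine Gam_hull_eq_zero (hE _) (fun hq => ?_) (hv q)
  have := hx _ hq
  rw [q.2] at this
  have : j + 1 ≤ j := by exact_mod_cast this
  omega

include hE in
lemma HH'_bij (j : ℕ) (hx : ∀ q ∈ SS x (j + 1), ((j + 1 : ℕ) : ℕ∞) ≤ Order.height q) :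
    (∀ v ∈ HH' d x j, x j • v = 0 → v = 0) ∧ (∀ v ∈ HH' d x j, ∃ v' ∈ HH' d x j, x j • v' = v) := by
  constructor
  · intro v hv h
    refine Gam_SS_zero hE x j hx v ?_
    rw [mem_Gam_SS_succ]
    exact ⟨hv.1, 1, by rwa [pow_one]⟩
  · intro v hv
    obtain ⟨ψ, hψ⟩ := psi_pow hE (II_inj hE j) (x j) 1
    have h1 : v - x j ^ 1 • ψ v = 0 := by
      refine Gam_SS_zero hE x j hx _ ?_
      rw [mem_Gam_SS_succ]
      exact ⟨Submodule.sub_mem _ hv.1 (Submodule.smul_mem _ _ (Gam_map _ hv.1)), hψ v⟩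
    rw [pow_one, sub_eq_zero] at h1
    refine ⟨ψ v, (mem_HH' d x).2 ⟨Gam_map _ hv.1, ?_⟩, h1.symm⟩
    obtain ⟨-, n, hn⟩ := (mem_HH' d x).1 hv
    refine ⟨n + 1, ?_⟩
    rw [pow_succ, mul_smul, ← map_smul, ← h1, hn]

include hE hd in
lemma HH'_surj (j : ℕ) (w : II Efam (j + 1)) (hw : w ∈ HH d x (j + 1)) :
    ∃ v ∈ HH' d x j, d j v = w := by
  obtain ⟨h1, h2⟩ := (mem_HH d x).1 hw
  rw [mem_Gam_SS_succ] at h1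
  obtain ⟨v, hv, hvw⟩ := exact_SS hE d hd x j j le_rfl w h1.1 h2
  refine ⟨v, (mem_HH' d x).2 ⟨hv, ?_⟩, hvw⟩
  rw [hvw]; exact h1.2

include hd in
omit [IsNoetherianRing R] in
lemma HH'_map (j : ℕ) (v : II Efam j) (hv : v ∈ HH' d x j) : d j v ∈ HH d x (j + 1) := by
  refine (mem_HH d x).2 ⟨?_, (hd j).apply_apply_eq_zero _⟩
  rw [mem_Gam_SS_succ]
  obtain ⟨h1, h2⟩ := (mem_HH' d x).1 hv
  exact ⟨Gam_map _ h1, h2⟩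

include hE in
lemma HH_loc (p : PrimeSpectrum R) (k : ℕ) (hp : Order.height p = k)
    (hx : ∀ i, i < k → x i ∈ p.asIdeal) :
    (∀ v ∈ HH d x k, v ⟨p, hp⟩ = 0 → ∃ s, s ∉ p.asIdeal ∧ s • v = 0) ∧
    (∀ e : Efam p, ∃ v ∈ HH d x k, ∃ s, s ∉ p.asIdeal ∧ v ⟨p, hp⟩ = s • e) := by
  constructor
  · intro v hv h0
    refine dfin_null p.asIdeal p.2 v (fun a ha => ?_)
    have hnle : ¬ a.1.asIdeal ≤ p.asIdeal := by
      intro hle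
      have hle : a.1 ≤ p := hle
      rcases hle.eq_or_lt with h | h
      · apply ha
        obtain ⟨a, ha'⟩ := a
        simp only at h
        subst h
        exact h0
      · have := Order.height_strictMono h (by rw [a.2]; exact ENat.coe_lt_top k)
        rw [a.2, hp] at this
        exact lt_irrefl _ this
    obtain ⟨s, hs, hs'⟩ := SetLike.not_le_iff_exists.1 hnle
    obtain ⟨n, hn⟩ := hull_nil (hE a.1) hs (v a)
    exact ⟨s ^ n, fun h => hs' (p.2.mem_of_pow_mem _ h), hn⟩
  · intro e
    let v : II Efam k := DFinsupp.single (⟨p, hp⟩ : {q : PrimeSpectrum R // Order.height q = (k : ℕ∞)}) e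
    have hv : v ∈ Gam (SS x k) _ :=
      Gam_map (DFinsupp.lsingle (M := fun q : {q : PrimeSpectrum R // Order.height q = (k : ℕ∞)} => Efam q.1)
        (⟨p, hp⟩ : {q : PrimeSpectrum R // Order.height q = (k : ℕ∞)}) : Efam p →ₗ[R] II Efam k)
        (Gam_hull_mem (hE p) (SS_stab x k) hx e)
    obtain ⟨s, hs, h1⟩ := dfin_null p.asIdeal p.2 (d k v) (fun a ha => by
      have hnle : ¬ a.1.asIdeal ≤ p.asIdeal := by
        intro hle
        have hle : a.1 ≤ p := hle
        have := Order.height_mono hle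
        rw [a.2, hp] at this
        have : k + 1 ≤ k := by exact_mod_cast this
        omega
      obtain ⟨s, hs, hs'⟩ := SetLike.not_le_iff_exists.1 hnle
      obtain ⟨n, hn⟩ := hull_nil (hE a.1) hs (d k v a)
      exact ⟨s ^ n, fun h => hs' (p.2.mem_of_pow_mem _ h), hn⟩)
    refine ⟨s • v, (mem_HH d x).2 ⟨Submodule.smul_mem _ _ hv, by rw [map_smul, h1]⟩, s, hs, ?_⟩
    rw [DFinsupp.smul_apply, DFinsupp.single_eq_same]

end S3
end GI

namespace GI
open scoped Classical
section S4
variable {R : Type u} [CommRing R]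

lemma inj_extend {Y : Type u} [AddCommGroup Y] [Module R Y] (hY : Module.Injective R Y)
    {A B : Type u} [AddCommGroup A] [Module R A] [AddCommGroup B] [Module R B]
    (f : A →ₗ[R] B) (hf : Function.Injective f) (h : A →ₗ[R] Y) :
    ∃ h' : B →ₗ[R] Y, h' ∘ₗ f = h := by
  obtain ⟨h', hh⟩ := hY.out f hf h
  exact ⟨h', LinearMap.ext hh⟩

lemma descend {Y A B C : Type u} [AddCommGroup Y] [Module R Y]
    [AddCommGroup A] [Module R A] [AddCommGroup B] [Module R B] [AddCommGroup C] [Module R C]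
    (f : A →ₗ[R] B) (g : B →ₗ[R] C) (hg : Function.Surjective g) (hfg : Function.Exact f g)
    (h : B →ₗ[R] Y) (hh : h ∘ₗ f = 0) : ∃ h' : C →ₗ[R] Y, h' ∘ₗ g = h := by
  obtain ⟨s, hs⟩ := hg.hasRightInverse
  have key : ∀ b b', g b = g b' → h b = h b' := by
    intro b b' hb
    obtain ⟨a, ha⟩ := (hfg (b - b')).1 (by rw [map_sub, hb, sub_self])
    have := LinearMap.congr_fun hh a
    simp only [LinearMap.comp_apply, ha, map_sub, LinearMap.zero_apply] at this
    exact sub_eq_zero.1 this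
  refine ⟨⟨⟨fun c => h (s c), fun c c' => ?_⟩, fun r c => ?_⟩, ?_⟩
  · rw [← map_add]; apply key; rw [map_add, hs, hs, hs]
  · simp only [RingHom.id_apply]; rw [← map_smul]; apply key; rw [map_smul, hs, hs]
  · ext b; exact key _ _ (hs _)

structure Cx (R : Type u) [CommRing R] where
  Y : ℤ → Type u
  [acg : ∀ i, AddCommGroup (Y i)]
  [mod : ∀ i, Module R (Y i)]
  d : ∀ i : ℤ, Y (i + 1) →ₗ[R] Y i
  inj : ∀ i, Module.Injective R (Y i)
  dd : ∀ i, (d i) ∘ₗ (d (i + 1)) = 0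

attribute [instance] Cx.acg Cx.mod

variable (K : Cx R)

def CC (X : Type u) [AddCommGroup X] [Module R X] : Prop :=
  ∀ i (g : X →ₗ[R] K.Y (i + 1)), K.d i ∘ₗ g = 0 → ∃ f : X →ₗ[R] K.Y (i + 1 + 1), K.d (i + 1) ∘ₗ f = g

section
variable {K} {A B C : Type u} [AddCommGroup A] [Module R A] [AddCommGroup B] [Module R B]
    [AddCommGroup C] [Module R C]

lemma CC.retract (hB : CC K B) (i : A →ₗ[R] B) (r : B →ₗ[R] A) (h : r ∘ₗ i = LinearMap.id) :
    CC K A := by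
  intro n g hg
  obtain ⟨f, hf⟩ := hB n (g ∘ₗ r) (by rw [← LinearMap.comp_assoc, hg, LinearMap.zero_comp])
  exact ⟨f ∘ₗ i, by rw [← LinearMap.comp_assoc, hf, LinearMap.comp_assoc, h, LinearMap.comp_id]⟩

lemma CC.equiv (hB : CC K B) (e : A ≃ₗ[R] B) : CC K A :=
  hB.retract e.toLinearMap e.symm.toLinearMap (by ext; simp)

lemma CC.subsing [Subsingleton A] : CC K A := by
  intro n g hg
  refine ⟨0, ?_⟩
  ext a
  rw [Subsingleton.elim a 0]; simp

lemma CC.dfinsupp {ι : Type u} (X : ι → Type u) [∀ i, AddCommGroup (X i)] [∀ i, Module R (X i)]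
    (h : ∀ i, CC K (X i)) : CC K (Π₀ i, X i) := by
  intro n g hg
  have : ∀ i, ∃ f : X i →ₗ[R] K.Y (n + 1 + 1), K.d (n + 1) ∘ₗ f = g ∘ₗ DFinsupp.lsingle i :=
    fun i => h i n _ (by rw [← LinearMap.comp_assoc, hg, LinearMap.zero_comp])
  choose f hf using this
  refine ⟨DFinsupp.lsum ℕ f, ?_⟩
  apply DFinsupp.lhom_ext'
  intro i
  rw [← hf i]
  ext a
  simp

variable (f : A →ₗ[R] B) (g : B →ₗ[R] C) (hf : Function.Injective f)
  (hg : Function.Surjective g) (hfg : Function.Exact f g)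

include hf hg hfg

lemma CC.mid (hA : CC K A) (hC : CC K C) : CC K B := by
  intro i h hh
  obtain ⟨u, hu⟩ := hA i (h ∘ₗ f) (by rw [← LinearMap.comp_assoc, hh, LinearMap.zero_comp])
  obtain ⟨U, hU⟩ := inj_extend (K.inj _) f hf u
  obtain ⟨c, hc⟩ := descend f g hg hfg (h - K.d (i + 1) ∘ₗ U)
    (by rw [LinearMap.sub_comp, LinearMap.comp_assoc, hU, hu, sub_self])
  obtain ⟨w, hw⟩ := hC i c (by
    rw [← LinearMap.cancel_right hg, LinearMap.comp_assoc, hc, LinearMap.comp_sub, hh,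
      ← LinearMap.comp_assoc, K.dd, LinearMap.zero_comp, LinearMap.zero_comp, sub_zero])
  refine ⟨U + w ∘ₗ g, ?_⟩
  rw [LinearMap.comp_add, ← LinearMap.comp_assoc, hw, hc]; abel

lemma CC.right (hA : CC K A) (hB : CC K B) : CC K C := by
  intro i h hh
  obtain ⟨u, hu⟩ := hB i (h ∘ₗ g) (by rw [← LinearMap.comp_assoc, hh, LinearMap.zero_comp])
  have h0 : h ∘ₗ g ∘ₗ f = 0 := by rw [hfg.linearMap_comp_eq_zero, LinearMap.comp_zero]
  obtain ⟨w, hw⟩ := hA (i + 1) (u ∘ₗ f) (by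
    rw [← LinearMap.comp_assoc, hu, LinearMap.comp_assoc, h0])
  obtain ⟨W, hW⟩ := inj_extend (K.inj _) f hf w
  obtain ⟨c, hc⟩ := descend f g hg hfg (u - K.d (i + 1 + 1) ∘ₗ W)
    (by rw [LinearMap.sub_comp, LinearMap.comp_assoc, hW, hw, sub_self])
  refine ⟨c, ?_⟩
  rw [← LinearMap.cancel_right hg, LinearMap.comp_assoc, hc, LinearMap.comp_sub, hu,
      ← LinearMap.comp_assoc, K.dd, LinearMap.zero_comp, sub_zero]

lemma CC.left (hB : CC K B) (hC : CC K C) : CC K A := by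
  intro i h hh
  obtain ⟨i, rfl⟩ : ∃ j, i = j + 1 := ⟨i - 1, by omega⟩
  obtain ⟨H, hH⟩ := inj_extend (K.inj _) f hf h
  obtain ⟨c, hc⟩ := descend f g hg hfg (K.d (i + 1) ∘ₗ H)
    (by rw [LinearMap.comp_assoc, hH, hh])
  obtain ⟨w, hw⟩ := hC i c (by
    rw [← LinearMap.cancel_right hg, LinearMap.comp_assoc, hc, ← LinearMap.comp_assoc, K.dd,
      LinearMap.zero_comp, LinearMap.zero_comp])
  obtain ⟨u, hu⟩ := hB (i + 1) (H - w ∘ₗ g) (by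
    rw [LinearMap.comp_sub, ← LinearMap.comp_assoc, hw, hc, sub_self])
  refine ⟨u ∘ₗ f, ?_⟩
  rw [← LinearMap.comp_assoc, hu, LinearMap.sub_comp, hH, LinearMap.comp_assoc,
    hfg.linearMap_comp_eq_zero, LinearMap.comp_zero, sub_zero]

end

lemma CC.union {H' : Type u} [AddCommGroup H'] [Module R H'] (H : ℕ → Submodule R H')
    (hm : Monotone H) (hall : ∀ v, ∃ n, v ∈ H n) (hC : ∀ n, CC K (H n)) : CC K H' := by
  intro i g hg
  have step : ∀ n (F : H' →ₗ[R] K.Y (i + 1 + 1)), (∀ v ∈ H n, K.d (i + 1) (F v) = g v) →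
      ∃ F' : H' →ₗ[R] K.Y (i + 1 + 1), (∀ v ∈ H (n + 1), K.d (i + 1) (F' v) = g v) ∧
        ∀ v ∈ H n, F' v = F v := by
    intro n F hF
    obtain ⟨e, he⟩ := hC (n + 1) i (g ∘ₗ (H (n + 1)).subtype)
      (by rw [← LinearMap.comp_assoc, hg, LinearMap.zero_comp])
    have he' : ∀ v, K.d (i + 1) (e v) = g v := fun v => LinearMap.congr_fun he v
    let j := Submodule.inclusion (hm (Nat.le_succ n))
    obtain ⟨u, hu⟩ := hC n (i + 1) (F ∘ₗ (H n).subtype - e ∘ₗ j) (by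
      ext v
      simp only [LinearMap.comp_apply, LinearMap.sub_apply, map_sub, Submodule.subtype_apply,
        hF _ v.2, he', LinearMap.zero_apply, j, Submodule.coe_inclusion, sub_self])
    obtain ⟨U, hU⟩ := inj_extend (K.inj _) (H n).subtype (H n).subtype_injective u
    obtain ⟨F', hF'⟩ := inj_extend (K.inj _) (H (n + 1)).subtype (H (n + 1)).subtype_injective
      (e + K.d _ ∘ₗ U ∘ₗ (H (n + 1)).subtype)
    refine ⟨F', fun v hv => ?_, fun v hv => ?_⟩
    · have := LinearMap.congr_fun hF' ⟨v, hv⟩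
      simp only [LinearMap.comp_apply, Submodule.subtype_apply, LinearMap.add_apply] at this
      rw [this, map_add, he']
      have h2 := LinearMap.congr_fun (K.dd (i + 1)) (U v)
      simp only [LinearMap.comp_apply, LinearMap.zero_apply] at h2
      rw [h2, add_zero]
    · have := LinearMap.congr_fun hF' ⟨v, hm (Nat.le_succ n) hv⟩
      simp only [LinearMap.comp_apply, Submodule.subtype_apply, LinearMap.add_apply] at this
      have h2 := LinearMap.congr_fun hU ⟨v, hv⟩
      have h3 := LinearMap.congr_fun hu ⟨v, hv⟩
      simp only [LinearMap.comp_apply, LinearMap.sub_apply, Submodule.subtype_apply] at h2 h3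
      rw [this, h2, h3]
      simp [j, Submodule.inclusion_apply]
  obtain ⟨e, he⟩ := hC 0 i (g ∘ₗ (H 0).subtype)
      (by rw [← LinearMap.comp_assoc, hg, LinearMap.zero_comp])
  obtain ⟨F0, hF0⟩ := inj_extend (K.inj _) (H 0).subtype (H 0).subtype_injective e
  have hF0' : ∀ v ∈ H 0, K.d (i + 1) (F0 v) = g v := by
    intro v hv
    have h2 := LinearMap.congr_fun hF0 ⟨v, hv⟩
    have h3 := LinearMap.congr_fun he ⟨v, hv⟩
    simp only [LinearMap.comp_apply, Submodule.subtype_apply] at h2 h3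
    rw [h2, h3]
  let T := fun n => {F : H' →ₗ[R] K.Y (i + 1 + 1) // ∀ v ∈ H n, K.d (i + 1) (F v) = g v}
  let F : ∀ n, T n := fun n => Nat.rec ⟨F0, hF0'⟩ (fun n F => ⟨(step n F.1 F.2).choose,
    (step n F.1 F.2).choose_spec.1⟩) n
  have hstep : ∀ n, ∀ v ∈ H n, (F (n + 1)).1 v = (F n).1 v := fun n =>
    (step n (F n).1 (F n).2).choose_spec.2
  have hFF : ∀ n m, n ≤ m → ∀ v ∈ H n, (F m).1 v = (F n).1 v := by
    intro n m hnm v hv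
    induction m, hnm using Nat.le_induction with
    | base => rfl
    | succ m hnm ih => rw [hstep m v (hm hnm hv), ih]
  choose N hN using hall
  have hval : ∀ v m, v ∈ H m → (F (N v)).1 v = (F m).1 v := by
    intro v m hv
    rw [← hFF (N v) (max (N v) m) (le_max_left _ _) v (hN v), hFF m _ (le_max_right _ _) v hv]
  refine ⟨⟨⟨fun v => (F (N v)).1 v, fun v w => ?_⟩, fun r v => ?_⟩, ?_⟩
  · have hv := hm (le_max_left (N v) (N w)) (hN v)
    have hw := hm (le_max_right (N v) (N w)) (hN w)
    rw [hval v _ hv, hval w _ hw, hval _ _ (Submodule.add_mem _ hv hw), map_add]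
  · change (F (N (r • v))).1 (r • v) = r • (F (N v)).1 v
    rw [hval (r • v) _ (Submodule.smul_mem _ r (hN v)), map_smul]
  · ext v
    exact (F (N v)).2 v (hN v)

variable [IsNoetherianRing R]
variable {Efam : PrimeSpectrum R → Type u} [∀ p, AddCommGroup (Efam p)]
    [∀ p, Module R (Efam p)]
variable (hE : ∀ p : PrimeSpectrum R, IsInjectiveHull R (R ⧸ p.asIdeal) (Efam p))
variable (d : ∀ k, II Efam k →ₗ[R] II Efam (k + 1)) (hd : ∀ k, Function.Exact (d k) (d (k + 1)))

def HHn (x : ℕ → R) (j n : ℕ) : Submodule R (HH' d x j) :=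
  (HH d x j).comap (x j ^ n • (HH' d x j).subtype)

omit [IsNoetherianRing R] in
lemma mem_HHn (x : ℕ → R) (j n : ℕ) (v : HH' d x j) :
    v ∈ HHn d x j n ↔ x j ^ n • v.1 ∈ HH d x j := Iff.rfl

include hE hd in
lemma CC_HH (x : ℕ → R) (k : ℕ)
    (hx : ∀ j, j ≤ k → ∀ q ∈ SS x j, (j : ℕ∞) ≤ Order.height q)
    (h0 : CC K (LinearMap.ker (d 0))) : ∀ j, j ≤ k → CC K (HH d x j) := by
  intro j
  induction j with
  | zero =>
    intro _
    have : HH d x 0 = LinearMap.ker (d 0) := by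
      ext v; rw [mem_HH]; exact ⟨fun h => h.2, fun h => ⟨Gam_univ x v, h⟩⟩
    rw [this]; exact h0
  | succ j ih =>
    intro hj
    have hC := ih (by omega)
    obtain ⟨b1, b2⟩ := HH'_bij hE d x j (hx (j + 1) hj)
    have b1' : ∀ n, ∀ v ∈ HH' d x j, x j ^ n • v = 0 → v = 0 := by
      intro n
      induction n with
      | zero => intro v _ h; simpa using h
      | succ n ihn =>
        intro v hv h
        rw [pow_succ, mul_smul] at h
        exact b1 v hv (ihn _ (Submodule.smul_mem _ _ hv) h)
    have b2' : ∀ n, ∀ v ∈ HH' d x j, ∃ v' ∈ HH' d x j, x j ^ n • v' = v := by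
      intro n
      induction n with
      | zero => intro v hv; exact ⟨v, hv, by simp⟩
      | succ n ihn =>
        intro v hv
        obtain ⟨v1, h1, rfl⟩ := b2 v hv
        obtain ⟨v2, h2, rfl⟩ := ihn v1 h1
        exact ⟨v2, h2, by rw [pow_succ', mul_smul]⟩
    have hC' : CC K (HH' d x j) := by
      refine CC.union K (HHn d x j) ?_ ?_ ?_
      · refine monotone_nat_of_le_succ (fun n v hv => ?_)
        rw [mem_HHn] at hv ⊢
        rw [pow_succ', mul_smul]; exact Submodule.smul_mem _ _ hv
      · intro v; exact HH'_pow d x v.2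
      · intro n
        let φ : HHn d x j n →ₗ[R] HH d x j :=
          LinearMap.codRestrict _ (x j ^ n • (HH' d x j).subtype ∘ₗ (HHn d x j n).subtype)
            (fun v => v.2)
        have hφ : Function.Bijective φ := by
          constructor
          · rw [injective_iff_map_eq_zero]
            intro v hv
            have : x j ^ n • v.1.1 = 0 := congrArg Subtype.val hv
            exact Subtype.ext (Subtype.ext (b1' n _ v.1.2 this))
          · intro w
            obtain ⟨v, hv, hvw⟩ := b2' n w.1 (HH_le d x j w.2)
            refine ⟨⟨⟨v, hv⟩, ?_⟩, Subtype.ext hvw⟩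
            rw [mem_HHn]; simp only [hvw]; exact w.2
        exact hC.equiv (LinearEquiv.ofBijective φ hφ)
    let δ : HH' d x j →ₗ[R] HH d x (j + 1) :=
      LinearMap.codRestrict _ (d j ∘ₗ (HH' d x j).subtype) (fun v => HH'_map d hd x j v.1 v.2)
    refine CC.right (Submodule.inclusion (HH_le d x j)) δ (Submodule.inclusion_injective _) ?_ ?_ hC hC'
    · intro w
      obtain ⟨v, hv, hvw⟩ := HH'_surj hE d hd x j w.1 w.2
      exact ⟨⟨v, hv⟩, Subtype.ext hvw⟩
    · intro v
      constructor
      · intro h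
        exact ⟨⟨v.1, (mem_HH d x).2 ⟨v.2.1, congrArg Subtype.val h⟩⟩, Subtype.ext rfl⟩
      · rintro ⟨w, rfl⟩
        exact Subtype.ext ((mem_HH d x).1 w.2).2

include hE hd in
lemma CC_E (dim : ℕ) (hdim : ∀ p : PrimeSpectrum R, Order.height p ≤ dim)
    (h0 : CC K (LinearMap.ker (d 0))) : ∀ n k : ℕ, dim < k + n →
    ∀ p : PrimeSpectrum R, Order.height p = k → CC K (Efam p) := by
  intro n
  induction n with
  | zero =>
    intro k hk p hp
    have := hdim p
    rw [hp] at this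
    have : k ≤ dim := by exact_mod_cast this
    omega
  | succ n ih =>
    intro k hk p hp
    obtain ⟨x, hx1, hx2⟩ := exists_sop p k hp
    have hH := CC_HH K hE d hd x k hx2 h0 k le_rfl
    let Z : ∀ i, Submodule R (II Efam i) := fun i => Gam (SS x k) _ ⊓ LinearMap.ker (d i)
    let δ : ∀ i, Gam (SS x k) (II Efam i) →ₗ[R] Z (i + 1) := fun i =>
      LinearMap.codRestrict _ (d i ∘ₗ (Gam (SS x k) (II Efam i)).subtype)
        (fun v => ⟨Gam_map (d i) v.2, (hd i).apply_apply_eq_zero _⟩)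
    let ι : ∀ i, Z i →ₗ[R] Gam (SS x k) (II Efam i) := fun i => Submodule.inclusion inf_le_left
    have hι : ∀ i, Function.Injective (ι i) := fun i => Submodule.inclusion_injective _
    have hδ : ∀ i, k ≤ i → Function.Surjective (δ i) := by
      intro i hi w
      obtain ⟨v, hv, hvw⟩ := exact_SS hE d hd x k i hi w.1 w.2.1 w.2.2
      exact ⟨⟨v, hv⟩, Subtype.ext hvw⟩
    have hex : ∀ i, Function.Exact (ι i) (δ i) := by
      intro i v
      constructor
      · intro h
        exact ⟨⟨v.1, ⟨v.2, congrArg Subtype.val h⟩⟩, Subtype.ext rfl⟩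
      · rintro ⟨w, rfl⟩
        exact Subtype.ext w.2.2
    have hΓ : ∀ i, k < i → CC K (Gam (SS x k) (II Efam i)) := by
      intro i hi
      have h1 : CC K (II Efam i) := CC.dfinsupp _ (fun q => ih i (by omega) q.1 q.2)
      obtain ⟨π, hπ1, hπ2⟩ := J1 Efam hE (II Efam i) (II_inj hE i) (SS x k) (SS_stab x k)
      refine h1.retract (Submodule.subtype _) (LinearMap.codRestrict _ π hπ1) ?_
      ext v : 1
      exact Subtype.ext (hπ2 v.1 v.2)
    have hZ : ∀ m i, dim < i + m → k < i → CC K (Z i) := by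
      intro m
      induction m with
      | zero =>
        intro i hi _
        have : IsEmpty {q : PrimeSpectrum R // Order.height q = (i : ℕ∞)} := ⟨fun q => by
          have := hdim q.1
          rw [q.2] at this
          have : i ≤ dim := by exact_mod_cast this
          omega⟩
        have : Subsingleton (II Efam i) := inferInstance
        exact CC.subsing
      | succ m ihm =>
        intro i hi hki
        exact CC.left (ι i) (δ i) (hι i) (hδ i hki.le) (hex i) (hΓ i hki) (ihm (i + 1) (by omega) (by omega))
    have hB := CC.mid (ι k) (δ k) (hι k) (hδ k le_rfl) (hex k) hH (hZ dim (k + 1) (by omega) (by omega))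
    let q : {q : PrimeSpectrum R // Order.height q = (k : ℕ∞)} := ⟨p, hp⟩
    let l : Efam p →ₗ[R] II Efam k := (DFinsupp.lsingle (M := fun q : {q : PrimeSpectrum R // Order.height q = (k : ℕ∞)} => Efam q.1) q)
    let c : II Efam k →ₗ[R] Efam p := (DFinsupp.lapply (M := fun q : {q : PrimeSpectrum R // Order.height q = (k : ℕ∞)} => Efam q.1) q)
    refine hB.retract (LinearMap.codRestrict _ l (fun e => Gam_map l (Gam_hull_mem (hE p) (SS_stab x k) hx1 e)))
      (c ∘ₗ Submodule.subtype _) ?_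
    ext e
    simp [l, c, q]

lemma height_bdd (dim : ℕ) (hdim : ringKrullDim R = (dim : ℕ)) (p : PrimeSpectrum R) : Order.height p ≤ dim := by
  have := Order.height_le_krullDim p
  change _ ≤ ringKrullDim R at this
  rw [hdim] at this
  exact_mod_cast this

/-- Lemma A -/
lemma CC_inj (hE : ∀ p : PrimeSpectrum R, IsInjectiveHull R (R ⧸ p.asIdeal) (Efam p))
    (D : Type u) [AddCommGroup D] [Module R D] (hD : IsDualizingModule R D)
    (dim : ℕ) (hdim : ringKrullDim R = (dim : ℕ)) (h : CC K D)
    (N : Type u) [AddCommGroup N] [Module R N] (hN : Module.Injective R N) : CC K N := by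
  obtain ⟨η, d, hη, hηd, hd⟩ := resolution hE D hD
  have h0 : CC K (LinearMap.ker (d 0)) := by
    refine h.equiv ?_
    refine LinearEquiv.symm ((LinearEquiv.ofInjective η hη).trans (LinearEquiv.ofEq _ _ ?_))
    rw [hηd.linearMap_ker_eq]
  have hEC : ∀ p, CC K (Efam p) := by
    intro p
    have hp := height_bdd dim hdim p
    obtain ⟨k, hk⟩ := ENat.ne_top_iff_exists.1 (ne_top_of_le_ne_top (ENat.coe_ne_top dim) hp)
    exact CC_E K hE d hd dim (height_bdd dim hdim) h0 (dim + 1) k (by omega) p hk.symm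
  obtain ⟨ι, q, ⟨e⟩⟩ := exists_decomp Efam hE N hN
  exact (CC.dfinsupp (fun i => Efam (q i)) (fun i => hEC _)).equiv e

/-- converse -/
lemma CC_D (hE : ∀ p : PrimeSpectrum R, IsInjectiveHull R (R ⧸ p.asIdeal) (Efam p))
    (D : Type u) [AddCommGroup D] [Module R D] (hD : IsDualizingModule R D)
    (dim : ℕ) (hdim : ringKrullDim R = (dim : ℕ))
    (h : ∀ (N : Type u) [AddCommGroup N] [Module R N] (hN : Module.Injective R N), CC K N) : CC K D := by
  obtain ⟨η, d, hη, hηd, hd⟩ := resolution hE D hD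
  have hZ : ∀ m i, dim < i + m → CC K (LinearMap.ker (d i)) := by
    intro m
    induction m with
    | zero =>
      intro i hi
      have : IsEmpty {q : PrimeSpectrum R // Order.height q = (i : ℕ∞)} := ⟨fun q => by
          have := height_bdd dim hdim q.1
          rw [q.2] at this
          have : i ≤ dim := by exact_mod_cast this
          omega⟩
      have : Subsingleton (II Efam i) := inferInstance
      exact CC.subsing
    | succ m ihm =>
      intro i hi
      refine CC.left (LinearMap.ker (d i)).subtype (LinearMap.codRestrict (LinearMap.ker (d (i + 1))) (d i)
        (fun v => (hd i).apply_apply_eq_zero v)) (Submodule.subtype_injective _) ?_ ?_ (h _ (II_inj hE i)) (ihm (i + 1) (by omega))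
      · intro w
        obtain ⟨v, hv⟩ := (hd i w.1).1 w.2
        exact ⟨v, Subtype.ext hv⟩
      · intro v
        constructor
        · intro h
          exact ⟨⟨v, congrArg Subtype.val h⟩, rfl⟩
        · rintro ⟨w, rfl⟩
          exact Subtype.ext w.2
  refine (hZ (dim + 1) 0 (by omega)).equiv ?_
  refine ((LinearEquiv.ofInjective η hη).trans (LinearEquiv.ofEq _ _ ?_))
  rw [hηd.linearMap_ker_eq]

end S4
end GI

namespace GI
open scoped Classical
section S4B
variable {R : Type u} [CommRing R]

section GQ
variable (W W' : Set (PrimeSpectrum R))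

abbrev GQ (N : Type u) [AddCommGroup N] [Module R N] : Type u :=
  ↥(Gam W N) ⧸ Submodule.comap (Gam W N).subtype (Gam W' N)

variable {N N' N'' : Type u} [AddCommGroup N] [Module R N] [AddCommGroup N'] [Module R N']
  [AddCommGroup N''] [Module R N'']

def Gmap (f : N →ₗ[R] N') : Gam W N →ₗ[R] Gam W N' :=
  f.restrict (fun _ hv => Gam_map f hv)

@[simp] lemma Gmap_coe (f : N →ₗ[R] N') (v) : (Gmap W f v : N') = f v := rfl

def GQmap (f : N →ₗ[R] N') : GQ W W' N →ₗ[R] GQ W W' N' :=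
  Submodule.mapQ _ _ (Gmap W f) (fun v hv => Gam_map f (y := v.1) hv)

def GQmk (v : N) (hv : v ∈ Gam W N) : GQ W W' N := Submodule.Quotient.mk ⟨v, hv⟩

variable {W W'}
lemma GQmk_surj (z : GQ W W' N) : ∃ v hv, z = GQmk W W' v hv := by
  obtain ⟨⟨v, hv⟩, rfl⟩ := Submodule.Quotient.mk_surjective _ z
  exact ⟨v, hv, rfl⟩

lemma GQmk_eq {v v' : N} {hv hv'} : GQmk W W' v hv = GQmk W W' v' hv' ↔ v - v' ∈ Gam W' N :=
  Submodule.Quotient.eq _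

lemma GQmk_eq_zero {v : N} {hv} : GQmk W W' v hv = 0 ↔ v ∈ Gam W' N :=
  Submodule.Quotient.mk_eq_zero _

@[simp] lemma GQmap_mk (f : N →ₗ[R] N') (v : N) (hv) : GQmap W W' f (GQmk W W' v hv) =
    GQmk W W' (f v) (Gam_map f hv) := rfl

end GQ

variable [IsNoetherianRing R]
variable {Efam : PrimeSpectrum R → Type u} [∀ p, AddCommGroup (Efam p)]
    [∀ p, Module R (Efam p)]
variable (hE : ∀ p : PrimeSpectrum R, IsInjectiveHull R (R ⧸ p.asIdeal) (Efam p))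
variable (K : Cx R)

include hE in
lemma lemB_SS {X : Type u} [AddCommGroup X] [Module R X] [Module.Finite R X] (hX : CC K X)
    (x : ℕ → R) (m : ℕ) : ∀ i (g : X →ₗ[R] K.Y (i + 1)), K.d i ∘ₗ g = 0 →
      (∀ v, g v ∈ Gam (SS x m) _) → ∃ f : X →ₗ[R] K.Y (i + 1 + 1), K.d (i + 1) ∘ₗ f = g ∧
        ∀ v, f v ∈ Gam (SS x m) _ := by
  induction m with
  | zero =>
    intro i g hg _
    obtain ⟨f, hf⟩ := hX i g hg
    exact ⟨f, hf, fun v => Gam_univ x _⟩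
  | succ m ih =>
    intro i g hg hgv
    simp only [mem_Gam_SS_succ] at hgv
    obtain ⟨f, hf, hfv⟩ := ih i g hg (fun v => (hgv v).1)
    obtain ⟨n, hn⟩ : ∃ n : ℕ, x m ^ n • g = 0 := by
      obtain ⟨S, hS⟩ := Module.Finite.fg_top (R := R) (M := X)
      choose N hN using fun v => (hgv v).2
      refine ⟨S.sup N, ?_⟩
      rw [← LinearMap.ker_eq_top, ← top_le_iff, ← hS, Submodule.span_le]
      intro v hv
      have : N v ≤ S.sup N := Finset.le_sup hv
      obtain ⟨c, hc⟩ := Nat.exists_eq_add_of_le this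
      change x m ^ _ • g v = 0
      rw [hc, Nat.add_comm (N v) c, pow_add, mul_smul, hN, smul_zero]
    obtain ⟨u, hu, huv⟩ := ih (i + 1) (x m ^ n • f) (by rw [LinearMap.comp_smul, hf, hn])
      (fun v => Submodule.smul_mem _ _ (hfv v))
    obtain ⟨ψ, hψ⟩ := psi_pow hE (K.inj (i + 1 + 1 + 1)) (x m) n
    refine ⟨f - K.d _ ∘ₗ ψ ∘ₗ u, ?_, fun v => ?_⟩
    · rw [LinearMap.comp_sub, hf, ← LinearMap.comp_assoc, K.dd, LinearMap.zero_comp, sub_zero]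
    · rw [mem_Gam_SS_succ]
      refine ⟨Submodule.sub_mem _ (hfv v) (Gam_map (K.d _) (Gam_map ψ (huv v))), ?_⟩
      obtain ⟨l, hl⟩ := hψ (u v)
      refine ⟨l + n, ?_⟩
      have h2 := LinearMap.congr_fun hu v
      simp only [LinearMap.comp_apply, LinearMap.smul_apply] at h2
      simp only [LinearMap.comp_apply, LinearMap.sub_apply]
      rw [pow_add, mul_smul, smul_sub (x m ^ n), ← h2, ← map_smul, ← map_sub, ← map_smul, hl, map_zero]

include hE in
lemma lemB {X : Type u} [AddCommGroup X] [Module R X] [Module.Finite R X] (hX : CC K X)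
    (W : Set (PrimeSpectrum R)) (i) (g : X →ₗ[R] K.Y (i + 1)) (hg : K.d i ∘ₗ g = 0)
    (hgv : ∀ v, g v ∈ Gam W _) : ∃ f : X →ₗ[R] K.Y (i + 1 + 1), K.d (i + 1) ∘ₗ f = g ∧
        ∀ v, f v ∈ Gam W _ := by
  let a : Ideal R := LinearMap.ker (LinearMap.toSpanSingleton R (X →ₗ[R] K.Y (i + 1)) g)
  have ha : ∀ r, r ∈ a ↔ r • g = 0 := fun r => Iff.rfl
  have hW : ∀ p : PrimeSpectrum R, a ≤ p.asIdeal → p ∈ W := by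
    intro p hp
    obtain ⟨S, hS⟩ := Module.Finite.fg_top (R := R) (M := X)
    by_contra hpW
    have h1 : ∀ v, ∃ r : R, r • g v = 0 ∧ r ∉ p.asIdeal := by
      intro v
      by_contra! h
      exact hpW (hgv v p h)
    choose r hr hrp using h1
    have : ∏ v ∈ S, r v ∈ a := by
      rw [ha, ← LinearMap.ker_eq_top, ← top_le_iff, ← hS, Submodule.span_le]
      intro v hv
      change (∏ v ∈ S, r v) • g v = 0
      obtain ⟨c, hc⟩ := Finset.dvd_prod_of_mem r hv
      rw [hc, mul_comm, mul_smul, hr, smul_zero]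
    obtain ⟨v, -, hv⟩ := (Ideal.IsPrime.prod_mem_iff).1 (hp this)
    exact hrp v hv
  obtain ⟨m, s, hs⟩ := Submodule.fg_iff_exists_fin_generating_family.1 (IsNoetherian.noetherian a)
  let x : ℕ → R := fun i => if h : i < m then s ⟨i, h⟩ else 0
  have hSS : ∀ q : PrimeSpectrum R, q ∈ SS x m ↔ a ≤ q.asIdeal := by
    intro q
    rw [← hs]
    erw [Submodule.span_le]
    constructor
    · rintro h _ ⟨i, rfl⟩
      have := h i.1 i.2
      simpa [x, i.2] using this
    · intro h i hi
      have := h ⟨⟨i, hi⟩, rfl⟩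
      simpa [x, hi] using this
  obtain ⟨f, hf, hfv⟩ := lemB_SS hE K hX x m i g hg (fun v p hp => by
    rw [hSS]
    intro r hr
    exact hp r (LinearMap.congr_fun ((ha r).1 hr) v))
  exact ⟨f, hf, fun v => Gam_mono (fun q hq => hW q ((hSS q).1 hq)) (hfv v)⟩

/-- elementwise version -/
lemma lemB_elt (hE : ∀ p : PrimeSpectrum R, IsInjectiveHull R (R ⧸ p.asIdeal) (Efam p)) (hX : CC K R)
    (W : Set (PrimeSpectrum R)) (i) (y : K.Y (i + 1)) (hy : K.d i y = 0) (hW : y ∈ Gam W _) :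
    ∃ z ∈ Gam W (K.Y (i + 1 + 1)), K.d (i + 1) z = y := by
  obtain ⟨f, hf, hfv⟩ := lemB hE K hX W i (LinearMap.toSpanSingleton R _ y) (by ext; simpa using hy)
    (fun v => by
      rw [LinearMap.toSpanSingleton_apply]; exact Submodule.smul_mem _ _ hW)
  exact ⟨f 1, hfv 1, by simpa using LinearMap.congr_fun hf 1⟩

lemma lemB_elt' (hE : ∀ p : PrimeSpectrum R, IsInjectiveHull R (R ⧸ p.asIdeal) (Efam p)) (hX : CC K R)
    (W : Set (PrimeSpectrum R)) (i) (y : K.Y (i + 1)) (hW : K.d i y ∈ Gam W _) :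
    ∃ z ∈ Gam W (K.Y (i + 1)), K.d i z = K.d i y := by
  obtain ⟨i, rfl⟩ : ∃ j, i = j + 1 := ⟨i - 1, by omega⟩
  exact lemB_elt K hE hX W i _ (LinearMap.congr_fun (K.dd i) y) hW

/-- section of the quotient -/
lemma GQ_section (hE : ∀ p : PrimeSpectrum R, IsInjectiveHull R (R ⧸ p.asIdeal) (Efam p))
    (W W' : Set (PrimeSpectrum R)) (hW : Stab W) (hW' : Stab W') (h : W' ⊆ W)
    (N : Type u) [AddCommGroup N] [Module R N] (hN : Module.Injective R N) :
    ∃ σ : GQ W W' N →ₗ[R] N, ∀ z, ∃ hz : σ z ∈ Gam W N, GQmk W W' (σ z) hz = z := by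
  obtain ⟨π, h1, h2⟩ := J1 Efam hE N hN W' hW'
  refine ⟨Submodule.liftQ _ ((LinearMap.id - π) ∘ₗ (Gam W N).subtype) ?_, ?_⟩
  · intro v hv
    simp only [LinearMap.mem_ker, LinearMap.comp_apply, LinearMap.sub_apply, LinearMap.id_apply,
      Submodule.subtype_apply]
    rw [h2 v.1 hv, sub_self]
  · intro z
    obtain ⟨v, hv, rfl⟩ := GQmk_surj z
    have hz : v - π v ∈ Gam W N := Submodule.sub_mem _ hv (Gam_mono h (h1 v))
    refine ⟨hz, GQmk_eq.2 ?_⟩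
    have : v - π v - v ∈ Gam W' N := by simpa using h1 v
    exact this

lemma GQ_inj (hE : ∀ p : PrimeSpectrum R, IsInjectiveHull R (R ⧸ p.asIdeal) (Efam p))
    (W W' : Set (PrimeSpectrum R)) (hW : Stab W) (hW' : Stab W') (h : W' ⊆ W)
    (N : Type u) [AddCommGroup N] [Module R N] (hN : Module.Injective R N) :
    Module.Injective R (GQ W W' N) := by
  obtain ⟨σ, hσ⟩ := GQ_section hE W W' hW hW' h N hN
  obtain ⟨π, h1, h2⟩ := J1 Efam hE N hN W hW
  refine inj_retract hN σ ((Submodule.mkQ _) ∘ₗ LinearMap.codRestrict _ π h1) ?_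
  intro z
  obtain ⟨hz, hz'⟩ := hσ z
  conv_rhs => rw [← hz']
  change GQmk W W' (π (σ z)) (h1 _) = _
  rw [GQmk_eq, h2 _ hz, sub_self]
  exact Submodule.zero_mem _

noncomputable def KQ (hE : ∀ p : PrimeSpectrum R, IsInjectiveHull R (R ⧸ p.asIdeal) (Efam p))
    (W W' : Set (PrimeSpectrum R)) (hW : Stab W) (hW' : Stab W') (h : W' ⊆ W) : Cx R where
  Y i := GQ W W' (K.Y i)
  d i := GQmap W W' (K.d i)
  inj i := GQ_inj hE W W' hW hW' h _ (K.inj i)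
  dd i := by
    apply LinearMap.ext
    intro z
    obtain ⟨v, hv, rfl⟩ := GQmk_surj z
    rw [LinearMap.comp_apply, GQmap_mk, GQmap_mk, LinearMap.zero_apply, GQmk_eq_zero]
    have := LinearMap.congr_fun (K.dd i) v
    simp only [LinearMap.comp_apply, LinearMap.zero_apply] at this
    rw [this]; exact Submodule.zero_mem _

section
variable (W W' : Set (PrimeSpectrum R)) (hW : Stab W) (hW' : Stab W') (h : W' ⊆ W)

lemma CC_KQ {X : Type u} [AddCommGroup X] [Module R X] [Module.Finite R X] (hX : CC K X) :
    CC (KQ K hE W W' hW hW' h) X := by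
  intro i g hg
  obtain ⟨i, rfl⟩ : ∃ j, i = j + 1 := ⟨i - 1, by omega⟩
  obtain ⟨σ, hσ⟩ := GQ_section hE W W' hW hW' h (K.Y (i + 1 + 1)) (K.inj _)
  choose hσ1 hσ2 using hσ
  let g' : X →ₗ[R] GQ W W' (K.Y (i + 1 + 1)) := g
  have hg' : ∀ v, GQmap W W' (K.d (i + 1)) (g' v) = 0 := fun v => LinearMap.congr_fun hg v
  obtain ⟨k, hk, hkv⟩ := lemB hE K hX W' i (K.d (i + 1) ∘ₗ σ ∘ₗ g') (by
    rw [← LinearMap.comp_assoc, K.dd, LinearMap.zero_comp]) (fun v => by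
      have := hg' v
      rw [← hσ2 (g' v), GQmap_mk, GQmk_eq_zero] at this
      exact this)
  obtain ⟨f, hf, hfv⟩ := lemB hE K hX W (i + 1) (σ ∘ₗ g' - k) (by
    rw [LinearMap.comp_sub, hk, sub_self])
    (fun v => Submodule.sub_mem _ (hσ1 _) (Gam_mono h (hkv v)))
  refine ⟨(Submodule.mkQ _) ∘ₗ LinearMap.codRestrict _ f hfv, ?_⟩
  ext v : 1
  change GQmk W W' (K.d _ (f v)) _ = g' v
  refine Eq.trans (GQmk_eq.2 ?_) (hσ2 (g' v))
  have h2 := LinearMap.congr_fun hf v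
  simp only [LinearMap.comp_apply, LinearMap.sub_apply] at h2
  rw [h2]
  have := Submodule.neg_mem _ (hkv v)
  convert this using 1
  abel

end

variable {G : Type u} [AddCommGroup G] [Module R G]

def Kof (𝒢 : GorensteinInjData R G) : Cx R :=
  letI := 𝒢.acg
  letI := 𝒢.mod
  { Y := 𝒢.E
    d := 𝒢.d
    inj := 𝒢.inj
    dd := fun i => by
      ext v
      have : 𝒢.d (i + 1) v ∈ LinearMap.ker (𝒢.d i) := by
        rw [← 𝒢.exact]; exact ⟨v, rfl⟩
      exact this }

omit [IsNoetherianRing R] in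
lemma Kof_CC (𝒢 : GorensteinInjData R G) (N : Type u) [AddCommGroup N] [Module R N]
    (hN : Module.Injective R N) : CC (Kof 𝒢) N :=
  fun i g hg => (𝒢.homExact N hN i g).1 hg

omit [IsNoetherianRing R] in
lemma Kof_R (𝒢 : GorensteinInjData R G) : CC (Kof 𝒢) R := by
  intro i g hg
  letI := 𝒢.acg
  letI := 𝒢.mod
  have h1 : (g 1 : 𝒢.E (i + 1)) ∈ LinearMap.ker (𝒢.d i) := LinearMap.congr_fun hg 1
  rw [← 𝒢.exact] at h1
  obtain ⟨z, hz⟩ := h1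
  refine ⟨LinearMap.toSpanSingleton R _ z, ?_⟩
  ext
  change 𝒢.d (i + 1) ((1 : R) • z) = g 1
  rw [one_smul]; exact hz

omit [IsNoetherianRing R] in
lemma Kof_equiv (𝒢 : GorensteinInjData R G) :
    ∃ j : G →ₗ[R] (Kof 𝒢).Y (-1 + 1), Function.Injective j ∧ ∀ y, (Kof 𝒢).d (-1) y = 0 ↔ ∃ v, j v = y := by
  letI := 𝒢.acg
  letI := 𝒢.mod
  refine ⟨(LinearMap.ker (𝒢.d (-1))).subtype ∘ₗ 𝒢.equiv.toLinearMap, ?_, ?_⟩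
  · exact (Submodule.subtype_injective _).comp 𝒢.equiv.injective
  · intro y
    constructor
    · intro hy
      refine ⟨𝒢.equiv.symm ⟨y, hy⟩, ?_⟩
      change ((𝒢.equiv (𝒢.equiv.symm ⟨y, hy⟩) : LinearMap.ker (𝒢.d (-1))) : 𝒢.E _) = y
      rw [LinearEquiv.apply_symm_apply]
    · rintro ⟨v, rfl⟩
      exact (𝒢.equiv v).2

omit [IsNoetherianRing R] in
lemma GI_of (K : Cx R) (hR : CC K R) (hN : ∀ (N : Type u) [AddCommGroup N] [Module R N],
    Module.Injective R N → CC K N) (j : G →ₗ[R] K.Y (-1 + 1)) (hj : Function.Injective j)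
    (hj' : ∀ y, K.d (-1) y = 0 ↔ ∃ v, j v = y) : IsGorensteinInjective R G := by
  refine ⟨⟨K.Y, K.d, K.inj, ?_, ?_, ?_⟩⟩
  · intro i
    apply le_antisymm
    · rintro _ ⟨v, rfl⟩
      exact LinearMap.congr_fun (K.dd i) v
    · intro v hv
      obtain ⟨f, hf⟩ := hR i (LinearMap.toSpanSingleton R _ v) (by ext; simpa using hv)
      exact ⟨f 1, by simpa using LinearMap.congr_fun hf 1⟩
  · intro E' _ _ hE' i g
    refine ⟨hN E' hE' i g, ?_⟩
    rintro ⟨f, rfl⟩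
    rw [← LinearMap.comp_assoc, K.dd, LinearMap.zero_comp]
  · refine (LinearEquiv.ofInjective j hj).trans (LinearEquiv.ofEq _ _ ?_)
    ext y
    exact (hj' y).symm

omit [IsNoetherianRing R] in
lemma GI_equiv {G' : Type u} [AddCommGroup G'] [Module R G'] (e : G' ≃ₗ[R] G)
    (h : IsGorensteinInjective R G) : IsGorensteinInjective R G' := by
  obtain ⟨𝒢⟩ := h
  obtain ⟨j, hj, hj'⟩ := Kof_equiv 𝒢
  refine GI_of (Kof 𝒢) (Kof_R 𝒢) (fun N _ _ hN => Kof_CC 𝒢 N hN) (j ∘ₗ e.toLinearMap)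
    (hj.comp e.injective) (fun y => ?_)
  rw [hj']
  exact ⟨fun ⟨v, hv⟩ => ⟨e.symm v, by simpa using hv⟩, fun ⟨v, hv⟩ => ⟨e v, hv⟩⟩

lemma GI_GQ (hE : ∀ p : PrimeSpectrum R, IsInjectiveHull R (R ⧸ p.asIdeal) (Efam p))
    (D : Type u) [AddCommGroup D] [Module R D] (hD : IsDualizingModule R D)
    (dim : ℕ) (hdim : ringKrullDim R = (dim : ℕ)) (hG : IsGorensteinInjective R G)
    (W W' : Set (PrimeSpectrum R)) (hW : Stab W) (hW' : Stab W') (h : W' ⊆ W) :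
    IsGorensteinInjective R (GQ W W' G) := by
  obtain ⟨𝒢⟩ := hG
  have hDf : Module.Finite R D := hD.1
  have hR := Kof_R 𝒢
  have hDC := CC_D (Kof 𝒢) hE D hD dim hdim (fun N _ _ hN => Kof_CC 𝒢 N hN)
  obtain ⟨j, hj, hj'⟩ := Kof_equiv 𝒢
  refine GI_of (KQ (Kof 𝒢) hE W W' hW hW' h) (CC_KQ hE _ W W' hW hW' h hR)
    (fun N _ _ hN => CC_inj _ hE D hD dim hdim (CC_KQ hE _ W W' hW hW' h hDC) N hN)
    (GQmap W W' j) ?_ ?_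
  · refine (injective_iff_map_eq_zero (GQmap W W' j)).2 ?_
    intro z hz
    obtain ⟨v, hv, rfl⟩ := GQmk_surj z
    rw [GQmap_mk, GQmk_eq_zero] at hz
    exact GQmk_eq_zero.2 (Gam_of_inj j hj hz)
  · intro z
    obtain ⟨y, hy, rfl⟩ := GQmk_surj (N := (Kof 𝒢).Y (-1 + 1)) z
    refine Iff.trans (show _ ↔ (Kof 𝒢).d (-1) y ∈ Gam W' _ from GQmk_eq_zero) ?_
    constructor
    · intro h1
      obtain ⟨y', hy', hyy⟩ := lemB_elt' (Kof 𝒢) hE hR W' (-1) y h1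
      obtain ⟨v, hv⟩ := (hj' (y - y')).1 (by rw [map_sub]; exact sub_eq_zero.2 hyy.symm)
      refine ⟨GQmk W W' v (Gam_of_inj j hj (by
        rw [hv]; exact Submodule.sub_mem _ hy (Gam_mono h hy'))), ?_⟩
      refine GQmk_eq.2 (show j v - y ∈ Gam W' _ from ?_)
      rw [hv]
      have := Submodule.neg_mem _ hy'
      convert this using 1
      exact sub_sub_cancel_left y y'
    · rintro ⟨z, hz⟩
      obtain ⟨v, hv, rfl⟩ := GQmk_surj z
      have hz := GQmk_eq.1 (show GQmk W W' (j v) (Gam_map j hv) = GQmk W W' y hy from hz)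
      have h2 := Gam_map ((Kof 𝒢).d (-1)) hz
      rw [map_sub, (hj' (j v)).2 ⟨v, rfl⟩, zero_sub] at h2
      simpa using Submodule.neg_mem _ h2

omit [IsNoetherianRing R] in
lemma Gam_empty (N : Type u) [AddCommGroup N] [Module R N] : Gam (∅ : Set (PrimeSpectrum R)) N = ⊥ := by
  rw [eq_bot_iff]
  intro y hy
  by_contra h0
  have h1 : (LinearMap.ker (LinearMap.toSpanSingleton R N y) : Ideal R) ≠ ⊤ := by
    intro h
    apply h0
    have : (1 : R) ∈ (LinearMap.ker (LinearMap.toSpanSingleton R N y) : Ideal R) := by rw [h]; trivial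
    simpa using this
  obtain ⟨m, hm, hle⟩ := Ideal.exists_le_maximal _ h1
  exact hy ⟨m, hm.isPrime⟩ (fun r hr => hle hr)

lemma GI_Gam (hE : ∀ p : PrimeSpectrum R, IsInjectiveHull R (R ⧸ p.asIdeal) (Efam p))
    (D : Type u) [AddCommGroup D] [Module R D] (hD : IsDualizingModule R D)
    (dim : ℕ) (hdim : ringKrullDim R = (dim : ℕ)) (hG : IsGorensteinInjective R G)
    (W : Set (PrimeSpectrum R)) (hW : Stab W) :
    IsGorensteinInjective R (Gam W G) := by
  have h1 := GI_GQ hE D hD dim hdim hG W ∅ hW (fun p q h => h.elim) (Set.empty_subset _)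
  refine GI_equiv (LinearEquiv.symm (Submodule.quotEquivOfEqBot _ ?_)) h1
  rw [Gam_empty, Submodule.comap_bot, Submodule.ker_subtype]

/-- the cover used in the Tor computations -/
lemma cover (hE : ∀ p : PrimeSpectrum R, IsInjectiveHull R (R ⧸ p.asIdeal) (Efam p))
    (D : Type u) [AddCommGroup D] [Module R D] (hD : IsDualizingModule R D)
    (dim : ℕ) (hdim : ringKrullDim R = (dim : ℕ)) (hG : IsGorensteinInjective R G) :
    ∃ K : Cx R, CC K D ∧ CC K R ∧ ∃ φ : K.Y (-1 + 1 + 1) →ₗ[R] G,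
      (∀ (X : Type u) [AddCommGroup X] [Module R X], CC K X → ∀ g : X →ₗ[R] G, ∃ f, φ ∘ₗ f = g) ∧
      ∀ (W : Set (PrimeSpectrum R)), ∀ y ∈ Gam W G, ∃ e ∈ Gam W (K.Y (-1 + 1 + 1)), φ e = y := by
  obtain ⟨𝒢⟩ := hG
  have hR := Kof_R 𝒢
  have hDC := CC_D (Kof 𝒢) hE D hD dim hdim (fun N _ _ hN => Kof_CC 𝒢 N hN)
  obtain ⟨j, hj, hj'⟩ := Kof_equiv 𝒢
  have h0 : ∀ y, ∃ v, j v = (Kof 𝒢).d (-1 + 1) y := fun y =>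
    (hj' _).1 (LinearMap.congr_fun ((Kof 𝒢).dd (-1)) y)
  obtain ⟨φ, hφ⟩ : ∃ φ : (Kof 𝒢).Y (-1 + 1 + 1) →ₗ[R] G, ∀ y, j (φ y) = (Kof 𝒢).d (-1 + 1) y := by
    choose v hv using h0
    refine ⟨⟨⟨v, fun a b => hj ?_⟩, fun r a => hj ?_⟩, hv⟩
    · rw [map_add, hv, hv, hv, map_add]
    · simp only [RingHom.id_apply]
      rw [map_smul, hv, hv, map_smul]
  refine ⟨Kof 𝒢, hDC, hR, φ, ?_, ?_⟩
  · intro X _ _ hX g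
    obtain ⟨f, hf⟩ := hX (-1) (j ∘ₗ g) (by
      ext v
      exact (hj' _).2 ⟨_, rfl⟩)
    refine ⟨f, ?_⟩
    ext v
    apply hj
    rw [LinearMap.comp_apply, hφ]
    exact LinearMap.congr_fun hf v
  · intro W y hy
    obtain ⟨z, hz, hzy⟩ := lemB_elt (Kof 𝒢) hE hR W (-1) (j y) ((hj' _).2 ⟨_, rfl⟩) (Gam_map j hy)
    exact ⟨z, hz, hj (by rw [hφ, hzy])⟩

end S4B
end GI

namespace GI
section Tor
variable {R : Type u} [CommRing R]
variable {M : Type u} [AddCommGroup M] [Module R M] (P : ProjectiveResolution (ModuleCat.of R M))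
variable {A B C : Type u} [AddCommGroup A] [Module R A] [AddCommGroup B] [Module R B]
  [AddCommGroup C] [Module R C]

noncomputable def tcx (X : Type u) [AddCommGroup X] [Module R X] : ChainComplex (ModuleCat.{u} R) ℕ :=
  (((MonoidalCategory.tensoringLeft (ModuleCat.{u} R)).obj (ModuleCat.of R X)).mapHomologicalComplex _).obj P.complex

noncomputable def tcxm (f : A →ₗ[R] B) : tcx P A ⟶ tcx P B :=
  (NatTrans.mapHomologicalComplex ((MonoidalCategory.tensoringLeft (ModuleCat.{u} R)).map (ModuleCat.ofHom f)) _).app P.complex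

lemma tcxm_f (f : A →ₗ[R] B) (n : ℕ) : ((tcxm P f).f n).hom = LinearMap.rTensor (P.complex.X n) f := rfl

noncomputable abbrev TT (n : ℕ) (X : Type u) [AddCommGroup X] [Module R X] : Type u := (tcx P X).homology n

noncomputable def Tmap (n : ℕ) (f : A →ₗ[R] B) : TT P n A →ₗ[R] TT P n B :=
  (HomologicalComplex.homologyMap (tcxm P f) n).hom

lemma tcxm_id : tcxm P (LinearMap.id : A →ₗ[R] A) = 𝟙 _ := by
  ext n : 1
  apply ModuleCat.hom_ext
  rw [tcxm_f]
  exact LinearMap.rTensor_id _ _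

lemma tcxm_comp (f : A →ₗ[R] B) (g : B →ₗ[R] C) : tcxm P (g ∘ₗ f) = tcxm P f ≫ tcxm P g := by
  ext n : 1
  apply ModuleCat.hom_ext
  exact LinearMap.rTensor_comp _ _ _

lemma Tmap_id (n : ℕ) : Tmap P n (LinearMap.id : A →ₗ[R] A) = LinearMap.id := by
  rw [Tmap, tcxm_id, HomologicalComplex.homologyMap_id]; rfl

lemma Tmap_comp (n : ℕ) (f : A →ₗ[R] B) (g : B →ₗ[R] C) :
    Tmap P n (g ∘ₗ f) = Tmap P n g ∘ₗ Tmap P n f := by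
  rw [Tmap, tcxm_comp, HomologicalComplex.homologyMap_comp]; rfl

lemma hmap_smul (K : ChainComplex (ModuleCat.{u} R) ℕ) (n : ℕ) (r : R) (z : K.homology n) :
    (HomologicalComplex.homologyMap (r • 𝟙 K) n).hom z = r • z := by
  have hs : Function.Surjective (K.homologyπ n).hom :=
    (ModuleCat.epi_iff_surjective _).1 inferInstance
  have hi : Function.Injective (K.iCycles n).hom :=
    (ModuleCat.mono_iff_injective _).1 inferInstance
  obtain ⟨c, rfl⟩ := hs z
  have e1 := congrArg (fun f => f.hom c) (HomologicalComplex.homologyπ_naturality (r • 𝟙 K) n)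
  have e2 := congrArg (fun f => f.hom c) (HomologicalComplex.cyclesMap_i (r • 𝟙 K) n)
  have e3 : (HomologicalComplex.cyclesMap (r • 𝟙 K) n).hom c = r • c := by
    apply hi
    rw [map_smul]
    exact e2
  refine e1.trans ?_
  change (K.homologyπ n).hom ((HomologicalComplex.cyclesMap (r • 𝟙 K) n).hom c) = _
  rw [e3, map_smul]

lemma Tmap_smul (n : ℕ) (r : R) : Tmap P n (r • LinearMap.id : A →ₗ[R] A) = r • LinearMap.id := by
  have h1 : tcxm P (r • LinearMap.id : A →ₗ[R] A) = r • 𝟙 _ := by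
    ext n : 1
    apply ModuleCat.hom_ext
    rw [tcxm_f, LinearMap.rTensor_smul]
    erw [LinearMap.rTensor_id]
    rfl
  rw [Tmap, h1]
  ext z
  exact hmap_smul _ n r z

noncomputable def Tequiv (n : ℕ) (e : A ≃ₗ[R] B) : TT P n A ≃ₗ[R] TT P n B :=
  LinearEquiv.ofLinear (Tmap P n e.toLinearMap) (Tmap P n e.symm.toLinearMap)
    (by rw [← Tmap_comp, LinearEquiv.comp_symm, Tmap_id])
    (by rw [← Tmap_comp, LinearEquiv.symm_comp, Tmap_id])

lemma Tequiv_apply (n : ℕ) (e : A ≃ₗ[R] B) (z : TT P n A) : Tequiv P n e z = Tmap P n e.toLinearMap z := rfl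

/-- null modules -/
def SNull (S : Submonoid R) (X : Type u) [AddCommGroup X] [Module R X] : Prop :=
  ∀ x : X, ∃ s ∈ S, s • x = 0

lemma TT_null (S : Submonoid R) (n : ℕ) (h : SNull S A) : SNull S (TT P n A) := by
  intro z
  have hs : Function.Surjective ((tcx P A).homologyπ n).hom :=
    (ModuleCat.epi_iff_surjective _).1 inferInstance
  have hi : Function.Injective ((tcx P A).iCycles n).hom :=
    (ModuleCat.mono_iff_injective _).1 inferInstance
  obtain ⟨c, rfl⟩ := hs z
  have key : ∀ w : TensorProduct R A (P.complex.X n), ∃ s ∈ S, s • w = 0 := by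
    intro w
    induction w using TensorProduct.induction_on with
    | zero => exact ⟨1, S.one_mem, smul_zero _⟩
    | tmul a b =>
      obtain ⟨s, hs, h⟩ := h a
      exact ⟨s, hs, by rw [TensorProduct.smul_tmul', h, TensorProduct.zero_tmul]⟩
    | add a b ha hb =>
      obtain ⟨s, hs, h1⟩ := ha
      obtain ⟨t, ht, h2⟩ := hb
      refine ⟨s * t, S.mul_mem hs ht, ?_⟩
      rw [smul_add, mul_smul s t b, h2, mul_comm, mul_smul, h1]; simp
  obtain ⟨s, hs, h1⟩ := key (((tcx P A).iCycles n).hom c)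
  refine ⟨s, hs, ?_⟩
  have : s • c = 0 := hi (by rw [map_smul, map_zero]; exact h1)
  rw [← map_smul, this, map_zero]

instance pflat (n : ℕ) : Module.Flat R (P.complex.X n) := by
  have := (IsProjective.iff_projective (R := R) (P := P.complex.X n)).2 (P.projective n)
  infer_instance

lemma TT_flat (n : ℕ) [Module.Flat R A] (z : TT P (n + 1) A) : z = 0 := by
  have h1 : P.complex.ExactAt (n + 1) := P.complex_exactAt_succ n
  have h2 : (tcx P A).ExactAt (n + 1) := by
    rw [HomologicalComplex.exactAt_iff' _ (n + 2) (n + 1) n (by simp) (by simp)] at h1 ⊢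
    rw [ShortComplex.ShortExact.moduleCat_exact_iff_function_exact] at h1 ⊢
    exact Module.Flat.lTensor_exact A h1
  have h3 := (HomologicalComplex.exactAt_iff_isZero_homology _ _).1 h2
  have := ModuleCat.subsingleton_of_isZero h3
  exact Subsingleton.elim _ _

lemma les_T (f : A →ₗ[R] B) (g : B →ₗ[R] C) (hf : Function.Injective f)
    (hg : Function.Surjective g) (h : Function.Exact f g) (n : ℕ) :
    Function.Exact (Tmap P n f) (Tmap P n g) ∧
    ∃ δ : TT P (n + 1) C →ₗ[R] TT P n A,
      Function.Exact (Tmap P (n + 1) g) δ ∧ Function.Exact δ (Tmap P n f) := by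
  have h0 : tcxm P f ≫ tcxm P g = 0 := by
    rw [← tcxm_comp, h.linearMap_comp_eq_zero]
    ext n : 1
    apply ModuleCat.hom_ext
    exact LinearMap.rTensor_zero _
  let S : ShortComplex (ChainComplex (ModuleCat.{u} R) ℕ) := ShortComplex.mk (tcxm P f) (tcxm P g) h0
  have hS : S.ShortExact := by
    apply HomologicalComplex.shortExact_of_degreewise_shortExact
    intro i
    exact shortExact_of (LinearMap.rTensor (P.complex.X i) f) (LinearMap.rTensor (P.complex.X i) g)
      (Module.Flat.rTensor_preserves_injective_linearMap f hf) (LinearMap.rTensor_surjective _ hg)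
      (rTensor_exact _ h hg)
  refine ⟨?_, (hS.δ (n + 1) n rfl).hom, ?_, ?_⟩
  · exact (ShortComplex.ShortExact.moduleCat_exact_iff_function_exact _).1 (hS.homology_exact₂ n)
  · exact (ShortComplex.ShortExact.moduleCat_exact_iff_function_exact _).1 (hS.homology_exact₃ (n + 1) n rfl)
  · exact (ShortComplex.ShortExact.moduleCat_exact_iff_function_exact _).1 (hS.homology_exact₁ (n + 1) n rfl)


noncomputable def tau0 (X : Type u) [AddCommGroup X] [Module R X] :
    TT P 0 X →ₗ[R] TensorProduct R X M :=
  ((tcx P X).homologyι 0 ≫ (tcx P X).descOpcycles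
    (ModuleCat.ofHom (LinearMap.lTensor X (P.π.f 0).hom)) 1 (by simp) (by
      have h : P.complex.d 1 0 ≫ P.π.f 0 = 0 := P.complex_d_comp_π_f_zero
      apply ModuleCat.hom_ext
      change LinearMap.lTensor X (P.π.f 0).hom ∘ₗ LinearMap.lTensor X (P.complex.d 1 0).hom = 0
      rw [← LinearMap.lTensor_comp]
      have h' : (P.π.f 0).hom ∘ₗ (P.complex.d 1 0).hom = 0 := by
        rw [← ModuleCat.hom_comp, h]; rfl
      rw [h', LinearMap.lTensor_zero])).hom

lemma desc_aux (K : ChainComplex (ModuleCat.{u} R) ℕ) {Y : ModuleCat.{u} R} (k : K.X 0 ⟶ Y)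
    (hk : K.d 1 0 ≫ k = 0) (z : K.homology 0) (w : K.X 0)
    (h : (K.homologyι 0).hom z = (K.pOpcycles 0).hom w) :
    (K.homologyι 0 ≫ K.descOpcycles k 1 (by simp) hk).hom z = k.hom w := by
  rw [ModuleCat.hom_comp, LinearMap.comp_apply, h]
  rw [← LinearMap.comp_apply, ← ModuleCat.hom_comp, HomologicalComplex.p_descOpcycles]

lemma tau0_nat (f : A →ₗ[R] B) (z : TT P 0 A) :
    tau0 P B (Tmap P 0 f z) = LinearMap.rTensor M f (tau0 P A z) := by
  have hs : Function.Surjective ((tcx P A).homologyπ 0).hom :=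
    (ModuleCat.epi_iff_surjective _).1 inferInstance
  obtain ⟨c, rfl⟩ := hs z
  have key : ∀ (X : Type u) [AddCommGroup X] [Module R X] (c : (tcx P X).cycles 0),
      tau0 P X (((tcx P X).homologyπ 0).hom c) =
        LinearMap.lTensor X (P.π.f 0).hom (((tcx P X).iCycles 0).hom c) := by
    intro X _ _ c
    have e1 := congrArg (fun f => f.hom c) (HomologicalComplex.homology_π_ι (K := tcx P X) (i := 0))
    exact desc_aux (tcx P X) _ _ _ _ e1
  have e1 := congrArg (fun f => f.hom c) (HomologicalComplex.homologyπ_naturality (tcxm P f) 0)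
  change Tmap P 0 f (((tcx P A).homologyπ 0).hom c) = ((tcx P B).homologyπ 0).hom ((HomologicalComplex.cyclesMap (tcxm P f) 0).hom c) at e1
  rw [e1, key, key]
  have e2 := congrArg (fun f => f.hom c) (HomologicalComplex.cyclesMap_i (tcxm P f) 0)
  change ((tcx P B).iCycles 0).hom ((HomologicalComplex.cyclesMap (tcxm P f) 0).hom c) = LinearMap.rTensor (P.complex.X 0) f (((tcx P A).iCycles 0).hom c) at e2
  rw [e2]
  exact (LinearMap.congr_fun (LinearMap.lTensor_comp_rTensor (f := f) (g := (P.π.f 0).hom)) _).trans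
    (LinearMap.congr_fun (LinearMap.rTensor_comp_lTensor (f := f) (g := (P.π.f 0).hom)) _).symm

lemma tau0_bij (X : Type u) [AddCommGroup X] [Module R X] : Function.Bijective (tau0 P X) := by
  have hπ : Function.Surjective (P.π.f 0).hom := by
    have : Epi (P.π.f 0) := inferInstance
    exact (ModuleCat.epi_iff_surjective _).1 this
  have hex : Function.Exact (P.complex.d 1 0).hom (P.π.f 0).hom :=
    (ShortComplex.ShortExact.moduleCat_exact_iff_function_exact _).1 P.exact₀
  have hx := lTensor_exact X hex hπ
  have hp : Function.Surjective ((tcx P X).pOpcycles 0).hom :=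
    (ModuleCat.epi_iff_surjective _).1 inferInstance
  have hι : Function.Bijective ((tcx P X).homologyι 0).hom := by
    have : IsIso ((tcx P X).homologyι 0) := inferInstance
    exact ConcreteCategory.bijective_of_isIso _
  have key : ∀ w : TensorProduct R X (P.complex.X 0), ∀ z, ((tcx P X).homologyι 0).hom z = ((tcx P X).pOpcycles 0).hom w →
      tau0 P X z = LinearMap.lTensor X (P.π.f 0).hom w := by
    intro w z h
    exact desc_aux (tcx P X) _ _ _ _ h
  constructor
  · rw [injective_iff_map_eq_zero]
    intro z hz
    obtain ⟨w, hw⟩ := hp (((tcx P X).homologyι 0).hom z)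
    rw [key w z hw.symm] at hz
    obtain ⟨v, rfl⟩ := (hx w).1 hz
    have e := congrArg (fun f => f.hom v) (HomologicalComplex.d_pOpcycles (tcx P X) 1 0)
    apply hι.1
    rw [map_zero, ← hw]
    exact e
  · intro m
    obtain ⟨w, rfl⟩ := LinearMap.lTensor_surjective X hπ m
    obtain ⟨z, hz⟩ := hι.2 (((tcx P X).pOpcycles 0).hom w)
    exact ⟨z, key w z hz⟩

lemma Tmap0_surj (f : A →ₗ[R] B) (hf : Function.Surjective f) : Function.Surjective (Tmap P 0 f) := by
  intro b
  obtain ⟨t, ht⟩ := LinearMap.rTensor_surjective M hf (tau0 P B b)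
  obtain ⟨z, rfl⟩ := (tau0_bij P A).2 t
  exact ⟨z, (tau0_bij P B).1 (by rw [tau0_nat, ht])⟩

lemma Tmap0_inj (f : A →ₗ[R] B) (hf : Function.Injective (LinearMap.rTensor M f)) :
    Function.Injective (Tmap P 0 f) := by
  intro a b h
  apply (tau0_bij P A).1
  apply hf
  rw [← tau0_nat, ← tau0_nat, h]

noncomputable def TT_Tor (n : ℕ) (X : Type u) [AddCommGroup X] [Module R X] :
    ↥(((Tor (ModuleCat.{u} R) n).obj (ModuleCat.of R X)).obj (ModuleCat.of R M)) ≃ₗ[R] TT P n X :=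
  (P.isoLeftDerivedObj ((MonoidalCategory.tensoringLeft (ModuleCat.{u} R)).obj (ModuleCat.of R X)) n).toLinearEquiv

/-- explicit form of a localization map -/
structure Loc (S : Submonoid R) (f : A →ₗ[R] B) : Prop where
  ker : ∀ a, f a = 0 → ∃ s ∈ S, s • a = 0
  coker : ∀ b, ∃ s ∈ S, ∃ a, f a = s • b
  inj : ∀ s ∈ S, ∀ b : B, s • b = 0 → b = 0
  surj : ∀ s ∈ S, ∀ b : B, ∃ b' : B, s • b' = b

lemma Tmap_smul_bij (n : ℕ) (s : R) (h : Function.Bijective (fun b : B => s • b)) :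
    Function.Bijective (fun z : TT P n B => s • z) := by
  obtain ⟨e, he⟩ : ∃ e : B ≃ₗ[R] B, e.toLinearMap = s • LinearMap.id :=
    ⟨LinearEquiv.ofBijective (s • LinearMap.id) h, rfl⟩
  have h2 := (Tequiv P n e).bijective
  have : (fun z : TT P n B => s • z) = Tequiv P n e := funext fun z => by
    rw [Tequiv_apply, he, Tmap_smul, LinearMap.smul_apply, LinearMap.id_apply]
  rw [this]; exact h2

lemma Loc.T {S : Submonoid R} {f : A →ₗ[R] B} (h : Loc S f) (n : ℕ) : Loc S (Tmap P n f) := by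
  have hb : ∀ s ∈ S, Function.Bijective (fun b : B => s • b) := fun s hs =>
    ⟨fun a b hab => sub_eq_zero.1 (h.inj s hs _ (by rw [smul_sub, sub_eq_zero]; exact hab)), h.surj s hs⟩
  have nk : SNull S (LinearMap.ker f) := fun x => by
    obtain ⟨s, hs, h1⟩ := h.ker x.1 x.2
    exact ⟨s, hs, Subtype.ext h1⟩
  have nq : SNull S (B ⧸ LinearMap.range f) := fun x => by
    obtain ⟨b, rfl⟩ := Submodule.mkQ_surjective _ x
    obtain ⟨s, hs, a, h1⟩ := h.coker b
    refine ⟨s, hs, ?_⟩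
    rw [← map_smul, ← h1]
    simp
  have hfac : f = (LinearMap.range f).subtype ∘ₗ f.rangeRestrict := rfl
  obtain ⟨e1, -⟩ := les_T P (LinearMap.ker f).subtype f.rangeRestrict (Submodule.injective_subtype _)
    f.surjective_rangeRestrict (by intro x; simp [Subtype.ext_iff]) n
  obtain ⟨e3, δ2, e4, e5⟩ := les_T P (LinearMap.range f).subtype (LinearMap.range f).mkQ (Submodule.injective_subtype _)
    (Submodule.mkQ_surjective _) (by intro x; simp) n
  have e6 : ∀ z : TT P n (LinearMap.range f), ∃ s ∈ S, ∃ a, Tmap P n f.rangeRestrict a = s • z := by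
    intro z
    cases n with
    | zero =>
      obtain ⟨a, rfl⟩ := Tmap0_surj P f.rangeRestrict f.surjective_rangeRestrict z
      exact ⟨1, S.one_mem, a, (one_smul _ _).symm⟩
    | succ n =>
      obtain ⟨-, δ, e7, -⟩ := les_T P (LinearMap.ker f).subtype f.rangeRestrict (Submodule.injective_subtype _)
        f.surjective_rangeRestrict (by intro x; simp [Subtype.ext_iff]) n
      obtain ⟨s, hs, h1⟩ := TT_null P S n nk (δ z)
      obtain ⟨a, ha⟩ := (e7 (s • z)).1 (by rw [map_smul, h1])
      exact ⟨s, hs, a, ha⟩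
  have hc : ∀ z, Tmap P n f z = Tmap P n (LinearMap.range f).subtype (Tmap P n f.rangeRestrict z) := by
    intro z
    conv_lhs => rw [hfac, Tmap_comp]
    rfl
  refine ⟨?_, ?_, ?_, ?_⟩
  · intro a ha
    rw [hc] at ha
    obtain ⟨c, hc'⟩ := (e5 _).1 ha
    obtain ⟨s, hs, h1⟩ := TT_null P S (n + 1) nq c
    obtain ⟨k, hk⟩ := (e1 (s • a)).1 (by rw [map_smul, ← hc', ← map_smul, h1, map_zero])
    obtain ⟨t, ht, h2⟩ := TT_null P S n nk k
    exact ⟨t * s, S.mul_mem ht hs, by rw [mul_smul, ← hk, ← map_smul, h2, map_zero]⟩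
  · intro b
    obtain ⟨s, hs, h1⟩ := TT_null P S n nq (Tmap P n (LinearMap.range f).mkQ b)
    obtain ⟨z, hz⟩ := (e3 (s • b)).1 (by rw [map_smul, h1])
    obtain ⟨t, ht, a, ha⟩ := e6 z
    exact ⟨t * s, S.mul_mem ht hs, a, by rw [hc, ha, map_smul, hz, mul_smul]⟩
  · intro s hs b hb'
    exact (Tmap_smul_bij P n s (hb s hs)).1 (by simp only [hb', smul_zero])
  · intro s hs b
    exact (Tmap_smul_bij P n s (hb s hs)).2 b

end Tor
end GI

namespace GI
section EV
variable {R : Type u} [CommRing R] (D G : Type u) [AddCommGroup D] [Module R D]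
  [AddCommGroup G] [Module R G]

noncomputable def ev (N : Type u) [AddCommGroup N] [Module R N] :
    TensorProduct R N (D →ₗ[R] G) →ₗ[R] ((N →ₗ[R] D) →ₗ[R] G) :=
  TensorProduct.lift (LinearMap.mk₂ R (fun n h => h ∘ₗ LinearMap.applyₗ n)
    (by intros; ext; simp) (by intros; ext; simp) (by intros; ext; simp) (by intros; ext; simp))

@[simp] lemma ev_tmul {N : Type u} [AddCommGroup N] [Module R N] (n : N) (h : D →ₗ[R] G)
    (α : N →ₗ[R] D) : ev D G N (n ⊗ₜ h) α = h (α n) := rfl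

variable {N N' : Type u} [AddCommGroup N] [Module R N] [AddCommGroup N'] [Module R N']

lemma ev_nat (f : N →ₗ[R] N') (w : TensorProduct R N (D →ₗ[R] G)) (α : N' →ₗ[R] D) :
    ev D G N' (LinearMap.rTensor _ f w) α = ev D G N w (α ∘ₗ f) := by
  induction w using TensorProduct.induction_on with
  | zero => simp
  | tmul a b => simp
  | add a b ha hb => simp only [map_add, LinearMap.add_apply, ha, hb]

lemma ev_free (n : ℕ) : Function.Bijective (ev (R := R) D G (ULift.{u} (Fin n) → R)) := by
  let e : ULift.{u} (Fin n) → ULift.{u} (Fin n) → R := fun i => Pi.single i 1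
  have hq : ∀ q : ULift.{u} (Fin n) → R, q = ∑ i, q i • e i := fun q => by
    funext j; simp [e, Finset.sum_apply, Pi.single_apply]
  have rep : ∀ w : TensorProduct R (ULift.{u} (Fin n) → R) (D →ₗ[R] G),
      ∃ m : ULift.{u} (Fin n) → (D →ₗ[R] G), w = ∑ i, e i ⊗ₜ m i := by
    intro w
    induction w using TensorProduct.induction_on with
    | zero => exact ⟨0, by simp⟩
    | tmul a b =>
      refine ⟨fun i => a i • b, ?_⟩
      conv_lhs => rw [hq a]
      rw [TensorProduct.sum_tmul]
      simp only [TensorProduct.smul_tmul]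
    | add a b ha hb =>
      obtain ⟨m, rfl⟩ := ha
      obtain ⟨m', rfl⟩ := hb
      refine ⟨m + m', ?_⟩
      simp only [Pi.add_apply, TensorProduct.tmul_add, Finset.sum_add_distrib]
  have hev : ∀ (m : ULift.{u} (Fin n) → (D →ₗ[R] G)) α,
      ev D G _ (∑ i, e i ⊗ₜ m i) α = ∑ i, m i (α (e i)) := by
    intro m α
    rw [map_sum, LinearMap.sum_apply]; rfl
  let A : ULift.{u} (Fin n) → D →ₗ[R] ((ULift.{u} (Fin n) → R) →ₗ[R] D) := fun i =>
    LinearMap.flip ((LinearMap.lsmul R D) ∘ₗ LinearMap.proj i)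
  have hA : ∀ i v q, A i v q = q i • v := fun i v q => rfl
  constructor
  · rw [injective_iff_map_eq_zero]
    intro w hw
    obtain ⟨m, rfl⟩ := rep w
    have : ∀ i, m i = 0 := by
      intro i
      ext v
      have h := LinearMap.congr_fun hw (A i v)
      rw [hev, Finset.sum_eq_single i] at h
      · rw [hA] at h; simpa [e] using h
      · intro j _ hj
        rw [hA]
        have : e j i = 0 := by simp [e, Ne.symm hj]
        rw [this, zero_smul, map_zero]
      · simp
    simp [this]
  · intro g
    refine ⟨∑ i, e i ⊗ₜ (g ∘ₗ A i), ?_⟩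
    ext α
    rw [hev]
    simp only [LinearMap.comp_apply]
    rw [← map_sum]
    congr 1
    refine LinearMap.ext fun q => ?_
    conv_rhs => rw [hq q]
    rw [LinearMap.sum_apply, map_sum]
    simp [hA]

variable (K : Cx R) (φ : K.Y (-1 + 1 + 1) →ₗ[R] G)

structure DD (N : Type u) [AddCommGroup N] [Module R N] : Prop where
  fin : Module.Finite R N
  ext : ∀ n, ∀ x : EE R N D (n + 1), x = 0
  cc : CC K (N →ₗ[R] D)

lemma CC_pi {K : Cx R} (h : CC K D) (n : ℕ) : CC K ((ULift.{u} (Fin n) → R) →ₗ[R] D) := by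
  have h1 : CC K (ULift.{u} (Fin n) → D) := by
    intro i g hg
    have : ∀ j, ∃ f : D →ₗ[R] K.Y (i + 1 + 1), K.d (i + 1) ∘ₗ f = g ∘ₗ LinearMap.single R (fun _ => D) j :=
      fun j => h i _ (by rw [← LinearMap.comp_assoc, hg, LinearMap.zero_comp])
    choose f hf using this
    refine ⟨∑ j, f j ∘ₗ LinearMap.proj j, ?_⟩
    ext j v
    have := LinearMap.congr_fun (hf j) v
    simp only [LinearMap.comp_apply] at this ⊢
    rw [← this, LinearMap.sum_apply, Finset.sum_eq_single j]
    · simp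
    · intro k _ hk
      simp [hk]
    · simp
  exact h1.equiv ((Pi.basisFun R (ULift.{u} (Fin n))).constr R).symm

lemma DD.syz [IsNoetherianRing R] {D} [AddCommGroup D] [Module R D] {K : Cx R} (hDK : CC K D) (hN : DD D K N) :
    ∃ (n : ℕ) (π : (ULift.{u} (Fin n) → R) →ₗ[R] N), Function.Surjective π ∧
      DD D K (LinearMap.ker π) ∧
      ∀ β : LinearMap.ker π →ₗ[R] D, ∃ α : (ULift.{u} (Fin n) → R) →ₗ[R] D,
        α ∘ₗ (LinearMap.ker π).subtype = β := by
  have := hN.fin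
  obtain ⟨n, π0, hπ0⟩ := Module.Finite.exists_fin' R N
  let eq : (ULift.{u} (Fin n) → R) ≃ₗ[R] (Fin n → R) := LinearEquiv.funCongrLeft R R Equiv.ulift.symm
  let π := π0 ∘ₗ eq.toLinearMap
  have hπ : Function.Surjective π := hπ0.comp eq.surjective
  have hex : Function.Exact (LinearMap.ker π).subtype π := by intro x; simp
  have hl : ∀ β : LinearMap.ker π →ₗ[R] D, ∃ α : (ULift.{u} (Fin n) → R) →ₗ[R] D,
        α ∘ₗ (LinearMap.ker π).subtype = β := by
    intro β
    obtain ⟨-, δ, h1, -⟩ := les_contra (LinearMap.ker π).subtype π (Submodule.injective_subtype _) hπ hex D 0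
    obtain ⟨y, hy⟩ := (h1 ((EE0 _ D).symm β)).1 (hN.ext 0 _)
    refine ⟨EE0 _ D y, ?_⟩
    rw [← EE0_pre, hy, LinearEquiv.apply_symm_apply]
  refine ⟨n, π, hπ, ⟨?_, ?_, ?_⟩, hl⟩
  · exact Module.IsNoetherian.finite R _
  · intro m x
    obtain ⟨-, δ, h1, -⟩ := les_contra (LinearMap.ker π).subtype π (Submodule.injective_subtype _) hπ hex D (m + 1)
    obtain ⟨y, hy⟩ := (h1 x).1 (hN.ext (m + 1) _)
    rw [← hy, EE_proj_zero inferInstance m y, map_zero]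
  · refine CC.right (LinearMap.lcomp R D π) (LinearMap.lcomp R D (LinearMap.ker π).subtype)
      ?_ ?_ ?_ hN.cc (CC_pi D hDK n)
    · intro a b h
      exact (LinearMap.cancel_right hπ).1 h
    · exact hl
    · intro α
      constructor
      · intro h
        obtain ⟨h', hh⟩ := descend (LinearMap.ker π).subtype π hπ hex α h
        exact ⟨h', hh⟩
      · rintro ⟨h', rfl⟩
        ext x
        exact (congrArg h' x.2).trans (map_zero _)

variable {D G K}
variable (hφ : ∀ (X : Type u) [AddCommGroup X] [Module R X], CC K X → ∀ g : X →ₗ[R] G, ∃ f, φ ∘ₗ f = g)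

include hφ in
lemma ev_surj [IsNoetherianRing R] (hDK : CC K D) (hN : DD D K N) : Function.Surjective (ev (R := R) D G N) := by
  obtain ⟨n, π, hπ, -, -⟩ := hN.syz hDK
  intro g
  obtain ⟨f, hf⟩ := hφ _ hN.cc g
  obtain ⟨f', hf'⟩ := inj_extend (K.inj _) (LinearMap.lcomp R D π)
    (fun a b h => (LinearMap.cancel_right hπ).1 h) f
  obtain ⟨w, hw⟩ := (ev_free D G n).2 (φ ∘ₗ f')
  refine ⟨LinearMap.rTensor _ π w, ?_⟩
  ext α
  rw [ev_nat, hw, ← hf, ← hf']; rfl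

include hφ in
lemma ev_inj [IsNoetherianRing R] (hDK : CC K D) (hN : DD D K N) : Function.Injective (ev (R := R) D G N) := by
  obtain ⟨n, π, hπ, hS, hl⟩ := hN.syz hDK
  have hex : Function.Exact (LinearMap.ker π).subtype π := by intro x; simp
  rw [injective_iff_map_eq_zero]
  intro w hw
  obtain ⟨w', rfl⟩ := LinearMap.rTensor_surjective _ hπ w
  obtain ⟨h, hh⟩ := descend (LinearMap.lcomp R D π) (LinearMap.lcomp R D (LinearMap.ker π).subtype) hl
    (by
      intro α
      constructor
      · intro h
        obtain ⟨h', hh⟩ := descend (LinearMap.ker π).subtype π hπ hex α h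
        exact ⟨h', hh⟩
      · rintro ⟨h', rfl⟩
        ext x
        exact (congrArg h' x.2).trans (map_zero _)) (ev D G _ w') (by
      ext α
      have := LinearMap.congr_fun hw α
      rw [ev_nat] at this
      exact this)
  obtain ⟨v, rfl⟩ := ev_surj φ hφ hDK hS h
  have : w' = LinearMap.rTensor _ (LinearMap.ker π).subtype v := by
    apply (ev_free D G n).1
    ext α
    rw [← hh, ev_nat]; rfl
  rw [this, ← LinearMap.comp_apply, ← LinearMap.rTensor_comp, hex.linearMap_comp_eq_zero, LinearMap.rTensor_zero]
  rfl

variable (P : ProjectiveResolution (ModuleCat.of R (D →ₗ[R] G)))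
include hφ in
lemma DD_T [IsNoetherianRing R] (hDK : CC K D) (i : ℕ) : ∀ (N : Type u) [AddCommGroup N] [Module R N],
    DD D K N → ∀ z : TT P (i + 1) N, z = 0 := by
  induction i with
  | zero =>
    intro N _ _ hN z
    obtain ⟨n, π, hπ, hS, hl⟩ := hN.syz hDK
    have hex : Function.Exact (LinearMap.ker π).subtype π := by intro x; simp
    obtain ⟨-, δ, h1, h2⟩ := les_T P (LinearMap.ker π).subtype π (Submodule.injective_subtype _) hπ hex 0
    have hi : Function.Injective (LinearMap.rTensor (D →ₗ[R] G) (LinearMap.ker π).subtype) := by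
      rw [injective_iff_map_eq_zero]
      intro w hw
      apply ev_inj φ hφ hDK hS
      rw [map_zero]
      ext β
      obtain ⟨α, rfl⟩ := hl β
      rw [← ev_nat, hw]; simp
    have h3 : δ z = 0 := Tmap0_inj P _ hi (by rw [map_zero]; exact h2.apply_apply_eq_zero z)
    obtain ⟨y, rfl⟩ := (h1 z).1 h3
    rw [TT_flat P 0 y, map_zero]
  | succ i ih =>
    intro N _ _ hN z
    obtain ⟨n, π, hπ, hS, hl⟩ := hN.syz hDK
    have hex : Function.Exact (LinearMap.ker π).subtype π := by intro x; simp
    obtain ⟨-, δ, h1, h2⟩ := les_T P (LinearMap.ker π).subtype π (Submodule.injective_subtype _) hπ hex (i + 1)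
    obtain ⟨y, rfl⟩ := (h1 z).1 (ih _ hS _)
    rw [TT_flat P _ y, map_zero]

lemma DD_D (hD : IsDualizingModule R D) (hR : CC K R) : DD D K D := by
  refine ⟨hD.1, fun n x => extDD D hD n x, ?_⟩
  exact hR.equiv (LinearEquiv.ofBijective (LinearMap.toSpanSingleton R (D →ₗ[R] D) LinearMap.id) hD.2.2.1).symm

include hφ in
lemma T0_D [IsNoetherianRing R] (hDK : CC K D) (hD : IsDualizingModule R D) (hR : CC K R) :
    Nonempty (TT P 0 D ≃ₗ[R] G) := by
  have hN := DD_D (K := K) hD hR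
  let e1 := LinearEquiv.ofBijective _ (tau0_bij P D)
  let e2 := LinearEquiv.ofBijective _ ⟨ev_inj φ hφ hDK hN, ev_surj φ hφ hDK hN⟩
  let e3 := (LinearEquiv.ofBijective (LinearMap.toSpanSingleton R (D →ₗ[R] D) LinearMap.id) hD.2.2.1)
  let e4 : ((D →ₗ[R] D) →ₗ[R] G) ≃ₗ[R] (R →ₗ[R] G) := LinearEquiv.congrLeft G R e3.symm
  exact ⟨e1.trans (e2.trans (e4.trans (LinearMap.ringLmapEquivSelf R R G)))⟩

end EV
end GI

namespace GI
section T2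
variable {R : Type u} [CommRing R]
variable {M : Type u} [AddCommGroup M] [Module R M] (P : ProjectiveResolution (ModuleCat.of R M))

/-- primes of height at least `k` -/
abbrev WW (R : Type u) [CommRing R] (k : ℕ) : Set (PrimeSpectrum R) := {q | (k : ℕ∞) ≤ Order.height q}

/-- one step of the Tor computation -/
lemma T_step {A B C G : Type u} [AddCommGroup A] [Module R A] [AddCommGroup B] [Module R B]
    [AddCommGroup C] [Module R C] [AddCommGroup G] [Module R G]
    (f : A →ₗ[R] B) (g : B →ₗ[R] C) (hf : Function.Injective f)
    (hg : Function.Surjective g) (h : Function.Exact f g) (x : R) (hl : Loc (Submonoid.powers x) f)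
    (j : ℕ) (hA : ∀ i, i ≠ j → ∀ z : TT P i A, z = 0) (V V' : Submodule R G)
    (θ : TT P j A →ₗ[R] G) (hθ : Function.Injective θ) (hV : ∀ y, y ∈ V ↔ ∃ z, θ z = y)
    (hV' : ∀ y, y ∈ V' ↔ y ∈ V ∧ ∃ n : ℕ, x ^ n • y = 0)
    (hdiv : ∀ y ∈ V, ∀ n : ℕ, ∃ y' ∈ V, ∃ m : ℕ, x ^ m • (y - x ^ n • y') = 0) :
    (∀ i, i ≠ j + 1 → ∀ z : TT P i C, z = 0) ∧
    ∃ θ' : TT P (j + 1) C →ₗ[R] G, Function.Injective θ' ∧ ∀ y, y ∈ V' ↔ ∃ z, θ' z = y := by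
  have hs : ∀ i, Function.Surjective (Tmap P i f) := by
    intro i b
    have hL := hl.T P i
    by_cases hij : i = j
    · subst hij
      obtain ⟨s, ⟨n, rfl⟩, a, ha⟩ := hL.coker b
      obtain ⟨y', hy', m, hm⟩ := hdiv (θ a) ((hV _).2 ⟨a, rfl⟩) n
      obtain ⟨a', rfl⟩ := (hV _).1 hy'
      have h1 : x ^ m • (a - x ^ n • a') = 0 := hθ (by
        rw [map_smul, map_sub, map_smul, hm, map_zero])
      refine ⟨a', ?_⟩
      have h2 : Tmap P i f (a - x ^ n • a') = 0 := hL.inj (x ^ m) ⟨m, rfl⟩ _ (by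
        rw [← map_smul, h1, map_zero])
      have h3 : b - Tmap P i f a' = 0 := hL.inj (x ^ n) ⟨n, rfl⟩ _ (by
        rw [smul_sub, ← map_smul]
        rw [map_sub, ha] at h2
        exact h2)
      exact (sub_eq_zero.1 h3).symm
    · obtain ⟨s, hs, a, ha⟩ := hL.coker b
      rw [hA i hij a, map_zero] at ha
      exact ⟨0, by rw [map_zero, hL.inj s hs b ha.symm]⟩
  have hz : ∀ i (b : TT P i B), Tmap P i g b = 0 := by
    intro i b
    obtain ⟨a, rfl⟩ := hs i b
    exact (les_T P f g hf hg h i).1.apply_apply_eq_zero a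
  constructor
  · intro i hi z
    cases i with
    | zero =>
      obtain ⟨b, rfl⟩ := Tmap0_surj P g hg z
      exact hz 0 b
    | succ i =>
      obtain ⟨-, δ, h1, -⟩ := les_T P f g hf hg h i
      obtain ⟨b, rfl⟩ := (h1 z).1 (hA i (by omega) _)
      exact hz _ b
  · obtain ⟨-, δ, h1, h2⟩ := les_T P f g hf hg h j
    have hL := hl.T P j
    refine ⟨θ ∘ₗ δ, hθ.comp ?_, fun y => ?_⟩
    · rw [injective_iff_map_eq_zero]
      intro z hz'
      obtain ⟨b, rfl⟩ := (h1 z).1 hz'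
      exact hz _ b
    · rw [hV', hV]
      constructor
      · rintro ⟨⟨a, rfl⟩, n, hn⟩
        have h3 : x ^ n • a = 0 := hθ (by rw [map_smul, hn, map_zero])
        obtain ⟨c, rfl⟩ := (h2 a).1 (hL.inj (x ^ n) ⟨n, rfl⟩ _ (by rw [← map_smul, h3, map_zero]))
        exact ⟨c, rfl⟩
      · rintro ⟨z, rfl⟩
        refine ⟨⟨δ z, rfl⟩, ?_⟩
        obtain ⟨s, ⟨n, rfl⟩, hn⟩ := hL.ker (δ z) (h2.apply_apply_eq_zero z)
        exact ⟨n, by rw [LinearMap.comp_apply, ← map_smul, hn, map_zero]⟩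

variable [IsNoetherianRing R]
variable {Efam : PrimeSpectrum R → Type u} [∀ p, AddCommGroup (Efam p)]
    [∀ p, Module R (Efam p)]
variable (hE : ∀ p : PrimeSpectrum R, IsInjectiveHull R (R ⧸ p.asIdeal) (Efam p))
variable (d : ∀ k, II Efam k →ₗ[R] II Efam (k + 1)) (hd : ∀ k, Function.Exact (d k) (d (k + 1)))
variable {G : Type u} [AddCommGroup G] [Module R G]

include hE hd in
lemma T_HH (x : ℕ → R) (k : ℕ)
    (hx : ∀ j, j ≤ k → ∀ q ∈ SS x j, (j : ℕ∞) ≤ Order.height q)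
    (h0 : ∀ i, ∀ z : TT P (i + 1) (LinearMap.ker (d 0)), z = 0)
    (h0' : Nonempty (TT P 0 (LinearMap.ker (d 0)) ≃ₗ[R] G))
    (hdiv : ∀ (W : Set (PrimeSpectrum R)) (r : R), ∀ y ∈ Gam W G, ∀ n : ℕ, ∃ y' ∈ Gam W G, ∃ m : ℕ, r ^ m • (y - r ^ n • y') = 0) :
    ∀ j, j ≤ k → (∀ i, i ≠ j → ∀ z : TT P i (HH d x j), z = 0) ∧
      ∃ θ : TT P j (HH d x j) →ₗ[R] G, Function.Injective θ ∧ ∀ y, y ∈ Gam (SS x j) G ↔ ∃ z, θ z = y := by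
  intro j
  induction j with
  | zero =>
    intro _
    have : HH d x 0 = LinearMap.ker (d 0) := by
      ext v; rw [mem_HH]; exact ⟨fun h => h.2, fun h => ⟨Gam_univ x v, h⟩⟩
    rw [this]
    obtain ⟨e⟩ := h0'
    refine ⟨fun i hi z => ?_, e.toLinearMap, e.injective, fun y => ⟨fun _ => e.surjective y, fun _ => Gam_univ x y⟩⟩
    obtain ⟨i, rfl⟩ : ∃ l, i = l + 1 := ⟨i - 1, by omega⟩
    exact h0 i z
  | succ j ih =>
    intro hj
    obtain ⟨hA, θ, hθ, hV⟩ := ih (by omega)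
    obtain ⟨b1, b2⟩ := HH'_bij hE d x j (hx (j + 1) hj)
    let δ : HH' d x j →ₗ[R] HH d x (j + 1) :=
      LinearMap.codRestrict _ (d j ∘ₗ (HH' d x j).subtype) (fun v => HH'_map d hd x j v.1 v.2)
    refine T_step P (Submodule.inclusion (HH_le d x j)) δ (Submodule.inclusion_injective _) ?_ ?_ (x j) ?_ j hA
      (Gam (SS x j) G) _ θ hθ hV (mem_Gam_SS_succ x j) (hdiv _ _)
    · intro w
      obtain ⟨v, hv, hvw⟩ := HH'_surj hE d hd x j w.1 w.2
      exact ⟨⟨v, hv⟩, Subtype.ext hvw⟩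
    · intro v
      constructor
      · intro h
        exact ⟨⟨v.1, (mem_HH d x).2 ⟨v.2.1, congrArg Subtype.val h⟩⟩, Subtype.ext rfl⟩
      · rintro ⟨w, rfl⟩
        exact Subtype.ext ((mem_HH d x).1 w.2).2
    · refine ⟨?_, ?_, ?_, ?_⟩
      · intro a ha
        exact ⟨1, Submonoid.one_mem _, by rw [one_smul]; exact Submodule.inclusion_injective _ (by rw [ha, map_zero])⟩
      · intro b
        obtain ⟨n, hn⟩ := HH'_pow d x b.2
        exact ⟨x j ^ n, ⟨n, rfl⟩, ⟨_, hn⟩, rfl⟩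
      · rintro s ⟨n, rfl⟩
        induction n with
        | zero => intro b h; simpa using h
        | succ n ihn =>
          intro b h
          simp only [pow_succ, mul_smul] at h
          have := ihn _ h
          exact Subtype.ext (b1 b.1 b.2 (congrArg Subtype.val this))
      · rintro s ⟨n, rfl⟩
        induction n with
        | zero => intro b; exact ⟨b, by simp⟩
        | succ n ihn =>
          intro b
          obtain ⟨v1, h1, h1'⟩ := b2 b.1 b.2
          obtain ⟨v2, h2⟩ := ihn ⟨v1, h1⟩
          refine ⟨v2, ?_⟩
          simp only [pow_succ', mul_smul] at h2 ⊢
          rw [h2]; exact Subtype.ext h1'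

/-- extension of localization maps -/
lemma loc_ext {S : Submonoid R} {A B T : Type u} [AddCommGroup A] [Module R A] [AddCommGroup B] [Module R B]
    [AddCommGroup T] [Module R T] (f : A →ₗ[R] T) (hf : Loc S f) (θ : A →ₗ[R] B)
    (hθ : Function.Injective θ) (h : ∀ b, ∃ s ∈ S, ∃ a, θ a = s • b) :
    ∃ l : B →ₗ[R] T, Loc S l := by
  have key : ∀ b, ∃ t, ∀ s ∈ S, ∀ a, θ a = s • b → f a = s • t := by
    intro b
    obtain ⟨s0, hs0, a0, h0⟩ := h b
    obtain ⟨t, ht⟩ := hf.surj s0 hs0 (f a0)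
    refine ⟨t, fun s hs a ha => ?_⟩
    have h1 : s0 • a = s • a0 := hθ (by rw [map_smul, map_smul, ha, h0, smul_comm])
    have h2 : s0 • (f a - s • t) = 0 := by
      rw [smul_sub, ← map_smul, h1, map_smul, ← ht, smul_comm, sub_self]
    exact sub_eq_zero.1 (hf.inj s0 hs0 _ h2)
  choose l hl using key
  have uniq : ∀ b s a t, s ∈ S → θ a = s • b → f a = s • t → l b = t := by
    intro b s a t hs ha ht
    have := hl b s hs a ha
    exact sub_eq_zero.1 (hf.inj s hs _ (by rw [smul_sub, ← this, ht, sub_self]))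
  let L : B →ₗ[R] T :=
    { toFun := l
      map_add' := by
        intro b b'
        obtain ⟨s, hs, a, ha⟩ := h b
        obtain ⟨s', hs', a', ha'⟩ := h b'
        refine uniq _ (s * s') (s' • a + s • a') _ (S.mul_mem hs hs') ?_ ?_
        · rw [map_add, map_smul, map_smul, ha, ha', smul_add, mul_smul, mul_smul, smul_comm]
        · rw [map_add, map_smul, map_smul, hl b s hs a ha, hl b' s' hs' a' ha', smul_add, mul_smul, mul_smul, smul_comm]
      map_smul' := by
        intro r b
        obtain ⟨s, hs, a, ha⟩ := h b
        refine uniq _ s (r • a) _ hs ?_ ?_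
        · rw [map_smul, ha, smul_comm]
        · rw [map_smul, hl b s hs a ha, smul_comm]; rfl }
  refine ⟨L, ?_, ?_, hf.inj, hf.surj⟩
  · intro b hb
    change l b = 0 at hb
    obtain ⟨s, hs, a, ha⟩ := h b
    have h1 := hl b s hs a ha
    rw [hb, smul_zero] at h1
    obtain ⟨s', hs', h2⟩ := hf.ker a h1
    exact ⟨s' * s, S.mul_mem hs' hs, by rw [mul_smul, ← ha, ← map_smul, h2, map_zero]⟩
  · intro t
    obtain ⟨s, hs, a, ha⟩ := hf.coker t
    refine ⟨s, hs, θ a, ?_⟩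
    exact uniq _ 1 a _ S.one_mem (by rw [one_smul]) (by rw [one_smul, ha])

omit [IsNoetherianRing R] in
lemma lt_height {p q : PrimeSpectrum R} (k : ℕ) (hp : Order.height p = k) (hqp : q ≤ p) (hq : (k : ℕ∞) ≤ Order.height q) :
    q = p := by
  by_contra hne
  have h1 : q < p := lt_of_le_of_ne hqp hne
  have h2 : Order.height q ≤ Order.height p := Order.height_mono hqp
  have h3 : Order.height q < Order.height p := Order.height_strictMono h1 (lt_of_le_of_lt h2 (by rw [hp]; exact ENat.coe_lt_top k))
  rw [hp] at h3
  exact absurd hq (not_le.2 h3)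

omit [IsNoetherianRing R] in
lemma loc_Gam (p : PrimeSpectrum R) (k : ℕ) (hp : Order.height p = k) (x : ℕ → R) (hx : ∀ i, i < k → x i ∈ p.asIdeal)
    (y : G) (hy : y ∈ Gam (WW R k) G) :
    ∀ j, j ≤ k → ∃ s, s ∉ p.asIdeal ∧ s • y ∈ Gam (SS x j) G := by
  intro j
  induction j with
  | zero => intro _; exact ⟨1, fun h => p.2.ne_top ((Ideal.eq_top_iff_one _).2 h), Gam_univ x _⟩
  | succ j ih =>
    intro hj
    obtain ⟨s, hs, h1⟩ := ih (by omega)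
    have : ∃ r, r ∉ p.asIdeal ∧ ∃ n : ℕ, (r * x j ^ n) • y = 0 := by
      by_contra hcon
      push Not at hcon
      let S : Submonoid R := p.asIdeal.primeCompl ⊔ Submonoid.powers (x j)
      have hdis : Disjoint ((LinearMap.toSpanSingleton R G y).ker : Set R) (S : Set R) := by
        rw [Set.disjoint_left]
        intro r hr hrS
        obtain ⟨a, ha, b, ⟨n, rfl⟩, rfl⟩ := Submonoid.mem_sup.1 hrS
        exact hcon a ha n hr
      obtain ⟨q, hq, hle, hqd⟩ := Ideal.exists_le_prime_disjoint _ S hdis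
      have hqp : q ≤ p.asIdeal := by
        intro r hr
        by_contra hrp
        exact Set.disjoint_left.1 hqd hr (Submonoid.mem_sup_left (show r ∈ p.asIdeal.primeCompl from hrp))
      have hxq : x j ∉ q := fun h => Set.disjoint_left.1 hqd h (Submonoid.mem_sup_right (Submonoid.mem_powers _))
      have := lt_height (q := ⟨q, hq⟩) k hp hqp (hy ⟨q, hq⟩ (fun r hr => hle hr))
      apply hxq
      have h3 : q = p.asIdeal := congrArg PrimeSpectrum.asIdeal this
      rw [h3]; exact hx j (by omega)
    obtain ⟨r, hr, n, hn⟩ := this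
    refine ⟨r * s, fun h => (p.2.mem_or_mem h).elim hr hs, ?_⟩
    rw [mem_Gam_SS_succ]
    refine ⟨by rw [mul_smul]; exact Submodule.smul_mem _ _ h1, n, ?_⟩
    rw [← mul_smul, show x j ^ n * (r * s) = s * (r * x j ^ n) by ring, mul_smul, hn, smul_zero]

include hE hd in
lemma T_E (p : PrimeSpectrum R) (k : ℕ) (hp : Order.height p = k)
    (h0 : ∀ i, ∀ z : TT P (i + 1) (LinearMap.ker (d 0)), z = 0)
    (h0' : Nonempty (TT P 0 (LinearMap.ker (d 0)) ≃ₗ[R] G))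
    (hdiv : ∀ (W : Set (PrimeSpectrum R)) (r : R), ∀ y ∈ Gam W G, ∀ n : ℕ, ∃ y' ∈ Gam W G, ∃ m : ℕ, r ^ m • (y - r ^ n • y') = 0) :
    ∃ l : Gam (WW R k) G →ₗ[R] TT P k (Efam p), Loc p.asIdeal.primeCompl l := by
  obtain ⟨x, hx1, hx2⟩ := exists_sop p k hp
  obtain ⟨-, θ, hθ, hV⟩ := T_HH P hE d hd x k hx2 h0 h0' hdiv k le_rfl
  obtain ⟨l1, l2⟩ := HH_loc hE d x p k hp hx1
  let q : {q : PrimeSpectrum R // Order.height q = (k : ℕ∞)} := ⟨p, hp⟩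
  let c : HH d x k →ₗ[R] Efam p :=
    (DFinsupp.lapply (M := fun q : {q : PrimeSpectrum R // Order.height q = (k : ℕ∞)} => Efam q.1) q) ∘ₗ (HH d x k).subtype
  have hc : Loc p.asIdeal.primeCompl c := by
    refine ⟨?_, ?_, ?_, ?_⟩
    · intro a ha
      obtain ⟨s, hs, h⟩ := l1 a.1 a.2 ha
      exact ⟨s, hs, Subtype.ext h⟩
    · intro e
      obtain ⟨v, hv, s, hs, h⟩ := l2 e
      exact ⟨s, hs, ⟨v, hv⟩, h⟩
    · intro s hs b h
      exact hull_inj (hE p) hs h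
    · intro s hs b
      exact hull_surj (hE p) hs b
  have hθ' : ∀ z, θ z ∈ Gam (WW R k) G := fun z =>
    Gam_mono (hx2 k le_rfl) ((hV _).2 ⟨z, rfl⟩)
  refine loc_ext _ (hc.T P k) (LinearMap.codRestrict _ θ hθ') (fun a b h => hθ (congrArg Subtype.val h)) ?_
  intro b
  obtain ⟨s, hs, h⟩ := loc_Gam p k hp x hx1 b.1 b.2 k le_rfl
  obtain ⟨z, hz⟩ := (hV _).1 h
  exact ⟨s, hs, z, Subtype.ext hz⟩

end T2
end GI

namespace GI
section T4
open scoped Classical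
variable {R : Type u} [CommRing R] [IsNoetherianRing R]
variable {G : Type u} [AddCommGroup G] [Module R G]

lemma glue (k : ℕ) (T : {p : PrimeSpectrum R // Order.height p = (k : ℕ∞)} → Type u)
    [∀ p, AddCommGroup (T p)] [∀ p, Module R (T p)]
    (l : ∀ p, Gam (WW R k) G →ₗ[R] T p) (hl : ∀ p, Loc p.1.asIdeal.primeCompl (l p))
    (hdiv : ∀ (p : PrimeSpectrum R), Order.height p = (k : ℕ∞) → ∀ s, s ∉ p.asIdeal → ∀ y ∈ Gam (WW R k) G,
      ∃ y' ∈ Gam {q | p ≤ q} G, ∃ t, t ∉ p.asIdeal ∧ t • (y - s • y') = 0) :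
    Nonempty (GQ (WW R k) (WW R (k + 1)) G ≃ₗ[R] DirectSum _ T) := by
  have l0 : ∀ p y, (∃ r, r ∉ p.1.asIdeal ∧ r • y = 0) → l p y = 0 := by
    rintro p y ⟨r, hr, h⟩
    exact (hl p).inj r hr _ (by rw [← map_smul, h, map_zero])
  have hfin : ∀ y, {p | l p y ≠ 0}.Finite := by
    intro y
    let I : Ideal R := (LinearMap.toSpanSingleton R G y.1).ker
    have h1 := Ideal.finite_minimalPrimes_of_isNoetherianRing R I
    refine Set.Finite.of_finite_image (f := fun p => p.1.asIdeal) (h1.subset ?_) ?_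
    · rintro _ ⟨p, hp, rfl⟩
      refine ⟨⟨p.1.2, ?_⟩, ?_⟩
      · intro r hr
        by_contra hrp
        exact hp (l0 p y ⟨r, hrp, Subtype.ext hr⟩)
      · rintro q ⟨hq, hqI⟩ hqp
        have := lt_height (q := ⟨q, hq⟩) k p.2 hqp (y.2 ⟨q, hq⟩ (fun r hr => hqI hr))
        exact (congrArg PrimeSpectrum.asIdeal this).ge
    · intro p _ q _ h
      exact Subtype.ext (PrimeSpectrum.ext h)
  let F0 : Gam (WW R k) G → DirectSum _ T := fun y => DFinsupp.mk (hfin y).toFinset (fun i => l i.1 y)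
  have hF0 : ∀ y p, F0 y p = l p y := by
    intro y p
    change DFinsupp.mk _ _ p = _
    rw [DFinsupp.mk_apply]
    split_ifs with h
    · rfl
    · by_contra h'
      exact h ((hfin y).mem_toFinset.2 (Ne.symm h'))
  let F : Gam (WW R k) G →ₗ[R] DirectSum _ T :=
    { toFun := F0
      map_add' := fun a b => DFinsupp.ext fun p => by
        rw [hF0, map_add, ← hF0, ← hF0]; rfl
      map_smul' := fun r a => DFinsupp.ext fun p => by
        rw [hF0, map_smul, ← hF0]; rfl }
  have hF : ∀ y p, F y p = l p y := hF0
  have hne : ∀ p q : {p : PrimeSpectrum R // Order.height p = (k : ℕ∞)}, p.1 ≤ q.1 → p = q := by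
    intro p q h
    exact Subtype.ext (lt_height k q.2 h p.2.ge)
  have hker : LinearMap.ker F = Submodule.comap (Gam (WW R k) G).subtype (Gam (WW R (k + 1)) G) := by
    ext y
    rw [LinearMap.mem_ker, Submodule.mem_comap]
    constructor
    · intro h p hp
      have h1 : (k : ℕ∞) ≤ Order.height p := y.2 p hp
      rcases h1.eq_or_lt with h2 | h2
      · exfalso
        have h3 : l ⟨p, h2.symm⟩ y = 0 := by rw [← hF, h]; rfl
        obtain ⟨s, hs, h4⟩ := (hl ⟨p, h2.symm⟩).ker y h3
        exact hs (hp s (congrArg Subtype.val h4))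
      · change ((k + 1 : ℕ) : ℕ∞) ≤ _
        push_cast
        exact Order.add_one_le_of_lt h2
    · intro h
      refine DFinsupp.ext fun p => ?_
      rw [hF]
      apply l0
      by_contra hcon
      push Not at hcon
      have h1 : ((k + 1 : ℕ) : ℕ∞) ≤ Order.height p.1 := h p.1 (fun r hr => by
        by_contra hrp
        exact hcon r hrp (Subtype.ext hr))
      rw [p.2] at h1
      have : k + 1 ≤ k := by exact_mod_cast h1
      omega
  have hsurj : Function.Surjective F := by
    rw [← LinearMap.range_eq_top, eq_top_iff]
    rintro v -
    induction v using DirectSum.induction_on with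
    | zero => exact zero_mem _
    | add a b ha hb => exact add_mem ha hb
    | of p t =>
      obtain ⟨s, hs, y, hy⟩ := (hl p).coker t
      obtain ⟨y', hy', r, hr, h⟩ := hdiv p.1 p.2 s hs y.1 y.2
      have hy'' : y' ∈ Gam (WW R k) G := Gam_mono (fun q (hq : p.1 ≤ q) => by
        change (k : ℕ∞) ≤ _
        rw [← p.2]; exact Order.height_mono hq) hy'
      refine ⟨⟨y', hy''⟩, DFinsupp.ext fun q => ?_⟩
      rw [hF]
      by_cases hpq : p = q
      · subst hpq
        change _ = DirectSum.of T p t p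
        rw [DirectSum.of_eq_same]
        have h1 : l p (y - s • ⟨y', hy''⟩) = 0 := l0 p _ ⟨r, hr, Subtype.ext h⟩
        rw [map_sub, map_smul, hy, ← smul_sub] at h1
        exact (sub_eq_zero.1 ((hl p).inj s hs _ h1)).symm
      · change _ = DirectSum.of T p t q
        rw [DirectSum.of_eq_of_ne _ _ _ (Ne.symm hpq)]
        apply l0
        by_contra hcon
        push Not at hcon
        exact hpq (hne p q (hy' q.1 (fun r hr => by
          by_contra hrp
          exact hcon r hrp (Subtype.ext hr))))
  exact ⟨(Submodule.quotEquivOfEq _ _ hker.symm).trans (LinearMap.quotKerEquivOfSurjective F hsurj)⟩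

lemma GQ_Tor {Efam : PrimeSpectrum R → Type u} [∀ p, AddCommGroup (Efam p)] [∀ p, Module R (Efam p)]
    (hE : ∀ p : PrimeSpectrum R, IsInjectiveHull R (R ⧸ p.asIdeal) (Efam p))
    (D : Type u) [AddCommGroup D] [Module R D] (hD : IsDualizingModule R D)
    (dim : ℕ) (hdim : ringKrullDim R = (dim : ℕ)) (hG : IsGorensteinInjective R G) (k : ℕ) :
    Nonempty (GQ (WW R k) (WW R (k + 1)) G ≃ₗ[R]
      DirectSum {p : PrimeSpectrum R // Order.height p = (k : ℕ∞)} (fun p =>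
        ↥(((Tor (ModuleCat.{u} R) k).obj (ModuleCat.of R (Efam p))).obj
              (ModuleCat.of R (D →ₗ[R] G))))) := by
  obtain ⟨K, hKD, hKR, φ, hφ, hcov⟩ := cover hE D hD dim hdim hG
  obtain ⟨η, d, hη, hηd, hd⟩ := resolution hE D hD
  let P : ProjectiveResolution (ModuleCat.of R (D →ₗ[R] G)) := Classical.choice (HasProjectiveResolution.out)
  let e : D ≃ₗ[R] LinearMap.ker (d 0) :=
    (LinearEquiv.ofInjective η hη).trans (LinearEquiv.ofEq _ _ (by rw [hηd.linearMap_ker_eq]))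
  have h0 : ∀ i, ∀ z : TT P (i + 1) (LinearMap.ker (d 0)), z = 0 := by
    intro i z
    obtain ⟨w, rfl⟩ := (Tequiv P (i + 1) e).surjective z
    rw [DD_T φ hφ P hKD i D (DD_D hD hKR) w, map_zero]
  have h0' : Nonempty (TT P 0 (LinearMap.ker (d 0)) ≃ₗ[R] G) := by
    obtain ⟨e'⟩ := T0_D φ hφ P hKD hD hKR
    exact ⟨(Tequiv P 0 e).symm.trans e'⟩
  have hdiv : ∀ (W : Set (PrimeSpectrum R)) (r : R), ∀ y ∈ Gam W G, ∀ n : ℕ, ∃ y' ∈ Gam W G,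
      ∃ m : ℕ, r ^ m • (y - r ^ n • y') = 0 := by
    intro W r y hy n
    obtain ⟨v, hv, rfl⟩ := hcov W y hy
    obtain ⟨ψ, hψ⟩ := psi_pow hE (K.inj (-1 + 1 + 1)) r n
    obtain ⟨m, hm⟩ := hψ v
    refine ⟨φ (ψ v), Gam_map _ (Gam_map _ hv), m, ?_⟩
    rw [← map_smul, ← map_sub, ← map_smul, hm, map_zero]
  have hl := fun p : {p : PrimeSpectrum R // Order.height p = (k : ℕ∞)} =>
    T_E P hE d hd p.1 k p.2 h0 h0' hdiv
  choose l hl using hl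
  obtain ⟨e2⟩ := glue k (fun p => TT P k (Efam p.1)) l hl (by
    intro p hp s hs y hy
    obtain ⟨v, hv, rfl⟩ := hcov _ y hy
    obtain ⟨v', hv', t, ht, h⟩ := J3 Efam hE _ (K.inj (-1 + 1 + 1)) (WW R k) p
      (fun q hq hqp => lt_height k hp hqp hq) s hs v hv
    refine ⟨φ v', Gam_map _ hv', t, ht, ?_⟩
    rw [← map_smul, ← map_sub, ← map_smul, h, map_zero])
  exact ⟨e2.trans (DFinsupp.mapRange.linearEquiv (fun p => (TT_Tor P k (Efam p.1)).symm))⟩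

end T4
end GI
open DirectSum in
/-- filtration of a Gorenstein injective module with successive quotients
the direct sums `⊕_{ht p = k} Tor_k^R(E(R/p), Hom_R(D,G))`, all Gorenstein injective. -/
theorem gorensteinInjective_filtration_via_tor
    {R : Type u} [CommRing R] [IsNoetherianRing R]
    (D : Type u) [AddCommGroup D] [Module R D] (hD : IsDualizingModule R D)
    (d : ℕ) (hdim : ringKrullDim R = (d : ℕ))
    (G : Type u) [AddCommGroup G] [Module R G] (hG : IsGorensteinInjective R G)
    (Efam : PrimeSpectrum R → Type u)
    [∀ p, AddCommGroup (Efam p)] [∀ p, Module R (Efam p)]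
    (hEfam : ∀ p : PrimeSpectrum R, IsInjectiveHull R (R ⧸ p.asIdeal) (Efam p)) :
    ∃ Gs : ℕ → Submodule R G,
      Gs (d + 1) = ⊥ ∧
      Gs 0 = ⊤ ∧
      (∀ k, k ≤ d → Gs (k + 1) ≤ Gs k) ∧
      (∀ k, k ≤ d + 1 → IsGorensteinInjective R (Gs k)) ∧
      (∀ k, k ≤ d →
        IsGorensteinInjective R
          (↥(Gs k) ⧸ Submodule.comap (Gs k).subtype (Gs (k + 1))) ∧
        Nonempty ((↥(Gs k) ⧸ Submodule.comap (Gs k).subtype (Gs (k + 1))) ≃ₗ[R]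
          ⨁ (p : {p : PrimeSpectrum R // Order.height p = (k : ℕ∞)}),
            ↥(((Tor (ModuleCat.{u} R) k).obj (ModuleCat.of R (Efam p))).obj
              (ModuleCat.of R (D →ₗ[R] G))))) := by
  have hst : ∀ k, GI.Stab (GI.WW R k) := fun k p q hp hpq =>
    le_trans (show (k : ℕ∞) ≤ Order.height p from hp) (Order.height_mono hpq)
  have hle : ∀ k, GI.WW R (k + 1) ⊆ GI.WW R k := fun k p hp =>
    le_trans (by exact_mod_cast Nat.le_succ k) (show ((k + 1 : ℕ) : ℕ∞) ≤ Order.height p from hp)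
  refine ⟨fun k => GI.Gam (GI.WW R k) G, ?_, ?_, ?_, ?_, ?_⟩
  · have : GI.WW R (d + 1) = ∅ := by
      rw [Set.eq_empty_iff_forall_notMem]
      intro p hp
      have h1 := le_trans (show ((d + 1 : ℕ) : ℕ∞) ≤ Order.height p from hp) (GI.height_bdd d hdim p)
      have : d + 1 ≤ d := by exact_mod_cast h1
      omega
    simp only [this]
    exact GI.Gam_empty G
  · rw [eq_top_iff]
    intro y _ p _
    change ((0 : ℕ) : ℕ∞) ≤ _
    simp
  · intro k _
    exact GI.Gam_mono (hle k)
  · intro k _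
    exact GI.GI_Gam hEfam D hD d hdim hG _ (hst k)
  · intro k _
    exact ⟨GI.GI_GQ hEfam D hD d hdim hG _ _ (hst k) (hst (k + 1)) (hle k),
      GI.GQ_Tor hEfam D hD d hdim hG k⟩
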